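/- Let n ≥ 3, m ≥ 2, and for each ε ∈ (0, 4/(n−2)) let u_ε be a radial Neumann solution with exactly m−1 interior zeros, with zeros ρ_{k,ε} and critical points δ_{k,ε}. Then, as ε → 0⁺: (i) |u_ε(δ_{k,ε})|·(κ_n ε)^{(2kn−3n+2)/(2n)} → (n(n−2))^{(n−2)/4}·(m−1)^{1/2−1/n}·Γ(m−k+1)/Γ(m) for every k ∈ {1,…,m}; (ii) δ_{k,ε}·(κ_n ε)^{−2(k−1)/(n−2)} → (m−1)^{−1/n}·(m−k)^{1/n}·(Γ(m)/Γ(m−k+1))^{2/(n−2)} for every k ∈ {2,…,m−1}; (iii) |u_ε'(ρ_{k,ε})|·(κ_n ε)^{(2kn−3n+4)/(2(n−2))} → n^{(n−2)/4}·(n−2)^{(n+2)/4}·(m−1)^{1/2}·(m−k)^{−1/(n−2)}·(Γ(m−k+1)/Γ(m))^{n/(n−2)} for every k ∈ {1,…,m−1}; (iv) ρ_{k,ε}·(κ_n ε)^{−(2kn−2n+2)/(n(n−2))} → (m−1)^{−1/n}·(m−k)^{1/(n−2)}·(Γ(m)/Γ(m−k+1))^{2/(n−2)} for every k ∈ {1,…,m−1}.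 -/

import Mathlib

open Real Set Filter Topology MeasureTheory

noncomputable section

/-- `κ_n = ((n-2)/4) · Γ(n/2)² / Γ(n)`. -/
def kappa (n : ℕ) : ℝ :=
  (((n : ℝ) - 2) / 4) * Real.Gamma ((n : ℝ) / 2) ^ 2 / Real.Gamma (n : ℝ)

/-- `p_ε = (n+2)/(n-2) - ε`. -/
def pEps (n : ℕ) (ε : ℝ) : ℝ := ((n : ℝ) + 2) / ((n : ℝ) - 2) - ε

/-- `u ∈ C²([0,1])` is a radial solution of `-Δu = |u|^{p-1} u` on the unit ball of `ℝⁿ`,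
written in the radial variable: `(r^{n-1} u')' = -|u|^{p-1} u · r^{n-1}` on `(0,1]`,
with `u'(0) = 0`. -/
def IsRadialSolution (n : ℕ) (p : ℝ) (u : ℝ → ℝ) : Prop :=
  ContDiffOn ℝ 2 u (Set.Icc 0 1) ∧ deriv u 0 = 0 ∧
    ∀ r ∈ Set.Ioc (0 : ℝ) 1,
      deriv (fun s => s ^ (n - 1) * deriv u s) r = -(|u r| ^ (p - 1) * u r * r ^ (n - 1))

/-- Radial Dirichlet solution with exactly `m-1` interior zeros, together with the
decreasing enumeration of its zeros `ρ 1 = 1 > ρ 2 > … > ρ m > 0` in `(0,1]` and of its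
critical points `1 > δ 1 > … > δ m = 0` in `[0,1]`, interlaced as
`0 = δ m < ρ m < δ (m-1) < … < δ 1 < ρ 1 = 1`. -/
def DirichletData (n : ℕ) (p : ℝ) (m : ℕ) (u : ℝ → ℝ) (ρ δ : ℕ → ℝ) : Prop :=
  IsRadialSolution n p u ∧ u 1 = 0 ∧ ρ 1 = 1 ∧ δ m = 0 ∧
    (∀ k, 1 ≤ k → k ≤ m → δ k < ρ k) ∧
    (∀ k, 1 ≤ k → k + 1 ≤ m → ρ (k + 1) < δ k) ∧
    {r : ℝ | r ∈ Set.Ioc (0 : ℝ) 1 ∧ u r = 0} = ρ '' Set.Icc 1 m ∧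
    {r : ℝ | r ∈ Set.Icc (0 : ℝ) 1 ∧ deriv u r = 0} = δ '' Set.Icc 1 m

/-- Radial Neumann solution with exactly `m-1` interior zeros, together with the
decreasing enumeration of its zeros `1 > ρ 1 > … > ρ (m-1) > 0` in `(0,1)` and of its
critical points `δ 1 = 1 > δ 2 > … > δ m = 0` in `[0,1]`, interlaced as
`0 = δ m < ρ (m-1) < δ (m-1) < … < ρ 1 < δ 1 = 1`. -/
def NeumannData (n : ℕ) (p : ℝ) (m : ℕ) (u : ℝ → ℝ) (ρ δ : ℕ → ℝ) : Prop :=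
  IsRadialSolution n p u ∧ deriv u 1 = 0 ∧ δ 1 = 1 ∧ δ m = 0 ∧
    (∀ k, 1 ≤ k → k ≤ m - 1 → ρ k < δ k) ∧
    (∀ k, 1 ≤ k → k ≤ m - 1 → δ (k + 1) < ρ k) ∧
    {r : ℝ | r ∈ Set.Ioo (0 : ℝ) 1 ∧ u r = 0} = ρ '' Set.Icc 1 (m - 1) ∧
    {r : ℝ | r ∈ Set.Icc (0 : ℝ) 1 ∧ deriv u r = 0} = δ '' Set.Icc 1 m

/-- A nontrivial radial Dirichlet solution with exactly `m-1` interior zeros. -/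
def DirichletSol (n : ℕ) (p : ℝ) (m : ℕ) (u : ℝ → ℝ) : Prop :=
  IsRadialSolution n p u ∧ u 1 = 0 ∧ (∃ r ∈ Set.Icc (0 : ℝ) 1, u r ≠ 0) ∧
    ∃ Z : Finset ℝ, (Z : Set ℝ) = {r | r ∈ Set.Ioo (0 : ℝ) 1 ∧ u r = 0} ∧ Z.card = m - 1

/-- A nontrivial radial Neumann solution with exactly `m-1` interior zeros. -/
def NeumannSol (n : ℕ) (p : ℝ) (m : ℕ) (u : ℝ → ℝ) : Prop :=
  IsRadialSolution n p u ∧ deriv u 1 = 0 ∧ (∃ r ∈ Set.Icc (0 : ℝ) 1, u r ≠ 0) ∧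
    ∃ Z : Finset ℝ, (Z : Set ℝ) = {r | r ∈ Set.Ioo (0 : ℝ) 1 ∧ u r = 0} ∧ Z.card = m - 1

/-! ### Part A: positive arcs of the Emden-Fowler flow -/

theorem mono_of_hd {f f' : ℝ → ℝ} {x y : ℝ} (hxy : x ≤ y) (hc : ContinuousOn f (Icc x y))
    (hd : ∀ r ∈ Ioo x y, HasDerivAt f (f' r) r) (h0 : ∀ r ∈ Ioo x y, 0 ≤ f' r) : f x ≤ f y := by
  have := monotoneOn_of_hasDerivWithinAt_nonneg (convex_Icc x y) hc (f' := f')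
    (fun r hr => by rw [interior_Icc] at hr ⊢; exact (hd r hr).hasDerivWithinAt)
    (fun r hr => by rw [interior_Icc] at hr; exact h0 r hr)
  exact this (left_mem_Icc.2 hxy) (right_mem_Icc.2 hxy) hxy

theorem anti_of_hd {f f' : ℝ → ℝ} {x y : ℝ} (hxy : x ≤ y) (hc : ContinuousOn f (Icc x y))
    (hd : ∀ r ∈ Ioo x y, HasDerivAt f (f' r) r) (h0 : ∀ r ∈ Ioo x y, f' r ≤ 0) : f y ≤ f x := by
  have := mono_of_hd (f := fun r => - f r) (f' := fun r => - f' r) hxy hc.neg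
    (fun r hr => (hd r hr).neg) (fun r hr => by have := h0 r hr; simpa using this)
  linarith

/-- A positive arc of the radial equation on `[x, y]`; `W` plays the role of the derivative of `U`. -/
structure Arc (lam η x y : ℝ) (U W : ℝ → ℝ) : Prop where
  hlam : 0 < lam
  hη : 0 < η
  hηl : η < lam
  hx : 0 ≤ x
  hxy : x < y
  cU : ContinuousOn U (Icc x y)
  cW : ContinuousOn W (Icc x y)
  dU : ∀ r ∈ Ioo x y, HasDerivAt U (W r) r
  dW : ∀ r ∈ Ioo x y,
    HasDerivAt W (-((2 * lam + 1) / r * W r) - U r ^ (1 + 2 / (lam + η))) r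
  pos : ∀ r ∈ Ioo x y, 0 < U r

def fV (lam η : ℝ) (U : ℝ → ℝ) (r : ℝ) : ℝ := r ^ (lam + η) * U r

def fP (lam η : ℝ) (U W : ℝ → ℝ) (r : ℝ) : ℝ :=
  (lam + η) * fV lam η U r + r ^ (lam + η) * (r * W r)

/-- The energy as a function of the phase plane variables. -/
def en (lam η P V : ℝ) : ℝ :=
  P ^ 2 / 2 - (lam ^ 2 - η ^ 2) * V ^ 2 / 2 + V ^ (2 + 2 / (lam + η)) / (2 + 2 / (lam + η))

def fE (lam η : ℝ) (U W : ℝ → ℝ) (r : ℝ) : ℝ := en lam η (fP lam η U W r) (fV lam η U r)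

def fN (lam : ℝ) (U W : ℝ → ℝ) (r : ℝ) : ℝ := 2 * lam * U r + r * W r

namespace Arc

variable {lam η x y : ℝ} {U W : ℝ → ℝ}

theorem ha (h : Arc lam η x y U W) : 0 < lam + η := by linarith [h.hlam, h.hη]

theorem rpos (h : Arc lam η x y U W) {r : ℝ} (hr : r ∈ Ioo x y) : 0 < r :=
  lt_of_le_of_lt h.hx hr.1

theorem U_nonneg (h : Arc lam η x y U W) {r : ℝ} (hr : r ∈ Icc x y) : 0 ≤ U r := by
  have hcl : Icc x y = closure (Ioo x y) := (closure_Ioo h.hxy.ne).symm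
  have h1 : ContinuousOn U (closure (Ioo x y)) := hcl ▸ h.cU
  have := h1.image_closure
  have h2 : U r ∈ closure (U '' Ioo x y) := this ⟨r, hcl ▸ hr, rfl⟩
  have h3 : closure (U '' Ioo x y) ⊆ Ici 0 := by
    apply closure_minimal _ isClosed_Ici
    rintro _ ⟨s, hs, rfl⟩
    exact (h.pos s hs).le
  exact h3 h2

theorem V_pos (h : Arc lam η x y U W) {r : ℝ} (hr : r ∈ Ioo x y) : 0 < fV lam η U r :=
  mul_pos (rpow_pos_of_pos (h.rpos hr) _) (h.pos r hr)

theorem V_nonneg (h : Arc lam η x y U W) {r : ℝ} (hr : r ∈ Icc x y) : 0 ≤ fV lam η U r :=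
  mul_nonneg (rpow_nonneg (h.hx.trans hr.1) _) (h.U_nonneg hr)

theorem cV (h : Arc lam η x y U W) : ContinuousOn (fV lam η U) (Icc x y) := by
  apply ContinuousOn.mul _ h.cU
  exact (continuous_id.rpow_const (fun _ => Or.inr h.ha.le)).continuousOn

theorem cP (h : Arc lam η x y U W) : ContinuousOn (fP lam η U W) (Icc x y) := by
  apply ContinuousOn.add (continuousOn_const.mul h.cV)
  exact (continuous_id.rpow_const (fun _ => Or.inr h.ha.le)).continuousOn.mul
    (continuousOn_id.mul h.cW)

theorem cE (h : Arc lam η x y U W) : ContinuousOn (fE lam η U W) (Icc x y) := by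
  have h1 : 0 ≤ 2 + 2 / (lam + η) := by have := h.ha; positivity
  unfold fE en
  apply ContinuousOn.add
  · exact ((h.cP.pow 2).div_const 2).sub ((continuousOn_const.mul (h.cV.pow 2)).div_const 2)
  · exact (h.cV.rpow_const (fun _ _ => Or.inr h1)).div_const _

theorem cN (h : Arc lam η x y U W) : ContinuousOn (fN lam U W) (Icc x y) :=
  (continuousOn_const.mul h.cU).add (continuousOn_id.mul h.cW)

theorem dV (h : Arc lam η x y U W) {r : ℝ} (hr : r ∈ Ioo x y) :
    HasDerivAt (fV lam η U) (fP lam η U W r / r) r := by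
  have r0 := h.rpos hr
  have h1 := (hasDerivAt_rpow_const (p := lam + η) (Or.inl r0.ne')).mul (h.dU r hr)
  refine h1.congr_deriv ?_
  unfold fP fV
  rw [rpow_sub_one r0.ne']
  field_simp

theorem pow_key (h : Arc lam η x y U W) {r : ℝ} (hr : r ∈ Ioo x y) :
    r ^ (lam + η) * (r ^ 2 * U r ^ (1 + 2 / (lam + η))) = fV lam η U r ^ (1 + 2 / (lam + η)) := by
  have r0 := h.rpos hr
  have := h.ha
  unfold fV
  rw [mul_rpow (rpow_nonneg r0.le _) (h.pos r hr).le, ← rpow_mul r0.le]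
  have : (lam + η) * (1 + 2 / (lam + η)) = lam + η + 2 := by field_simp
  rw [this, rpow_add r0 (lam + η) 2, rpow_two]
  ring

theorem dP (h : Arc lam η x y U W) {r : ℝ} (hr : r ∈ Ioo x y) :
    HasDerivAt (fP lam η U W) ((2 * η * fP lam η U W r + (lam ^ 2 - η ^ 2) * fV lam η U r
      - fV lam η U r ^ (1 + 2 / (lam + η))) / r) r := by
  have r0 := h.rpos hr
  have h1 := ((h.dV hr).const_mul (lam + η)).add
    ((hasDerivAt_rpow_const (p := lam + η) (Or.inl r0.ne')).mul
      ((hasDerivAt_id r).mul (h.dW r hr)))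
  refine h1.congr_deriv ?_
  rw [← h.pow_key hr]
  unfold fP fV
  rw [rpow_sub_one r0.ne']
  simp only [id, Pi.mul_apply]
  field_simp
  ring

theorem dE (h : Arc lam η x y U W) {r : ℝ} (hr : r ∈ Ioo x y) :
    HasDerivAt (fE lam η U W) (2 * η * fP lam η U W r ^ 2 / r) r := by
  have r0 := h.rpos hr
  have hq : (2 + 2 / (lam + η)) ≠ 0 := by have := h.ha; positivity
  have h1 := ((((h.dP hr).pow 2).div_const 2).sub
    ((((h.dV hr).pow 2).const_mul (lam ^ 2 - η ^ 2)).div_const 2)).add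
    (((h.dV hr).rpow_const (p := 2 + 2 / (lam + η)) (Or.inl (h.V_pos hr).ne')).div_const
      (2 + 2 / (lam + η)))
  refine h1.congr_deriv ?_
  have : 2 + 2 / (lam + η) - 1 = 1 + 2 / (lam + η) := by ring
  rw [this]
  generalize fV lam η U r ^ (1 + 2 / (lam + η)) = X
  generalize (2 + 2 / (lam + η)) = q at hq
  simp only [Nat.cast_ofNat, Nat.add_one_sub_one, pow_one]
  field_simp
  ring

theorem dN (h : Arc lam η x y U W) {r : ℝ} (hr : r ∈ Ioo x y) :
    HasDerivAt (fN lam U W) (-(r * U r ^ (1 + 2 / (lam + η)))) r := by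
  have r0 := h.rpos hr
  have h1 := ((h.dU r hr).const_mul (2 * lam)).add ((hasDerivAt_id r).mul (h.dW r hr))
  refine h1.congr_deriv ?_
  simp only [id]
  field_simp
  ring

theorem E_mono (h : Arc lam η x y U W) {s t : ℝ} (hs : s ∈ Icc x y) (ht : t ∈ Icc x y)
    (hst : s ≤ t) : fE lam η U W s ≤ fE lam η U W t := by
  apply mono_of_hd hst (h.cE.mono (Icc_subset_Icc hs.1 ht.2))
    (fun r hr => h.dE ⟨hs.1.trans_lt hr.1, hr.2.trans_le ht.2⟩)
  intro r hr
  have := h.rpos (r := r) ⟨hs.1.trans_lt hr.1, hr.2.trans_le ht.2⟩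
  have := h.hη
  positivity

/-- At an interior critical point of `V` where the energy is nonnegative, `P` has negative derivative. -/
theorem crit_neg (h : Arc lam η x y U W) {r : ℝ} (hr : r ∈ Ioo x y)
    (hE : 0 ≤ fE lam η U W r) (hP : fP lam η U W r = 0) :
    (2 * η * fP lam η U W r + (lam ^ 2 - η ^ 2) * fV lam η U r
      - fV lam η U r ^ (1 + 2 / (lam + η))) / r < 0 := by
  have r0 := h.rpos hr
  have ha := h.ha
  have hV := h.V_pos hr
  rw [hP]
  unfold fE en at hE
  rw [hP] at hE
  set V := fV lam η U r
  have e1 : V ^ (2 + 2 / (lam + η)) = V ^ (1 + 2 / (lam + η)) * V := by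
    rw [← rpow_add_one hV.ne']; congr 1; ring
  rw [e1] at hE
  have hX : 0 < V ^ (1 + 2 / (lam + η)) := rpow_pos_of_pos hV _
  set X := V ^ (1 + 2 / (lam + η))
  have hq : 2 < 2 + 2 / (lam + η) := by have : 0 < 2 / (lam + η) := by positivity
                                        linarith
  set q := 2 + 2 / (lam + η)
  apply div_neg_of_neg_of_pos _ r0
  have h2 : X * V / q < X * V / 2 := by
    apply div_lt_div_of_pos_left _ (by norm_num) hq
    positivity
  have h3 : (lam ^ 2 - η ^ 2) * V * V < X * V := by nlinarith
  have := lt_of_mul_lt_mul_right h3 hV.le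
  linarith

theorem ge_left (h : Arc lam η x y U W) {f : ℝ → ℝ} (hf : ContinuousOn f (Icc x y)) {b : ℝ}
    (hb : b ∈ Ioc x y) (hpos : ∀ r ∈ Ioo x b, 0 ≤ f r) : 0 ≤ f x := by
  have h1 : Tendsto f (𝓝[>] x) (𝓝 (f x)) := by
    have := (hf x (left_mem_Icc.2 h.hxy.le)).tendsto
    refine this.mono_left ?_
    rw [← nhdsWithin_Ioo_eq_nhdsGT h.hxy]
    exact nhdsWithin_mono _ Ioo_subset_Icc_self
  apply ge_of_tendsto h1
  filter_upwards [Ioo_mem_nhdsGT hb.1] with r hr using hpos r hr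

theorem P_nonneg (h : Arc lam η x y U W) (hE : 0 ≤ fE lam η U W x) {b : ℝ} (hb : b ∈ Icc x y)
    (hPb : 0 ≤ fP lam η U W b) (hb2 : b < y ∨ 0 < fP lam η U W b) :
    ∀ r ∈ Icc x b, 0 ≤ fP lam η U W r := by
  have E0 : ∀ r ∈ Icc x y, 0 ≤ fE lam η U W r := fun r hr =>
    hE.trans (h.E_mono (left_mem_Icc.2 h.hxy.le) hr hr.1)
  have key : ∀ b < y, 0 ≤ fP lam η U W b → ∀ x' ∈ Ioc x b, 0 ≤ fP lam η U W x' := by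
    intro b hby hPb x' hx'
    have hmap : ∀ t ∈ Icc (-b) (-x'), -t ∈ Ioo x y := by
      intro t ht
      constructor <;> linarith [ht.1, ht.2, hx'.1, hx'.2]
    have := image_le_of_deriv_right_lt_deriv_boundary' (f := fun t => - fP lam η U W (-t))
      (f' := fun t => (2 * η * fP lam η U W (-t) + (lam ^ 2 - η ^ 2) * fV lam η U (-t)
      - fV lam η U (-t) ^ (1 + 2 / (lam + η))) / (-t)) (a := -b) (b := -x')
      (B := fun _ => 0) (B' := fun _ => 0) ?_ ?_ ?_ continuousOn_const ?_ ?_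
      (x := -x') (right_mem_Icc.2 (by linarith [hx'.2]))
    · simpa using this
    · apply ContinuousOn.neg
      apply h.cP.comp continuousOn_neg
      intro t ht
      exact Ioo_subset_Icc_self (hmap t ht)
    · intro t ht
      have h1 := (h.dP (hmap t (Ico_subset_Icc_self ht)))
      have h2 := (h1.comp t (hasDerivAt_neg t)).neg
      refine (h2.congr_deriv ?_).hasDerivWithinAt
      ring
    · simpa using hPb
    · intro t _
      exact (hasDerivAt_const t (0 : ℝ)).hasDerivWithinAt
    · intro t ht h0
      have hm := hmap t (Ico_subset_Icc_self ht)
      exact h.crit_neg hm (E0 _ (Ioo_subset_Icc_self hm)) (by simpa using h0)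
  have key2 : ∀ x' ∈ Ioc x b, 0 ≤ fP lam η U W x' := by
    intro x' hx'
    by_cases hby : b < y
    · exact key b hby hPb x' hx'
    have hbe : b = y := le_antisymm hb.2 (not_lt.1 hby)
    subst hbe
    have hpos : 0 < fP lam η U W b := hb2.resolve_left hby
    rcases hx'.2.eq_or_lt with rfl | hlt
    · exact hPb
    have h1 : Tendsto (fP lam η U W) (𝓝[<] b) (𝓝 (fP lam η U W b)) := by
      refine (h.cP b (right_mem_Icc.2 h.hxy.le)).tendsto.mono_left ?_
      rw [← nhdsWithin_Ioo_eq_nhdsLT h.hxy]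
      exact nhdsWithin_mono _ Ioo_subset_Icc_self
    obtain ⟨b', hb'1, hb'2⟩ := ((h1.eventually (lt_mem_nhds hpos)).and (Ioo_mem_nhdsLT hlt)).exists
    exact key b' hb'2.2 hb'1.le x' ⟨hx'.1, hb'2.1.le⟩
  intro r hr
  rcases hr.1.eq_or_lt with rfl | hlt
  · rcases hb.1.eq_or_lt with rfl | hlt
    · exact hPb
    · exact h.ge_left h.cP ⟨hlt, hb.2⟩ (fun s hs => key2 s ⟨hs.1, hs.2.le⟩)
  · exact key2 r ⟨hlt, hr.2⟩

theorem P_nonpos (h : Arc lam η x y U W) (hE : 0 ≤ fE lam η U W x) {b : ℝ} (hb : b ∈ Ioo x y)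
    (hPb : fP lam η U W b ≤ 0) :
    ∀ r ∈ Icc b y, fP lam η U W r ≤ 0 := by
  have E0 : ∀ r ∈ Icc x y, 0 ≤ fE lam η U W r := fun r hr =>
    hE.trans (h.E_mono (left_mem_Icc.2 h.hxy.le) hr hr.1)
  have hmap : ∀ t ∈ Ico b y, t ∈ Ioo x y := fun t ht => ⟨hb.1.trans_le ht.1, ht.2⟩
  refine image_le_of_deriv_right_lt_deriv_boundary' (f := fP lam η U W)
      (f' := fun t => (2 * η * fP lam η U W t + (lam ^ 2 - η ^ 2) * fV lam η U t
      - fV lam η U t ^ (1 + 2 / (lam + η))) / t) (a := b) (b := y)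
      (B := fun _ => 0) (B' := fun _ => 0) ?_ ?_ ?_ continuousOn_const ?_ ?_
  · exact h.cP.mono (Icc_subset_Icc_left hb.1.le)
  · intro t ht
    exact (h.dP (hmap t ht)).hasDerivWithinAt
  · exact hPb
  · intro t _
    exact (hasDerivAt_const t (0 : ℝ)).hasDerivWithinAt
  · intro t ht h0
    have hm := hmap t ht
    exact h.crit_neg hm (E0 _ (Ioo_subset_Icc_self hm)) h0

theorem E_nonneg_left (hV : fV lam η U x = 0) (h : Arc lam η x y U W) : 0 ≤ fE lam η U W x := by
  unfold fE en
  rw [hV, zero_rpow (by have := h.ha; positivity)]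
  have := sq_nonneg (fP lam η U W x)
  simp only [zero_div, add_zero]
  linarith

/-- Peak of a full bump. -/
theorem exists_peak (h : Arc lam η x y U W) (hVx : fV lam η U x = 0) (hVy : fV lam η U y = 0) :
    ∃ b ∈ Ioo x y, fP lam η U W b = 0 ∧ (∀ r ∈ Icc x b, 0 ≤ fP lam η U W r) ∧
      (∀ r ∈ Icc b y, fP lam η U W r ≤ 0) ∧ (∀ r ∈ Icc x y, fV lam η U r ≤ fV lam η U b) := by
  obtain ⟨b, hb, hmax⟩ := isCompact_Icc.exists_isMaxOn (nonempty_Icc.2 h.hxy.le) h.cV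
  have hmid : (x + y) / 2 ∈ Ioo x y := by constructor <;> linarith [h.hxy]
  have hpos : 0 < fV lam η U b := (h.V_pos hmid).trans_le (hmax (Ioo_subset_Icc_self hmid))
  have hb1 : b ∈ Ioo x y := by
    refine ⟨lt_of_le_of_ne hb.1 ?_, lt_of_le_of_ne hb.2 ?_⟩
    · rintro rfl; linarith
    · rintro rfl; linarith
  have hloc : IsLocalMax (fV lam η U) b := hmax.isLocalMax (Icc_mem_nhds hb1.1 hb1.2)
  have h0 := hloc.hasDerivAt_eq_zero (h.dV hb1)
  have hP : fP lam η U W b = 0 := by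
    rcases div_eq_zero_iff.1 h0 with h1 | h1
    · exact h1
    · exact absurd h1 (h.rpos hb1).ne'
  have hE := E_nonneg_left hVx h
  exact ⟨b, hb1, hP, h.P_nonneg hE hb hP.ge (Or.inl hb1.2), h.P_nonpos hE hb1 hP.le, hmax⟩

/-- Energy gain along a monotone piece, upper bound. -/
theorem gain_le (h : Arc lam η x y U W) {s t ς : ℝ} (hς : ς = 1 ∨ ς = -1)
    (hs : s ∈ Icc x y) (ht : t ∈ Icc x y) (hst : s ≤ t)
    (hP : ∀ r ∈ Ioo s t, 0 ≤ ς * fP lam η U W r) {g : ℝ → ℝ} (hg : Continuous g)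
    (hb : ∀ r ∈ Ioo s t, |fP lam η U W r| ≤ g (fV lam η U r)) :
    fE lam η U W t - fE lam η U W s ≤
      2 * η * ς * ∫ z in (fV lam η U s)..(fV lam η U t), g z := by
  have hG : ∀ z, HasDerivAt (fun v => ∫ z in (0 : ℝ)..v, g z) (g z) z := fun z =>
    intervalIntegral.integral_hasDerivAt_right (hg.intervalIntegrable _ _)
      hg.stronglyMeasurable.stronglyMeasurableAtFilter hg.continuousAt
  have hsub : ∀ r ∈ Ioo s t, r ∈ Ioo x y := fun r hr =>
    ⟨hs.1.trans_lt hr.1, hr.2.trans_le ht.2⟩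
  have hGc : Continuous (fun v => ∫ z in (0 : ℝ)..v, g z) :=
    continuous_iff_continuousAt.2 fun z => (hG z).continuousAt
  have := anti_of_hd (f := fun r => fE lam η U W r - 2 * η * ς * ∫ z in (0 : ℝ)..(fV lam η U r), g z)
    (f' := fun r => 2 * η * fP lam η U W r ^ 2 / r -
      2 * η * ς * (g (fV lam η U r) * (fP lam η U W r / r))) hst ?_ ?_ ?_
  · have e : ∫ z in (fV lam η U s)..(fV lam η U t), g z =
        (∫ z in (0 : ℝ)..(fV lam η U t), g z) - ∫ z in (0 : ℝ)..(fV lam η U s), g z :=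
      (intervalIntegral.integral_interval_sub_left (hg.intervalIntegrable _ _)
        (hg.intervalIntegrable _ _)).symm
    rw [e]
    linarith
  · have hI : Icc s t ⊆ Icc x y := Icc_subset_Icc hs.1 ht.2
    exact (h.cE.mono hI).sub (continuousOn_const.mul (hGc.comp_continuousOn (h.cV.mono hI)))
  · intro r hr
    exact (h.dE (hsub r hr)).sub (((hG _).comp r (h.dV (hsub r hr))).const_mul _)
  · intro r hr
    have r0 := h.rpos (hsub r hr)
    have hη := h.hη
    have h1 := hb r hr
    have h2 := hP r hr
    set P := fP lam η U W r
    have e1 : ς * P = |P| := by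
      rcases hς with rfl | rfl
      · rw [abs_of_nonneg (by linarith)]; ring
      · rw [abs_of_nonpos (by linarith)]; ring
    have e2 : 2 * η * P ^ 2 / r - 2 * η * ς * (g (fV lam η U r) * (P / r)) =
        2 * η * (|P| * (|P| - g (fV lam η U r))) / r := by
      rw [← sq_abs, ← e1]; field_simp
    rw [e2]
    apply div_nonpos_of_nonpos_of_nonneg _ r0.le
    have h3 := mul_nonpos_of_nonneg_of_nonpos (abs_nonneg P) (sub_nonpos.2 h1)
    nlinarith

/-- Energy gain along a monotone piece, lower bound. -/
theorem gain_ge (h : Arc lam η x y U W) {s t ς : ℝ} (hς : ς = 1 ∨ ς = -1)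
    (hs : s ∈ Icc x y) (ht : t ∈ Icc x y) (hst : s ≤ t)
    (hP : ∀ r ∈ Ioo s t, 0 ≤ ς * fP lam η U W r) {g : ℝ → ℝ} (hg : Continuous g)
    (hb : ∀ r ∈ Ioo s t, g (fV lam η U r) ≤ |fP lam η U W r|) :
    2 * η * ς * (∫ z in (fV lam η U s)..(fV lam η U t), g z) ≤
      fE lam η U W t - fE lam η U W s := by
  have hG : ∀ z, HasDerivAt (fun v => ∫ z in (0 : ℝ)..v, g z) (g z) z := fun z =>
    intervalIntegral.integral_hasDerivAt_right (hg.intervalIntegrable _ _)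
      hg.stronglyMeasurable.stronglyMeasurableAtFilter hg.continuousAt
  have hsub : ∀ r ∈ Ioo s t, r ∈ Ioo x y := fun r hr =>
    ⟨hs.1.trans_lt hr.1, hr.2.trans_le ht.2⟩
  have hGc : Continuous (fun v => ∫ z in (0 : ℝ)..v, g z) :=
    continuous_iff_continuousAt.2 fun z => (hG z).continuousAt
  have := mono_of_hd (f := fun r => fE lam η U W r - 2 * η * ς * ∫ z in (0 : ℝ)..(fV lam η U r), g z)
    (f' := fun r => 2 * η * fP lam η U W r ^ 2 / r -
      2 * η * ς * (g (fV lam η U r) * (fP lam η U W r / r))) hst ?_ ?_ ?_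
  · have e : ∫ z in (fV lam η U s)..(fV lam η U t), g z =
        (∫ z in (0 : ℝ)..(fV lam η U t), g z) - ∫ z in (0 : ℝ)..(fV lam η U s), g z :=
      (intervalIntegral.integral_interval_sub_left (hg.intervalIntegrable _ _)
        (hg.intervalIntegrable _ _)).symm
    rw [e]
    linarith
  · have hI : Icc s t ⊆ Icc x y := Icc_subset_Icc hs.1 ht.2
    exact (h.cE.mono hI).sub (continuousOn_const.mul (hGc.comp_continuousOn (h.cV.mono hI)))
  · intro r hr
    exact (h.dE (hsub r hr)).sub (((hG _).comp r (h.dV (hsub r hr))).const_mul _)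
  · intro r hr
    have r0 := h.rpos (hsub r hr)
    have hη := h.hη
    have h1 := hb r hr
    have h2 := hP r hr
    set P := fP lam η U W r
    have e1 : ς * P = |P| := by
      rcases hς with rfl | rfl
      · rw [abs_of_nonneg (by linarith)]; ring
      · rw [abs_of_nonpos (by linarith)]; ring
    have e2 : 2 * η * P ^ 2 / r - 2 * η * ς * (g (fV lam η U r) * (P / r)) =
        2 * η * (|P| * (|P| - g (fV lam η U r))) / r := by
      rw [← sq_abs, ← e1]; field_simp
    rw [e2]
    apply div_nonneg _ r0.le
    have h3 := mul_nonneg (abs_nonneg P) (sub_nonneg.2 h1)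
    nlinarith

end Arc

/-! ### Part B: energy gain across a bump -/

def gq (lam η c z : ℝ) : ℝ :=
  √(2 * c + (lam ^ 2 - η ^ 2) * z ^ 2 - 2 * z ^ (2 + 2 / (lam + η)) / (2 + 2 / (lam + η)))

def Kc (lam : ℝ) : ℝ := ((2 + 2 / lam) * (lam ^ 2 / 2 + 1)) ^ lam

theorem gq_nonneg (lam η c z : ℝ) : 0 ≤ gq lam η c z := sqrt_nonneg _

theorem gq_cont {lam η : ℝ} (c : ℝ) (ha : 0 < lam + η) : Continuous (gq lam η c) := by
  unfold gq
  apply Continuous.sqrt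
  apply Continuous.sub (by fun_prop)
  apply Continuous.div_const
  apply Continuous.mul continuous_const
  exact continuous_id.rpow_const (fun _ => Or.inr (by positivity))

theorem en_P (lam η P V : ℝ) : P ^ 2 = 2 * en lam η P V + (lam ^ 2 - η ^ 2) * V ^ 2
    - 2 * V ^ (2 + 2 / (lam + η)) / (2 + 2 / (lam + η)) := by
  unfold en; ring

theorem absP_le_gq {lam η P V c : ℝ} (h : en lam η P V ≤ c) : |P| ≤ gq lam η c V := by
  apply abs_le_sqrt
  rw [en_P lam η P V]; linarith

theorem gq_le_absP {lam η P V : ℝ} (h : 0 ≤ en lam η P V) : gq lam η 0 V ≤ |P| := by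
  unfold gq
  rw [sqrt_le_left (abs_nonneg P), sq_abs, en_P lam η P V]; linarith

theorem Kc_ge_one {lam : ℝ} (hlam : 0 < lam) : 1 ≤ Kc lam := by
  apply one_le_rpow _ hlam.le
  have : 0 < 2 / lam := by positivity
  nlinarith [sq_nonneg lam]

theorem gq_le {lam η c z : ℝ} (ha : 0 < lam + η) (hz : 0 ≤ z) :
    gq lam η c z ≤ √(2 * c + lam ^ 2 * z ^ 2) := by
  apply sqrt_le_sqrt
  have : 0 ≤ 2 * z ^ (2 + 2 / (lam + η)) / (2 + 2 / (lam + η)) := by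
    have := rpow_nonneg hz (2 + 2 / (lam + η))
    positivity
  nlinarith [mul_nonneg (sq_nonneg η) (sq_nonneg z)]

theorem peak_bound {lam η c M P : ℝ} (hlam : 0 < lam) (hη : 0 < η) (hηl : η < lam)
    (hc : 0 ≤ c) (hM : 0 ≤ M) (h : en lam η P M ≤ c) : M ^ 2 ≤ Kc lam ^ 2 + c := by
  have hK := Kc_ge_one hlam
  by_cases hMK : M ≤ Kc lam
  · nlinarith
  push Not at hMK
  have ha : 0 < lam + η := by linarith
  have hM1 : 1 ≤ M := by linarith
  have hM0 : 0 < M := by linarith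
  have h1 : M ^ (1 / lam) ≤ M ^ (2 / (lam + η)) := by
    apply rpow_le_rpow_of_exponent_le hM1
    rw [div_le_div_iff₀ hlam ha]; linarith
  have h2 : (2 + 2 / lam) * (lam ^ 2 / 2 + 1) ≤ M ^ (1 / lam) := by
    have : Kc lam ^ (1 / lam) ≤ M ^ (1 / lam) :=
      rpow_le_rpow (by linarith) hMK.le (by positivity)
    rw [Kc, ← rpow_mul (by positivity), mul_one_div_cancel hlam.ne', rpow_one] at this
    exact this
  have hq : 2 + 2 / (lam + η) ≤ 2 + 2 / lam := by
    have : 2 / (lam + η) ≤ 2 / lam := div_le_div_of_nonneg_left (by norm_num) hlam (by linarith)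
    linarith
  have hq0 : 0 < 2 + 2 / (lam + η) := by positivity
  have h3 : (lam ^ 2 / 2 + 1) * (2 + 2 / (lam + η)) ≤ M ^ (2 / (lam + η)) := by
    have : (lam ^ 2 / 2 + 1) * (2 + 2 / (lam + η)) ≤ (lam ^ 2 / 2 + 1) * (2 + 2 / lam) := by gcongr
    linarith
  have h4 : (lam ^ 2 / 2 + 1) * M ^ 2 ≤ M ^ (2 + 2 / (lam + η)) / (2 + 2 / (lam + η)) := by
    rw [rpow_add hM0, rpow_two, le_div_iff₀ hq0]
    nlinarith [sq_nonneg M]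
  unfold en at h
  nlinarith [sq_nonneg P, sq_nonneg (η * M), sq_nonneg (Kc lam)]

theorem gq_zero_beyond {lam η M z : ℝ} (ha : 0 < lam + η) (hM : 0 < M)
    (h : 0 ≤ en lam η 0 M) (hz : M ≤ z) : gq lam η 0 z = 0 := by
  unfold gq
  apply sqrt_eq_zero_of_nonpos
  have hz0 : 0 < z := by linarith
  have hq0 : 0 < 2 + 2 / (lam + η) := by positivity
  unfold en at h
  rw [rpow_add hM, rpow_two] at h
  rw [rpow_add hz0, rpow_two]
  have h1 : M ^ (2 / (lam + η)) ≤ z ^ (2 / (lam + η)) := rpow_le_rpow hM.le hz (by positivity)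
  have h2 : M ^ 2 * ((lam ^ 2 - η ^ 2) / 2) ≤ M ^ 2 * (M ^ (2 / (lam + η)) / (2 + 2 / (lam + η))) := by
    have : M ^ 2 * M ^ (2 / (lam + η)) / (2 + 2 / (lam + η)) =
      M ^ 2 * (M ^ (2 / (lam + η)) / (2 + 2 / (lam + η))) := by ring
    rw [← this]; linarith
  have h3 := le_of_mul_le_mul_left h2 (by positivity)
  have h4 : M ^ (2 / (lam + η)) / (2 + 2 / (lam + η)) ≤ z ^ (2 / (lam + η)) / (2 + 2 / (lam + η)) := by
    gcongr
  have h5 : (lam ^ 2 - η ^ 2) / 2 * z ^ 2 ≤ z ^ (2 / (lam + η)) / (2 + 2 / (lam + η)) * z ^ 2 := by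
    exact mul_le_mul_of_nonneg_right (h3.trans h4) (sq_nonneg z)
  have : 2 * (z ^ 2 * z ^ (2 / (lam + η))) / (2 + 2 / (lam + η)) =
    2 * (z ^ (2 / (lam + η)) / (2 + 2 / (lam + η)) * z ^ 2) := by ring
  rw [this]; linarith

namespace Arc
variable {lam η x y : ℝ} {U W : ℝ → ℝ}

theorem bump_apriori (h : Arc lam η x y U W) (hVx : fV lam η U x = 0) (hVy : fV lam η U y = 0) :
    fE lam η U W y ≤ fE lam η U W x +
      η * (2 * (lam ^ 2 + 3) * (Kc lam ^ 2 + 1)) * (1 + fE lam η U W y) := by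
  obtain ⟨b, hb, hPb, hup, hdn, hmax⟩ := h.exists_peak hVx hVy
  have hbI := Ioo_subset_Icc_self hb
  have hxI : x ∈ Icc x y := left_mem_Icc.2 h.hxy.le
  have hyI : y ∈ Icc x y := right_mem_Icc.2 h.hxy.le
  have hEx := E_nonneg_left hVx h
  have hEy : 0 ≤ fE lam η U W y := hEx.trans (h.E_mono hxI hyI h.hxy.le)
  set c := fE lam η U W y with hc
  have hEc : ∀ r ∈ Icc x y, fE lam η U W r ≤ c := fun r hr => h.E_mono hr hyI hr.2
  set M := fV lam η U b with hM
  have hM0 : 0 ≤ M := h.V_nonneg hbI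
  have hMb : M ^ 2 ≤ Kc lam ^ 2 + c := peak_bound h.hlam h.hη h.hηl hEy hM0 (hEc b hbI)
  set B := √(2 * c + lam ^ 2 * M ^ 2) with hB
  have hPB : ∀ r ∈ Icc x y, |fP lam η U W r| ≤ B := fun r hr => by
    refine (absP_le_gq (hEc r hr)).trans ((gq_le h.ha (h.V_nonneg hr)).trans ?_)
    apply sqrt_le_sqrt
    have := hmax r hr
    have := h.V_nonneg hr
    gcongr
  have h1 := h.gain_le (ς := 1) (Or.inl rfl) hxI hbI hb.1.le
    (fun r hr => by have := hup r (Ioo_subset_Icc_self hr); linarith)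
    (continuous_const (y := B)) (fun r hr => hPB r ⟨hr.1.le, hr.2.le.trans hb.2.le⟩)
  have h2 := h.gain_le (ς := -1) (Or.inr rfl) hbI hyI hb.2.le
    (fun r hr => by have := hdn r (Ioo_subset_Icc_self hr); linarith)
    (continuous_const (y := B)) (fun r hr => hPB r ⟨hb.1.le.trans hr.1.le, hr.2.le⟩)
  rw [hVx, ← hM, intervalIntegral.integral_const] at h1
  rw [hVy, ← hM, intervalIntegral.integral_const] at h2
  simp only [smul_eq_mul, sub_zero, zero_sub] at h1 h2
  have hB2 : B ^ 2 = 2 * c + lam ^ 2 * M ^ 2 := sq_sqrt (by positivity)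
  have hMB : 2 * (M * B) ≤ M ^ 2 + B ^ 2 := by nlinarith [sq_nonneg (M - B)]
  have hη := h.hη
  have h3 : c - fE lam η U W x ≤ 2 * η * (2 * (M * B)) := by linarith
  have h4 : 2 * η * (2 * (M * B)) ≤ 2 * η * ((lam ^ 2 + 3) * (Kc lam ^ 2 + 1) * (1 + c)) := by
    apply mul_le_mul_of_nonneg_left _ (by positivity)
    have hK : 0 ≤ Kc lam ^ 2 := sq_nonneg _
    have h5 : (lam ^ 2 + 1) * M ^ 2 ≤ (lam ^ 2 + 1) * (Kc lam ^ 2 + c) := by gcongr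
    nlinarith [sq_nonneg lam, mul_nonneg hK hEy, mul_nonneg (mul_nonneg hK hEy) (sq_nonneg lam)]
  nlinarith

theorem bump_gain (h : Arc lam η x y U W) (hVx : fV lam η U x = 0) (hVy : fV lam η U y = 0)
    (hc1 : fE lam η U W y ≤ 1) :
    4 * η * (∫ z in (0 : ℝ)..(Kc lam + 1), gq lam η 0 z) ≤ fE lam η U W y - fE lam η U W x ∧
    fE lam η U W y - fE lam η U W x ≤
      4 * η * (∫ z in (0 : ℝ)..(Kc lam + 1), gq lam η (fE lam η U W y) z) := by
  obtain ⟨b, hb, hPb, hup, hdn, hmax⟩ := h.exists_peak hVx hVy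
  have hbI := Ioo_subset_Icc_self hb
  have hxI : x ∈ Icc x y := left_mem_Icc.2 h.hxy.le
  have hyI : y ∈ Icc x y := right_mem_Icc.2 h.hxy.le
  have hEx := E_nonneg_left hVx h
  have hEy : 0 ≤ fE lam η U W y := hEx.trans (h.E_mono hxI hyI h.hxy.le)
  set c := fE lam η U W y with hc
  have hEc : ∀ r ∈ Icc x y, fE lam η U W r ≤ c := fun r hr => h.E_mono hr hyI hr.2
  have hE0 : ∀ r ∈ Icc x y, 0 ≤ fE lam η U W r := fun r hr => hEx.trans (h.E_mono hxI hr hr.1)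
  set M := fV lam η U b with hM
  have hM0 : 0 < M := h.V_pos hb
  have hMb : M ^ 2 ≤ Kc lam ^ 2 + c := peak_bound h.hlam h.hη h.hηl hEy hM0.le (hEc b hbI)
  have hK := Kc_ge_one h.hlam
  have hMK : M ≤ Kc lam + 1 := by nlinarith
  have hη := h.hη
  have hup' : ∀ r ∈ Ioo x b, 0 ≤ 1 * fP lam η U W r := fun r hr => by
    have := hup r (Ioo_subset_Icc_self hr); linarith
  have hdn' : ∀ r ∈ Ioo b y, 0 ≤ -1 * fP lam η U W r := fun r hr => by
    have := hdn r (Ioo_subset_Icc_self hr); linarith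
  have hi1 : ∀ r ∈ Ioo x b, r ∈ Icc x y := fun r hr => ⟨hr.1.le, hr.2.le.trans hb.2.le⟩
  have hi2 : ∀ r ∈ Ioo b y, r ∈ Icc x y := fun r hr => ⟨hb.1.le.trans hr.1.le, hr.2.le⟩
  constructor
  · have gc := gq_cont (lam := lam) (η := η) 0 h.ha
    have h1 := h.gain_ge (ς := 1) (Or.inl rfl) hxI hbI hb.1.le hup' gc
      (fun r hr => gq_le_absP (hE0 r (hi1 r hr)))
    have h2 := h.gain_ge (ς := -1) (Or.inr rfl) hbI hyI hb.2.le hdn' gc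
      (fun r hr => gq_le_absP (hE0 r (hi2 r hr)))
    rw [hVx, ← hM] at h1
    rw [hVy, ← hM, intervalIntegral.integral_symm] at h2
    have hen : 0 ≤ en lam η 0 M := by
      have := hE0 b hbI
      unfold fE at this
      rwa [hPb] at this
    have h3 : ∫ z in M..(Kc lam + 1), gq lam η 0 z = 0 := by
      have : ∫ z in M..(Kc lam + 1), gq lam η 0 z = ∫ z in M..(Kc lam + 1), (0 : ℝ) := by
        apply intervalIntegral.integral_congr
        intro z hz
        rw [uIcc_of_le hMK] at hz
        exact gq_zero_beyond h.ha hM0 hen hz.1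
      rw [this]; simp
    have h4 := intervalIntegral.integral_add_adjacent_intervals (gc.intervalIntegrable (μ := volume) 0 M)
      (gc.intervalIntegrable M (Kc lam + 1))
    rw [h3] at h4
    rw [← h4]
    linarith
  · have gc := gq_cont (lam := lam) (η := η) c h.ha
    have h1 := h.gain_le (ς := 1) (Or.inl rfl) hxI hbI hb.1.le hup' gc
      (fun r hr => absP_le_gq (hEc r (hi1 r hr)))
    have h2 := h.gain_le (ς := -1) (Or.inr rfl) hbI hyI hb.2.le hdn' gc
      (fun r hr => absP_le_gq (hEc r (hi2 r hr)))
    rw [hVx, ← hM] at h1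
    rw [hVy, ← hM, intervalIntegral.integral_symm] at h2
    have h3 : 0 ≤ ∫ z in M..(Kc lam + 1), gq lam η c z :=
      intervalIntegral.integral_nonneg hMK (fun z _ => gq_nonneg _ _ _ _)
    have h4 := intervalIntegral.integral_add_adjacent_intervals (gc.intervalIntegrable (μ := volume) 0 M)
      (gc.intervalIntegrable M (Kc lam + 1))
    rw [← h4]
    have h5 := mul_nonneg hη.le h3
    nlinarith

end Arc

def Ibub (lam : ℝ) : ℝ := ∫ z in (0 : ℝ)..(Kc lam + 1), gq lam 0 0 z

theorem gq_tendsto {ι : Type*} {l : Filter ι} {lam : ℝ} (hlam : 0 < lam) {η c : ι → ℝ}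
    (hη : Tendsto η l (𝓝 0)) (hc : Tendsto c l (𝓝 0)) {z : ℝ} (hz : 0 < z) :
    Tendsto (fun i => gq lam (η i) (c i) z) l (𝓝 (gq lam 0 0 z)) := by
  unfold gq
  apply Tendsto.sqrt
  have h1 : Tendsto (fun i => 2 + 2 / (lam + η i)) l (𝓝 (2 + 2 / (lam + 0))) :=
    tendsto_const_nhds.add (tendsto_const_nhds.div (tendsto_const_nhds.add hη) (by simpa using hlam.ne'))
  have h2 : (2 + 2 / (lam + 0)) ≠ 0 := by rw [add_zero]; positivity
  exact ((tendsto_const_nhds.mul hc).add ((tendsto_const_nhds.sub (hη.pow 2)).mul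
    tendsto_const_nhds)).sub ((tendsto_const_nhds.mul (tendsto_const_nhds.rpow h1 (Or.inl hz.ne'))).div h1 h2)

theorem int_gq_tendsto {ι : Type*} {l : Filter ι} [l.IsCountablyGenerated] {lam : ℝ}
    (hlam : 0 < lam) {η c : ι → ℝ}
    (hη : Tendsto η l (𝓝 0)) (hc : Tendsto c l (𝓝 0)) :
    Tendsto (fun i => ∫ z in (0 : ℝ)..(Kc lam + 1), gq lam (η i) (c i) z) l (𝓝 (Ibub lam)) := by
  have hK := Kc_ge_one hlam
  have hev : ∀ᶠ i in l, 0 < lam + η i ∧ c i ≤ 1 := by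
    have h1 := hη.eventually (lt_mem_nhds (show -lam < 0 by linarith))
    have h2 := hc.eventually (gt_mem_nhds (show (0 : ℝ) < 1 by norm_num))
    filter_upwards [h1, h2] with i h1 h2
    exact ⟨by linarith, h2.le⟩
  apply intervalIntegral.tendsto_integral_filter_of_dominated_convergence
    (fun _ => √(2 * 1 + lam ^ 2 * (Kc lam + 1) ^ 2))
  · filter_upwards [hev] with i hi
    exact (gq_cont _ hi.1).aestronglyMeasurable
  · filter_upwards [hev] with i hi
    refine Eventually.of_forall fun z hz => ?_
    rw [uIoc_of_le (by linarith)] at hz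
    rw [norm_eq_abs, abs_of_nonneg (gq_nonneg _ _ _ _)]
    refine (gq_le hi.1 hz.1.le).trans (sqrt_le_sqrt ?_)
    have := hi.2
    have := hz.1
    have := hz.2
    gcongr
  · simp
  · refine Eventually.of_forall fun z hz => ?_
    rw [uIoc_of_le (by linarith)] at hz
    exact gq_tendsto hlam hη hc hz.1

theorem bump_E_tendsto_zero {ι : Type*} {l : Filter ι} {lam : ℝ}
    {η x y : ι → ℝ} {U W : ι → ℝ → ℝ} (hη : Tendsto η l (𝓝 0))
    (hA : ∀ᶠ i in l, Arc lam (η i) (x i) (y i) (U i) (W i))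
    (hVx : ∀ᶠ i in l, fV lam (η i) (U i) (x i) = 0)
    (hVy : ∀ᶠ i in l, fV lam (η i) (U i) (y i) = 0)
    (hE : Tendsto (fun i => fE lam (η i) (U i) (W i) (x i)) l (𝓝 0)) :
    Tendsto (fun i => fE lam (η i) (U i) (W i) (y i)) l (𝓝 0) := by
  set C := 2 * (lam ^ 2 + 3) * (Kc lam ^ 2 + 1) with hC
  have hCp : 0 < C := by positivity
  have h1 : ∀ᶠ i in l, η i * C < 1 / 2 := by
    have : Tendsto (fun i => η i * C) l (𝓝 (0 * C)) := hη.mul tendsto_const_nhds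
    rw [zero_mul] at this
    exact this.eventually (gt_mem_nhds (by norm_num))
  have h2 : Tendsto (fun i => 2 * (fE lam (η i) (U i) (W i) (x i) + η i * C)) l (𝓝 (2 * (0 + 0 * C))) :=
    tendsto_const_nhds.mul (hE.add (hη.mul tendsto_const_nhds))
  rw [show (2 * (0 + 0 * C) : ℝ) = 0 by ring] at h2
  refine tendsto_of_tendsto_of_tendsto_of_le_of_le' tendsto_const_nhds h2 ?_ ?_
  · filter_upwards [hA, hVx] with i hA hVx
    exact (Arc.E_nonneg_left hVx hA).trans
      (hA.E_mono (left_mem_Icc.2 hA.hxy.le) (right_mem_Icc.2 hA.hxy.le) hA.hxy.le)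
  · filter_upwards [hA, hVx, hVy, h1] with i hA hVx hVy h1
    have h3 := hA.bump_apriori hVx hVy
    have h4 : 0 ≤ fE lam (η i) (U i) (W i) (y i) := (Arc.E_nonneg_left hVx hA).trans
      (hA.E_mono (left_mem_Icc.2 hA.hxy.le) (right_mem_Icc.2 hA.hxy.le) hA.hxy.le)
    rw [← hC] at h3
    nlinarith

theorem bump_tendsto {ι : Type*} {l : Filter ι} [l.IsCountablyGenerated] {lam : ℝ}
    (hlam : 0 < lam) {η x y : ι → ℝ} {U W : ι → ℝ → ℝ} (hη : Tendsto η l (𝓝 0))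
    (hA : ∀ᶠ i in l, Arc lam (η i) (x i) (y i) (U i) (W i))
    (hVx : ∀ᶠ i in l, fV lam (η i) (U i) (x i) = 0)
    (hVy : ∀ᶠ i in l, fV lam (η i) (U i) (y i) = 0)
    (hE : Tendsto (fun i => fE lam (η i) (U i) (W i) (x i)) l (𝓝 0)) :
    Tendsto (fun i => (fE lam (η i) (U i) (W i) (y i) - fE lam (η i) (U i) (W i) (x i)) / η i) l
      (𝓝 (4 * Ibub lam)) := by
  have hEy := bump_E_tendsto_zero hη hA hVx hVy hE
  have h1 := hEy.eventually (gt_mem_nhds (show (0 : ℝ) < 1 by norm_num))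
  have lo := (int_gq_tendsto hlam hη (tendsto_const_nhds (x := (0 : ℝ)))).const_mul 4
  have hi := (int_gq_tendsto hlam hη hEy).const_mul 4
  refine tendsto_of_tendsto_of_tendsto_of_le_of_le' lo hi ?_ ?_
  · filter_upwards [hA, hVx, hVy, h1] with i hA hVx hVy h1
    have := (hA.bump_gain hVx hVy h1.le).1
    rw [le_div_iff₀ hA.hη]; linarith
  · filter_upwards [hA, hVx, hVy, h1] with i hA hVx hVy h1
    have := (hA.bump_gain hVx hVy h1.le).2
    rw [div_le_iff₀ hA.hη]; linarith

/-! ### Part C: the bubble integral -/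

theorem beta_real {α β : ℝ} (hα : 0 < α) (hβ : 0 < β) :
    IntervalIntegrable (fun y : ℝ => y ^ (α - 1) * (1 - y) ^ (β - 1)) volume 0 1 ∧
    ∫ y in (0 : ℝ)..1, y ^ (α - 1) * (1 - y) ^ (β - 1) =
      Real.Gamma α * Real.Gamma β / Real.Gamma (α + β) := by
  have hc := Complex.betaIntegral_convergent (u := (α : ℂ)) (v := (β : ℂ)) (by simpa) (by simpa)
  have e : ∀ y ∈ Ioc (0 : ℝ) 1, ((y : ℂ) ^ ((α : ℂ) - 1) * (1 - (y : ℂ)) ^ ((β : ℂ) - 1)) =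
      ((y ^ (α - 1) * (1 - y) ^ (β - 1) : ℝ) : ℂ) := by
    intro y hy
    rw [Complex.ofReal_mul, Complex.ofReal_cpow hy.1.le, Complex.ofReal_cpow (by linarith [hy.2])]
    push_cast
    rfl
  have hc2 : IntervalIntegrable (fun y : ℝ => ((y ^ (α - 1) * (1 - y) ^ (β - 1) : ℝ) : ℂ)) volume 0 1 := by
    refine hc.congr ?_
    intro y hy
    rw [uIoc_of_le zero_le_one] at hy
    exact e y hy
  have hr : IntervalIntegrable (fun y : ℝ => y ^ (α - 1) * (1 - y) ^ (β - 1)) volume 0 1 := by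
    rw [intervalIntegrable_iff] at hc2 ⊢
    have := Integrable.re hc2
    simpa [IntegrableOn] using this
  refine ⟨hr, ?_⟩
  have h1 := ProbabilityTheory.beta_eq_betaIntegralReal α β hα hβ
  unfold ProbabilityTheory.beta Complex.betaIntegral at h1
  rw [h1]
  have h2 : ∫ y in (0 : ℝ)..1, ((y : ℂ) ^ ((α : ℂ) - 1) * (1 - (y : ℂ)) ^ ((β : ℂ) - 1)) =
      ∫ y in (0 : ℝ)..1, ((y ^ (α - 1) * (1 - y) ^ (β - 1) : ℝ) : ℂ) := by
    apply intervalIntegral.integral_congr_ae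
    refine Eventually.of_forall fun y hy => ?_
    rw [uIoc_of_le zero_le_one] at hy
    exact e y hy
  rw [h2, intervalIntegral.integral_ofReal, Complex.ofReal_re]

theorem gq_zero_eq {lam z : ℝ} (hlam : 0 < lam) (hz : 0 < z) :
    gq lam 0 0 z = √(lam ^ 2 * z ^ 2 * (1 - z ^ (2 / lam) / (lam * (lam + 1)))) := by
  unfold gq
  rw [add_zero, rpow_add hz, rpow_two]
  congr 1
  field_simp
  ring

theorem beta_three_half {lam : ℝ} (hlam : 0 < lam) :
    Real.Gamma lam * Real.Gamma (3 / 2) / Real.Gamma (lam + 3 / 2) =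
      4 ^ lam * Real.Gamma (lam + 1) ^ 2 / (lam * Real.Gamma (2 * lam + 2)) := by
  have h1 := Real.Gamma_mul_Gamma_add_half (lam + 1)
  have h2 : Real.Gamma (3 / 2) = √π / 2 := by
    have : (3 / 2 : ℝ) = 1 / 2 + 1 := by norm_num
    rw [this, Real.Gamma_add_one (by norm_num), Real.Gamma_one_half_eq]; ring
  have h3 : Real.Gamma (lam + 1) = lam * Real.Gamma lam := Real.Gamma_add_one hlam.ne'
  have e1 : lam + 1 + 1 / 2 = lam + 3 / 2 := by ring
  have e2 : 2 * (lam + 1) = 2 * lam + 2 := by ring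
  rw [e1, e2] at h1
  have h4 : (2 : ℝ) ^ (1 - (2 * lam + 2)) = (2 * 4 ^ lam)⁻¹ := by
    have : (4 : ℝ) ^ lam = 2 ^ (2 * lam) := by
      rw [rpow_mul (by norm_num)]; norm_num
    rw [this, show (1 - (2 * lam + 2)) = -(1 + 2 * lam) by ring, rpow_neg (by norm_num),
      rpow_add (by norm_num), rpow_one]
  rw [h4] at h1
  have g1 : 0 < Real.Gamma (lam + 3 / 2) := Real.Gamma_pos_of_pos (by positivity)
  have g2 : 0 < Real.Gamma (2 * lam + 2) := Real.Gamma_pos_of_pos (by positivity)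
  have g3 : 0 < Real.Gamma lam := Real.Gamma_pos_of_pos hlam
  have g4 : (0 : ℝ) < 4 ^ lam := by positivity
  rw [h2, div_eq_div_iff g1.ne' (by positivity)]
  rw [h3] at h1 ⊢
  field_simp at h1 ⊢
  have := mul_right_cancel₀ (b := Real.Gamma lam) g3.ne' (a := lam * Real.Gamma (lam + 3 / 2) * 2 * 4 ^ lam * Real.Gamma lam) (c := Real.Gamma (2 * lam + 2) * √π * Real.Gamma lam)
  nlinarith

theorem Ibub_eq {lam : ℝ} (hlam : 0 < lam) : Ibub lam =
    lam / 2 * Real.Gamma (lam + 1) ^ 2 / Real.Gamma (2 * lam + 2) * (4 * (lam * (lam + 1))) ^ lam := by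
  set A := lam * (lam + 1) with hA
  have hA0 : 0 < A := by positivity
  set M := A ^ (lam / 2) with hM
  have hM0 : 0 < M := rpow_pos_of_pos hA0 _
  have gc : Continuous (gq lam 0 0) := gq_cont 0 (by simpa using hlam)
  have hMK : M ≤ Kc lam + 1 := by
    have hb1 : 1 ≤ (2 + 2 / lam) * (lam ^ 2 / 2 + 1) := by
      have : 0 < 2 / lam := by positivity
      nlinarith [sq_nonneg lam]
    have hb2 : A ≤ (2 + 2 / lam) * (lam ^ 2 / 2 + 1) := by
      have : (2 + 2 / lam) * (lam ^ 2 / 2 + 1) = A + 2 + 2 / lam := by rw [hA]; field_simp; ring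
      rw [this]
      have : 0 < 2 / lam := by positivity
      linarith
    have : M ≤ Kc lam := by
      rw [hM]
      refine (rpow_le_rpow hA0.le hb2 (by positivity)).trans ?_
      exact rpow_le_rpow_of_exponent_le hb1 (by linarith)
    linarith
  have e1 : ∫ z in M..(Kc lam + 1), gq lam 0 0 z = 0 := by
    have : ∫ z in M..(Kc lam + 1), gq lam 0 0 z = ∫ z in M..(Kc lam + 1), (0 : ℝ) := by
      apply intervalIntegral.integral_congr
      intro z hz
      rw [uIcc_of_le hMK] at hz
      have hz0 : 0 < z := hM0.trans_le hz.1
      simp only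
      rw [gq_zero_eq hlam hz0]
      apply sqrt_eq_zero_of_nonpos
      apply mul_nonpos_of_nonneg_of_nonpos (by positivity)
      have h1 : A ≤ z ^ (2 / lam) := by
        have := rpow_le_rpow hM0.le hz.1 (show 0 ≤ 2 / lam by positivity)
        rwa [hM, ← rpow_mul hA0.le, show lam / 2 * (2 / lam) = 1 by field_simp, rpow_one] at this
      have := (one_le_div hA0).2 h1
      linarith
    rw [this]; simp
  have e2 : Ibub lam = ∫ z in (0 : ℝ)..M, gq lam 0 0 z := by
    unfold Ibub
    rw [← intervalIntegral.integral_add_adjacent_intervals (gc.intervalIntegrable (μ := volume) 0 M)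
      (gc.intervalIntegrable M (Kc lam + 1)), e1, add_zero]
  obtain ⟨bi, bv⟩ := beta_real (α := lam) (β := 3 / 2) hlam (by norm_num)
  have hfun : ∀ y ∈ Ioc (0 : ℝ) 1, gq lam 0 0 (M * y ^ (lam / 2)) *
      (M * (lam / 2 * y ^ (lam / 2 - 1))) =
      lam ^ 2 / 2 * A ^ lam * (y ^ (lam - 1) * (1 - y) ^ ((3 : ℝ) / 2 - 1)) := by
    intro y hy
    have y0 := hy.1
    rw [gq_zero_eq hlam (by positivity)]
    have h1 : (M * y ^ (lam / 2)) ^ (2 / lam) = A * y := by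
      rw [mul_rpow hM0.le (by positivity), hM, ← rpow_mul hA0.le, ← rpow_mul y0.le,
        show lam / 2 * (2 / lam) = 1 by field_simp, rpow_one, rpow_one]
    have h2 : A * y / (lam * (lam + 1)) = y := by rw [← hA]; field_simp
    rw [h1, h2, ← mul_pow, sqrt_mul (by positivity), sqrt_sq (by positivity), sqrt_eq_rpow]
    have h3 : A ^ lam = M * M := by
      rw [hM, ← rpow_add hA0]; congr 1; ring
    have h4 : y ^ (lam - 1) = y ^ (lam / 2) * y ^ (lam / 2 - 1) := by
      rw [← rpow_add y0]; congr 1; ring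
    rw [h3, h4, show ((3 : ℝ) / 2 - 1) = 1 / 2 by norm_num]
    ring
  have hsub := intervalIntegral.integral_comp_mul_deriv''' (a := 0) (b := 1)
    (f := fun y : ℝ => M * y ^ (lam / 2)) (f' := fun y => M * (lam / 2 * y ^ (lam / 2 - 1)))
    (g := gq lam 0 0) ?_ ?_ gc.continuousOn ?_ ?_
  · rw [one_rpow, zero_rpow (by positivity), mul_one, mul_zero, ← e2] at hsub
    rw [← hsub]
    have : ∫ y in (0 : ℝ)..1, (gq lam 0 0 ∘ fun y : ℝ => M * y ^ (lam / 2)) y *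
        (M * (lam / 2 * y ^ (lam / 2 - 1))) =
        ∫ y in (0 : ℝ)..1, lam ^ 2 / 2 * A ^ lam * (y ^ (lam - 1) * (1 - y) ^ ((3 : ℝ) / 2 - 1)) := by
      apply intervalIntegral.integral_congr_ae
      refine Eventually.of_forall fun y hy => ?_
      rw [uIoc_of_le zero_le_one] at hy
      exact hfun y hy
    rw [this, intervalIntegral.integral_const_mul, bv, beta_three_half hlam,
      mul_rpow (by norm_num) hA0.le]
    field_simp
  · exact (continuous_const.mul (continuous_id.rpow_const (fun _ => Or.inr (by positivity)))).continuousOn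
  · intro y hy
    rw [min_eq_left zero_le_one] at hy
    exact ((hasDerivAt_rpow_const (p := lam / 2) (Or.inl hy.1.ne')).const_mul M).hasDerivWithinAt
  · refine (gc.continuousOn.integrableOn_compact ?_)
    rw [uIcc_of_le zero_le_one]
    exact isCompact_Icc.image
      (continuous_const.mul (continuous_id.rpow_const (fun _ => Or.inr (by positivity))))
  · rw [uIcc_of_le zero_le_one, integrableOn_Icc_iff_integrableOn_Ioc]
    have := (bi.const_mul (lam ^ 2 / 2 * A ^ lam))
    rw [intervalIntegrable_iff, uIoc_of_le zero_le_one] at this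
    refine this.congr_fun ?_ measurableSet_Ioc
    intro y hy
    exact (hfun y hy).symm

/-! ### Part D: from a zero to the next critical point -/

namespace Arc
variable {lam η x y d : ℝ} {U W : ℝ → ℝ}

theorem P_crit (hW : W d = 0) : fP lam η U W d = (lam + η) * fV lam η U d := by
  unfold fP; rw [hW]; ring

theorem E_crit (hW : W d = 0) : fE lam η U W d = η * (lam + η) * fV lam η U d ^ 2 +
    fV lam η U d ^ (2 + 2 / (lam + η)) / (2 + 2 / (lam + η)) := by
  unfold fE en; rw [P_crit hW]; ring

theorem P_nonneg_crit (h : Arc lam η x y U W) (hVx : fV lam η U x = 0) (hd : d ∈ Icc x y)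
    (hW : W d = 0) (hU : 0 < U d) : ∀ r ∈ Icc x d, 0 ≤ fP lam η U W r := by
  have hPd : 0 ≤ fP lam η U W d := by
    rw [P_crit hW]; exact mul_nonneg h.ha.le (h.V_nonneg hd)
  apply h.P_nonneg (E_nonneg_left hVx h) hd hPd
  rcases hd.2.lt_or_eq with h1 | h1
  · exact Or.inl h1
  · right
    rw [P_crit hW]
    apply mul_pos h.ha (mul_pos (rpow_pos_of_pos _ _) hU)
    rw [h1]; exact h.hx.trans_lt h.hxy

theorem V_mono_of (h : Arc lam η x y U W) {s t : ℝ} (hs : s ∈ Icc x y) (ht : t ∈ Icc x y)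
    (hst : s ≤ t) (hP : ∀ r ∈ Ioo s t, 0 ≤ fP lam η U W r) : fV lam η U s ≤ fV lam η U t := by
  have hsub : ∀ r ∈ Ioo s t, r ∈ Ioo x y := fun r hr =>
    ⟨hs.1.trans_lt hr.1, hr.2.trans_le ht.2⟩
  exact mono_of_hd hst (h.cV.mono (Icc_subset_Icc hs.1 ht.2)) (fun r hr => h.dV (hsub r hr))
    (fun r hr => div_nonneg (hP r hr) (h.rpos (hsub r hr)).le)

theorem V_anti_of (h : Arc lam η x y U W) {s t : ℝ} (hs : s ∈ Icc x y) (ht : t ∈ Icc x y)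
    (hst : s ≤ t) (hP : ∀ r ∈ Ioo s t, fP lam η U W r ≤ 0) : fV lam η U t ≤ fV lam η U s := by
  have hsub : ∀ r ∈ Ioo s t, r ∈ Ioo x y := fun r hr =>
    ⟨hs.1.trans_lt hr.1, hr.2.trans_le ht.2⟩
  exact anti_of_hd hst (h.cV.mono (Icc_subset_Icc hs.1 ht.2)) (fun r hr => h.dV (hsub r hr))
    (fun r hr => div_nonpos_of_nonpos_of_nonneg (hP r hr) (h.rpos (hsub r hr)).le)

theorem crit_gain (h : Arc lam η x y U W) (hVx : fV lam η U x = 0) (hd : d ∈ Icc x y)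
    (hW : W d = 0) (hU : 0 < U d) :
    fE lam η U W d - fE lam η U W x ≤
      η * ((1 + lam ^ 2) * fV lam η U d ^ 2 + 2 * fE lam η U W d) ∧
    fV lam η U d ^ 2 ≤ Kc lam ^ 2 + fE lam η U W d ∧ 0 ≤ fE lam η U W x ∧
    fE lam η U W x ≤ fE lam η U W d := by
  have hxI : x ∈ Icc x y := left_mem_Icc.2 h.hxy.le
  have hEx := E_nonneg_left hVx h
  have hE : fE lam η U W x ≤ fE lam η U W d := h.E_mono hxI hd hd.1
  have hP := h.P_nonneg_crit hVx hd hW hU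
  have hη := h.hη
  set c := fE lam η U W d with hc
  set V := fV lam η U d with hV
  have hV0 : 0 ≤ V := h.V_nonneg hd
  have hMb : V ^ 2 ≤ Kc lam ^ 2 + c :=
    peak_bound h.hlam h.hη h.hηl (hEx.trans hE) hV0 (le_refl _)
  refine ⟨?_, hMb, hEx, hE⟩
  set B := √(2 * c + lam ^ 2 * V ^ 2) with hB
  have hsub : ∀ r ∈ Ioo x d, r ∈ Icc x y := fun r hr => ⟨hr.1.le, hr.2.le.trans hd.2⟩
  have hPB : ∀ r ∈ Ioo x d, |fP lam η U W r| ≤ B := fun r hr => by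
    refine (absP_le_gq (h.E_mono (hsub r hr) hd hr.2.le)).trans
      ((gq_le h.ha (h.V_nonneg (hsub r hr))).trans ?_)
    apply sqrt_le_sqrt
    have h1 : fV lam η U r ≤ V := h.V_mono_of (hsub r hr) hd hr.2.le
      (fun s hs => hP s ⟨hr.1.le.trans hs.1.le, hs.2.le⟩)
    have := h.V_nonneg (hsub r hr)
    gcongr
  have h1 := h.gain_le (ς := 1) (Or.inl rfl) hxI hd hd.1
    (fun r hr => by have := hP r (Ioo_subset_Icc_self hr); linarith)
    (continuous_const (y := B)) hPB
  rw [hVx, ← hV, intervalIntegral.integral_const] at h1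
  simp only [smul_eq_mul, sub_zero] at h1
  have hc0 : 0 ≤ c := hEx.trans hE
  have hB2 : B ^ 2 = 2 * c + lam ^ 2 * V ^ 2 := sq_sqrt (by positivity)
  have hMB : 2 * (V * B) ≤ V ^ 2 + B ^ 2 := by nlinarith [sq_nonneg (V - B)]
  have : η * (2 * (V * B)) ≤ η * (V ^ 2 + B ^ 2) := by gcongr
  rw [hB2] at this
  linarith

end Arc

theorem crit_tendsto {ι : Type*} {l : Filter ι} {lam : ℝ} (hlam : 0 < lam)
    {η x y d : ι → ℝ} {U W : ι → ℝ → ℝ} (hη : Tendsto η l (𝓝 0))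
    (hA : ∀ᶠ i in l, Arc lam (η i) (x i) (y i) (U i) (W i))
    (hVx : ∀ᶠ i in l, fV lam (η i) (U i) (x i) = 0)
    (hd : ∀ᶠ i in l, d i ∈ Icc (x i) (y i) ∧ W i (d i) = 0 ∧ 0 < U i (d i))
    (hE : Tendsto (fun i => fE lam (η i) (U i) (W i) (x i)) l (𝓝 0)) :
    Tendsto (fun i => fE lam (η i) (U i) (W i) (d i)) l (𝓝 0) ∧
    Tendsto (fun i => fV lam (η i) (U i) (d i)) l (𝓝 0) := by
  have hK : 0 ≤ Kc lam ^ 2 := sq_nonneg _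
  set C := (lam ^ 2 + 3) * (Kc lam ^ 2 + 1) with hC
  have hCp : 0 < C := by positivity
  have h1 : ∀ᶠ i in l, η i * C < 1 / 2 := by
    have : Tendsto (fun i => η i * C) l (𝓝 (0 * C)) := hη.mul tendsto_const_nhds
    rw [zero_mul] at this
    exact this.eventually (gt_mem_nhds (by norm_num))
  have h2 : Tendsto (fun i => 2 * (fE lam (η i) (U i) (W i) (x i) + η i * C)) l (𝓝 (2 * (0 + 0 * C))) :=
    tendsto_const_nhds.mul (hE.add (hη.mul tendsto_const_nhds))
  rw [show (2 * (0 + 0 * C) : ℝ) = 0 by ring] at h2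
  have hEd : Tendsto (fun i => fE lam (η i) (U i) (W i) (d i)) l (𝓝 0) := by
    refine tendsto_of_tendsto_of_tendsto_of_le_of_le' tendsto_const_nhds h2 ?_ ?_
    · filter_upwards [hA, hVx, hd] with i hA hVx hd
      obtain ⟨_, _, a, b⟩ := hA.crit_gain hVx hd.1 hd.2.1 hd.2.2
      linarith
    · filter_upwards [hA, hVx, hd, h1] with i hA hVx hd h1
      obtain ⟨a, b, e, f⟩ := hA.crit_gain hVx hd.1 hd.2.1 hd.2.2
      have hη := hA.hη
      set c := fE lam (η i) (U i) (W i) (d i)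
      have h3 : (1 + lam ^ 2) * fV lam (η i) (U i) (d i) ^ 2 + 2 * c ≤ C * (1 + c) := by
        have : (1 + lam ^ 2) * fV lam (η i) (U i) (d i) ^ 2 ≤ (1 + lam ^ 2) * (Kc lam ^ 2 + c) := by gcongr
        have hc : 0 ≤ c := e.trans f
        rw [hC]
        nlinarith [mul_nonneg hK hc, mul_nonneg (sq_nonneg lam) (mul_nonneg hK hc), mul_nonneg (sq_nonneg lam) hc]
      have h4 : η i * ((1 + lam ^ 2) * fV lam (η i) (U i) (d i) ^ 2 + 2 * c) ≤ η i * (C * (1 + c)) := by gcongr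
      have hc : 0 ≤ c := e.trans f
      nlinarith
  refine ⟨hEd, ?_⟩
  rw [Metric.tendsto_nhds]
  intro e he
  set e' := min e 1 with he'
  have he'0 : 0 < e' := lt_min he one_pos
  have h3 := hEd.eventually (gt_mem_nhds (show 0 < e' ^ (2 + 2 / lam) / (2 + 2 / lam) by positivity))
  filter_upwards [hA, hd, h3] with i hA hd h3
  have hV0 := hA.V_nonneg hd.1
  rw [Real.dist_eq, sub_zero, abs_of_nonneg hV0]
  by_contra hcon
  push Not at hcon
  have hVe : e' ≤ fV lam (η i) (U i) (d i) := (min_le_left _ _).trans hcon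
  rw [Arc.E_crit hd.2.1] at h3
  set V := fV lam (η i) (U i) (d i)
  have ha := hA.ha
  have hη := hA.hη
  have hq : 2 + 2 / (lam + η i) ≤ 2 + 2 / lam := by
    have : 2 / (lam + η i) ≤ 2 / lam := div_le_div_of_nonneg_left (by norm_num) hlam (by linarith)
    linarith
  have hq0 : 0 < 2 + 2 / (lam + η i) := by positivity
  have h4 : e' ^ (2 + 2 / lam) ≤ V ^ (2 + 2 / (lam + η i)) :=
    (rpow_le_rpow_of_exponent_ge he'0 (min_le_right _ _) hq).trans
      (rpow_le_rpow he'0.le hVe hq0.le)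
  have h5 : e' ^ (2 + 2 / lam) / (2 + 2 / lam) ≤ V ^ (2 + 2 / (lam + η i)) / (2 + 2 / (lam + η i)) := by
    gcongr
  have h6 : 0 ≤ η i * (lam + η i) * V ^ 2 := by positivity
  linarith

theorem crit_tendsto_div {ι : Type*} {l : Filter ι} {lam L : ℝ} (hlam : 0 < lam)
    {η x y d : ι → ℝ} {U W : ι → ℝ → ℝ} (hη : Tendsto η l (𝓝 0))
    (hA : ∀ᶠ i in l, Arc lam (η i) (x i) (y i) (U i) (W i))
    (hVx : ∀ᶠ i in l, fV lam (η i) (U i) (x i) = 0)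
    (hd : ∀ᶠ i in l, d i ∈ Icc (x i) (y i) ∧ W i (d i) = 0 ∧ 0 < U i (d i))
    (hE : Tendsto (fun i => fE lam (η i) (U i) (W i) (x i)) l (𝓝 0))
    (hL : Tendsto (fun i => fE lam (η i) (U i) (W i) (x i) / η i) l (𝓝 L)) :
    Tendsto (fun i => fV lam (η i) (U i) (d i) ^ (2 + 2 / (lam + η i)) / (2 + 2 / (lam + η i)) / η i)
      l (𝓝 L) := by
  obtain ⟨hEd, hVd⟩ := crit_tendsto hlam hη hA hVx hd hE
  have e1 : Tendsto (fun i => (lam + η i) * fV lam (η i) (U i) (d i) ^ 2) l (𝓝 0) := by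
    have := (tendsto_const_nhds (x := lam)).add hη |>.mul (hVd.pow 2)
    simpa using this
  have e2 : Tendsto (fun i => (1 + lam ^ 2) * fV lam (η i) (U i) (d i) ^ 2 +
      2 * fE lam (η i) (U i) (W i) (d i)) l (𝓝 0) := by
    have := ((tendsto_const_nhds (x := 1 + lam ^ 2)).mul (hVd.pow 2)).add (hEd.const_mul 2)
    simpa using this
  have lo := hL.sub e1
  have hi := (hL.add e2).sub e1
  rw [sub_zero] at lo
  rw [add_zero, sub_zero] at hi
  have key : ∀ᶠ i in l, fV lam (η i) (U i) (d i) ^ (2 + 2 / (lam + η i)) / (2 + 2 / (lam + η i)) / η i =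
      fE lam (η i) (U i) (W i) (d i) / η i - (lam + η i) * fV lam (η i) (U i) (d i) ^ 2 := by
    filter_upwards [hA, hd] with i hA hd
    have := hA.hη.ne'
    rw [Arc.E_crit hd.2.1]
    generalize fV lam (η i) (U i) (d i) ^ (2 + 2 / (lam + η i)) / (2 + 2 / (lam + η i)) = X
    field_simp
    ring
  refine tendsto_of_tendsto_of_tendsto_of_le_of_le' lo hi ?_ ?_
  · filter_upwards [hA, hVx, hd, key] with i hA hVx hd key
    obtain ⟨a, b, e, f⟩ := hA.crit_gain hVx hd.1 hd.2.1 hd.2.2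
    rw [key]
    have := div_le_div_of_nonneg_right f hA.hη.le
    linarith
  · filter_upwards [hA, hVx, hd, key] with i hA hVx hd key
    obtain ⟨a, b, e, f⟩ := hA.crit_gain hVx hd.1 hd.2.1 hd.2.2
    rw [key]
    have h1 := div_le_div_of_nonneg_right a hA.hη.le
    rw [mul_div_cancel_left₀ _ hA.hη.ne', sub_div] at h1
    linarith

/-! ### Part E: the linear regime -/

/-- Smallness of the threshold `θ`. -/
def ThSmall (lam θ : ℝ) : Prop := 0 < θ ∧ θ ≤ 1 ∧ θ ^ (1 / lam) ≤ lam ^ 2 / 2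

theorem pow_small {lam η θ V : ℝ} (hlam : 0 < lam) (hη : 0 < η) (hηl : η ≤ lam / 2)
    (hV : 0 ≤ V) (hVθ : V ≤ θ) (hθ1 : θ ≤ 1) : V ^ (2 / (lam + η)) ≤ θ ^ (1 / lam) := by
  have ha : 0 < lam + η := by linarith
  rcases hV.eq_or_lt with rfl | hV0
  · rw [zero_rpow (by positivity)]; positivity
  calc V ^ (2 / (lam + η)) ≤ V ^ (1 / lam) := by
        apply rpow_le_rpow_of_exponent_ge hV0 (hVθ.trans hθ1)
        rw [div_le_div_iff₀ hlam ha]; linarith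
    _ ≤ θ ^ (1 / lam) := rpow_le_rpow hV hVθ (by positivity)

theorem small_P {lam η θ P V : ℝ} (hlam : 0 < lam) (hη : 0 < η) (hηl : η ≤ lam / 2)
    (hθ : ThSmall lam θ) (hV : 0 ≤ V) (hVθ : V ≤ θ) (hE : 0 ≤ en lam η P V) :
    lam / 2 * V ≤ |P| := by
  have ha : 0 < lam + η := by linarith
  rcases hV.eq_or_lt with rfl | hV0
  · simp
  have h1 := pow_small hlam hη hηl hV hVθ hθ.2.1
  have h2 := en_P lam η P V
  have hq : 2 ≤ 2 + 2 / (lam + η) := by have : 0 ≤ 2 / (lam + η) := by positivity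
                                        linarith
  have h3 : 2 * V ^ (2 + 2 / (lam + η)) / (2 + 2 / (lam + η)) ≤ V ^ 2 * (lam ^ 2 / 2) := by
    rw [rpow_add hV0, rpow_two, div_le_iff₀ (by linarith)]
    have h4 : V ^ 2 * V ^ (2 / (lam + η)) ≤ V ^ 2 * (lam ^ 2 / 2) := by
      have := h1.trans hθ.2.2
      gcongr
    have h5 : 0 ≤ V ^ 2 * (lam ^ 2 / 2) := by positivity
    nlinarith
  rw [← abs_of_nonneg (show 0 ≤ lam / 2 * V by positivity), ← sq_le_sq]
  have h6 : η ^ 2 ≤ lam ^ 2 / 4 := by nlinarith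
  nlinarith [mul_le_mul_of_nonneg_right h6 (sq_nonneg V)]

namespace Arc
variable {lam η x y d : ℝ} {U W : ℝ → ℝ}

theorem N_eq (_h : Arc lam η x y U W) {r : ℝ} :
    r ^ (lam + η) * fN lam U W r = fP lam η U W r + (lam - η) * fV lam η U r := by
  unfold fN fP fV; ring

theorem N_lemma (h : Arc lam η x y U W) (hE : 0 ≤ fE lam η U W x) (hηl : η ≤ lam / 2) {θ s t : ℝ}
    (hθ : ThSmall lam θ) (hs : s ∈ Icc x y) (ht : t ∈ Icc x y) (hst : s ≤ t)
    (hP : ∀ r ∈ Ioo s t, 0 ≤ fP lam η U W r) (hV : ∀ r ∈ Ioo s t, fV lam η U r ≤ θ)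
    (hVt : fV lam η U t ≤ θ) (hN : 0 < fN lam U W t) :
    fN lam U W t ≤ fN lam U W s ∧ log (fN lam U W s) ≤ log (fN lam U W t) +
      4 / lam * fV lam η U t ^ (2 / (lam + η)) := by
  have hsub : ∀ r ∈ Ioo s t, r ∈ Ioo x y := fun r hr =>
    ⟨hs.1.trans_lt hr.1, hr.2.trans_le ht.2⟩
  have hI : Icc s t ⊆ Icc x y := Icc_subset_Icc hs.1 ht.2
  have hlam := h.hlam
  have hη := h.hη
  have ha := h.ha
  have E0 : ∀ r ∈ Icc x y, 0 ≤ fE lam η U W r := fun r hr =>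
    hE.trans (h.E_mono (left_mem_Icc.2 h.hxy.le) hr hr.1)
  have hmono : ∀ r ∈ Icc s t, fN lam U W t ≤ fN lam U W r := by
    intro r hr
    apply anti_of_hd hr.2 (h.cN.mono ((Icc_subset_Icc_left hr.1).trans hI))
      (fun z hz => h.dN (hsub z ⟨hr.1.trans_lt hz.1, hz.2⟩))
    intro z hz
    have hz' := hsub z ⟨hr.1.trans_lt hz.1, hz.2⟩
    have := h.rpos hz'
    have := h.pos z hz'
    have : 0 ≤ z * U z ^ (1 + 2 / (lam + η)) := by positivity
    linarith
  refine ⟨hmono s (left_mem_Icc.2 hst), ?_⟩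
  have hpos : ∀ r ∈ Icc s t, 0 < fN lam U W r := fun r hr => hN.trans_le (hmono r hr)
  have hmain := mono_of_hd
    (f := fun r => log (fN lam U W r) + 4 / lam * fV lam η U r ^ (2 / (lam + η)))
    (f' := fun r => -(r * U r ^ (1 + 2 / (lam + η))) / fN lam U W r +
      4 / lam * (fP lam η U W r / r * (2 / (lam + η)) * fV lam η U r ^ (2 / (lam + η) - 1)))
    hst ?_ ?_ ?_
  · have : 0 ≤ 4 / lam * fV lam η U s ^ (2 / (lam + η)) := by
      have := rpow_nonneg (h.V_nonneg hs) (2 / (lam + η))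
      positivity
    beta_reduce at hmain
    linarith
  · apply ContinuousOn.add
    · exact (h.cN.mono hI).log (fun r hr => (hpos r hr).ne')
    · exact continuousOn_const.mul ((h.cV.mono hI).rpow_const (fun r _ => Or.inr (by positivity)))
  · intro r hr
    exact ((h.dN (hsub r hr)).log (hpos r (Ioo_subset_Icc_self hr)).ne').add
      (((h.dV (hsub r hr)).rpow_const (Or.inl (h.V_pos (hsub r hr)).ne')).const_mul _)
  · intro r hr
    have hrI := hsub r hr
    have r0 := h.rpos hrI
    have hV0 := h.V_pos hrI
    have hN0 := hpos r (Ioo_subset_Icc_self hr)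
    have hPr := hP r hr
    have hsm := small_P hlam hη hηl hθ hV0.le (hV r hr) (E0 r (Ioo_subset_Icc_self hrI))
    rw [abs_of_nonneg hPr] at hsm
    have hk := h.pow_key hrI
    have hNe := h.N_eq (r := r)
    have hra : 0 < r ^ (lam + η) := rpow_pos_of_pos r0 _
    set P := fP lam η U W r
    set V := fV lam η U r
    set N := fN lam U W r
    set X := V ^ (2 / (lam + η)) with hX
    have hX0 : 0 < X := rpow_pos_of_pos hV0 _
    have e1 : V ^ (1 + 2 / (lam + η)) = V * X := by rw [rpow_add hV0, rpow_one]
    have e2 : V ^ (2 / (lam + η) - 1) = X / V := by rw [rpow_sub_one hV0.ne']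
    rw [e1] at hk
    rw [e2]
    have e3 : r * U r ^ (1 + 2 / (lam + η)) / N = V * X / (P + (lam - η) * V) / r := by
      rw [← hNe, ← hk]; field_simp
    rw [neg_div, e3]
    have hZ : lam / 2 * V ≤ P + (lam - η) * V := by nlinarith
    have hZ0 : 0 < P + (lam - η) * V := lt_of_lt_of_le (by positivity) hZ
    have i1 : V * X / (P + (lam - η) * V) ≤ 2 / lam * X := by
      rw [div_le_iff₀ hZ0]
      calc V * X = 2 / lam * X * (lam / 2 * V) := by field_simp
        _ ≤ 2 / lam * X * (P + (lam - η) * V) := by gcongr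
    have i2 : 2 / lam * X ≤ 4 / lam * (P * (2 / (lam + η)) * (X / V)) := by
      have : 1 / 2 ≤ P * (2 / (lam + η)) / V := by
        rw [le_div_iff₀ hV0, mul_div_assoc', le_div_iff₀ ha]
        nlinarith
      calc 2 / lam * X = 4 / lam * X * (1 / 2) := by ring
        _ ≤ 4 / lam * X * (P * (2 / (lam + η)) / V) := by gcongr
        _ = _ := by ring
    have i3 : 4 / lam * (P / r * (2 / (lam + η)) * (X / V)) =
      4 / lam * (P * (2 / (lam + η)) * (X / V)) / r := by ring
    rw [i3]
    have := div_le_div_of_nonneg_right (i1.trans i2) r0.le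
    linarith

/-- The function `log |r^{2λ+1} U'|`. -/
def fG (lam : ℝ) (W : ℝ → ℝ) (r : ℝ) : ℝ := log (-W r) + (2 * lam + 1) * log r

theorem Y_eq (_h : Arc lam η x y U W) {r : ℝ} (hr : 0 < r) :
    r ^ (lam + η + 1) * W r = fP lam η U W r - (lam + η) * fV lam η U r := by
  unfold fP; rw [rpow_add_one hr.ne']; ring

theorem J_lemma (h : Arc lam η x y U W) (hE : 0 ≤ fE lam η U W x) (hηl : η ≤ lam / 2) {θ s : ℝ}
    (hθ : ThSmall lam θ) (hs : s ∈ Ioo x y)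
    (hP : ∀ r ∈ Ico s y, fP lam η U W r ≤ 0) (hV : ∀ r ∈ Ico s y, fV lam η U r ≤ θ) :
    W y < 0 ∧ fG lam W s ≤ fG lam W y ∧
      fG lam W y ≤ fG lam W s + 2 / lam * fV lam η U s ^ (2 / (lam + η)) := by
  have hsub : ∀ r ∈ Ico s y, r ∈ Ioo x y := fun r hr => ⟨hs.1.trans_le hr.1, hr.2⟩
  have hI : Icc s y ⊆ Icc x y := Icc_subset_Icc_left hs.1.le
  have hlam := h.hlam
  have hη := h.hη
  have ha := h.ha
  have s0 : 0 < s := h.rpos hs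
  have E0 : ∀ r ∈ Icc x y, 0 ≤ fE lam η U W r := fun r hr =>
    hE.trans (h.E_mono (left_mem_Icc.2 h.hxy.le) hr hr.1)
  have hWneg : ∀ r ∈ Ico s y, W r < 0 := by
    intro r hr
    have r0 := h.rpos (hsub r hr)
    have h1 := h.Y_eq r0
    have h2 := hP r hr
    have h3 := h.V_pos (hsub r hr)
    have h4 : 0 < r ^ (lam + η + 1) := rpow_pos_of_pos r0 _
    have h5 : r ^ (lam + η + 1) * W r < 0 := by nlinarith
    by_contra hcon
    push Not at hcon
    nlinarith [mul_nonneg h4.le hcon]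
  have hcJ : ContinuousOn (fun r => r ^ (2 * lam + 1) * W r) (Icc s y) :=
    ((continuous_id.rpow_const (fun _ => Or.inr (by positivity))).continuousOn).mul (h.cW.mono hI)
  have hJ : y ^ (2 * lam + 1) * W y ≤ s ^ (2 * lam + 1) * W s := by
    apply anti_of_hd (f := fun r => r ^ (2 * lam + 1) * W r)
      (f' := fun r => -(r ^ (2 * lam + 1) * U r ^ (1 + 2 / (lam + η)))) hs.2.le hcJ
    · intro r hr
      have hrI := hsub r (Ioo_subset_Ico_self hr)
      have r0 := h.rpos hrI
      refine ((hasDerivAt_rpow_const (p := 2 * lam + 1) (Or.inl r0.ne')).mul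
        (h.dW r hrI)).congr_deriv ?_
      rw [rpow_sub_one r0.ne']
      field_simp
      ring
    · intro r hr
      have hrI := hsub r (Ioo_subset_Ico_self hr)
      have r0 := h.rpos hrI
      have := h.pos r hrI
      have : 0 ≤ r ^ (2 * lam + 1) * U r ^ (1 + 2 / (lam + η)) := by positivity
      linarith
  have y0 : 0 < y := s0.trans hs.2
  have hWy : W y < 0 := by
    have h1 := hWneg s ⟨le_refl _, hs.2⟩
    have h2 : 0 < s ^ (2 * lam + 1) := rpow_pos_of_pos s0 _
    have h3 : 0 < y ^ (2 * lam + 1) := rpow_pos_of_pos y0 _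
    by_contra hcon
    push Not at hcon
    nlinarith [mul_nonneg h3.le hcon, mul_pos h2 (neg_pos.2 h1)]
  have hWneg' : ∀ r ∈ Icc s y, W r < 0 := by
    intro r hr
    rcases hr.2.lt_or_eq with h1 | h1
    · exact hWneg r ⟨hr.1, h1⟩
    · rw [h1]; exact hWy
  have hcG : ContinuousOn (fG lam W) (Icc s y) := by
    apply ContinuousOn.add
    · exact (h.cW.mono hI).neg.log (fun r hr => (neg_pos.2 (hWneg' r hr)).ne')
    · exact continuousOn_const.mul (continuousOn_id.log (fun r hr => (s0.trans_le hr.1).ne'))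
  have hdG : ∀ r ∈ Ioo s y, HasDerivAt (fG lam W) (U r ^ (1 + 2 / (lam + η)) / (-W r)) r := by
    intro r hr
    have hrI := hsub r (Ioo_subset_Ico_self hr)
    have r0 := h.rpos hrI
    have hw := hWneg r (Ioo_subset_Ico_self hr)
    refine (((h.dW r hrI).neg.log (neg_pos.2 hw).ne').add
      ((hasDerivAt_log r0.ne').const_mul (2 * lam + 1))).congr_deriv ?_
    have := hw.ne
    simp only [Pi.neg_apply]
    field_simp
    ring
  refine ⟨hWy, ?_, ?_⟩
  · apply mono_of_hd hs.2.le hcG hdG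
    intro r hr
    have hrI := hsub r (Ioo_subset_Ico_self hr)
    have := h.pos r hrI
    have hw := hWneg r (Ioo_subset_Ico_self hr)
    exact div_nonneg (by positivity) (by linarith)
  have hmain := anti_of_hd
    (f := fun r => fG lam W r + 2 / lam * fV lam η U r ^ (2 / (lam + η)))
    (f' := fun r => U r ^ (1 + 2 / (lam + η)) / (-W r) +
      2 / lam * (fP lam η U W r / r * (2 / (lam + η)) * fV lam η U r ^ (2 / (lam + η) - 1)))
    hs.2.le ?_ ?_ ?_
  · have : 0 ≤ 2 / lam * fV lam η U y ^ (2 / (lam + η)) := by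
      have := rpow_nonneg (h.V_nonneg (right_mem_Icc.2 h.hxy.le)) (2 / (lam + η))
      positivity
    beta_reduce at hmain
    linarith
  · exact hcG.add (continuousOn_const.mul ((h.cV.mono hI).rpow_const (fun r _ => Or.inr (by positivity))))
  · intro r hr
    have hrI := hsub r (Ioo_subset_Ico_self hr)
    exact (hdG r hr).add
      (((h.dV hrI).rpow_const (Or.inl (h.V_pos hrI).ne')).const_mul _)
  · intro r hr
    have hrJ := Ioo_subset_Ico_self hr
    have hrI := hsub r hrJ
    have r0 := h.rpos hrI
    have hV0 := h.V_pos hrI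
    have hw := hWneg r hrJ
    have hPr := hP r hrJ
    have hsm := small_P hlam hη hηl hθ hV0.le (hV r hrJ) (E0 r (Ioo_subset_Icc_self hrI))
    rw [abs_of_nonpos hPr] at hsm
    have hk := h.pow_key hrI
    have hYe := h.Y_eq (η := η) (U := U) r0
    rw [rpow_add_one r0.ne'] at hYe
    have hra : 0 < r ^ (lam + η) := rpow_pos_of_pos r0 _
    set P := fP lam η U W r
    set V := fV lam η U r
    set X := V ^ (2 / (lam + η)) with hX
    have hX0 : 0 < X := rpow_pos_of_pos hV0 _
    have e1 : V ^ (1 + 2 / (lam + η)) = V * X := by rw [rpow_add hV0, rpow_one]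
    have e2 : V ^ (2 / (lam + η) - 1) = X / V := by rw [rpow_sub_one hV0.ne']
    rw [e1] at hk
    rw [e2]
    have e3 : U r ^ (1 + 2 / (lam + η)) / (-W r) = V * X / ((lam + η) * V - P) / r := by
      have : (lam + η) * V - P = -(r ^ (lam + η) * r * W r) := by linarith
      rw [this, ← hk]
      have := hw.ne
      field_simp
    rw [e3]
    have hZ : lam * V ≤ (lam + η) * V - P := by nlinarith
    have hZ0 : 0 < (lam + η) * V - P := lt_of_lt_of_le (by positivity) hZ
    have i1 : V * X / ((lam + η) * V - P) ≤ 1 / lam * X := by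
      rw [div_le_iff₀ hZ0]
      calc V * X = 1 / lam * X * (lam * V) := by field_simp
        _ ≤ 1 / lam * X * ((lam + η) * V - P) := by gcongr
    have i2 : 1 / lam * X ≤ 2 / lam * (-P * (2 / (lam + η)) * (X / V)) := by
      have : 1 / 2 ≤ -P * (2 / (lam + η)) / V := by
        rw [le_div_iff₀ hV0, mul_div_assoc', le_div_iff₀ ha]
        nlinarith
      calc 1 / lam * X = 2 / lam * X * (1 / 2) := by ring
        _ ≤ 2 / lam * X * (-P * (2 / (lam + η)) / V) := by gcongr
        _ = _ := by ring
    have i3 : 2 / lam * (P / r * (2 / (lam + η)) * (X / V)) =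
      -(2 / lam * (-P * (2 / (lam + η)) * (X / V)) / r) := by ring
    rw [i3]
    have := div_le_div_of_nonneg_right (i1.trans i2) r0.le
    linarith

end Arc

theorem exists_small {lam : ℝ} (hlam : 0 < lam) : ∀ᶠ θ in 𝓝[>] (0 : ℝ), ThSmall lam θ := by
  have h1 : Tendsto (fun θ : ℝ => θ ^ (1 / lam)) (𝓝[>] 0) (𝓝 0) := by
    have := (continuous_id.rpow_const (p := 1 / lam) (fun _ => Or.inr (by positivity))).tendsto (0 : ℝ)
    simp only [id] at this
    rw [zero_rpow (by positivity)] at this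
    exact this.mono_left nhdsWithin_le_nhds
  filter_upwards [Ioc_mem_nhdsGT (one_pos : (0 : ℝ) < 1),
    h1.eventually (gt_mem_nhds (show 0 < lam ^ 2 / 2 by positivity))] with θ a b
  exact ⟨a.1, a.2, b.le⟩

/-- Relation between the slope at a zero and the value at the next critical point. -/
theorem slope_tendsto {ι : Type*} {l : Filter ι} {lam : ℝ} (hlam : 0 < lam)
    {η x y d : ι → ℝ} {U W : ι → ℝ → ℝ} (hη : Tendsto η l (𝓝 0))
    (hA : ∀ᶠ i in l, Arc lam (η i) (x i) (y i) (U i) (W i))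
    (hUx : ∀ᶠ i in l, U i (x i) = 0)
    (hd : ∀ᶠ i in l, d i ∈ Icc (x i) (y i) ∧ W i (d i) = 0 ∧ 0 < U i (d i))
    (hE : Tendsto (fun i => fE lam (η i) (U i) (W i) (x i)) l (𝓝 0)) :
    Tendsto (fun i => log (x i * W i (x i)) - log (2 * lam * U i (d i))) l (𝓝 0) := by
  have hVx : ∀ᶠ i in l, fV lam (η i) (U i) (x i) = 0 := by
    filter_upwards [hUx] with i h
    unfold fV; rw [h, mul_zero]
  obtain ⟨-, hVd⟩ := crit_tendsto hlam hη hA hVx hd hE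
  obtain ⟨θ, hθ⟩ := (exists_small hlam).exists
  have hup : Tendsto (fun i => 4 / lam * fV lam (η i) (U i) (d i) ^ (1 / lam)) l (𝓝 0) := by
    have := (hVd.rpow_const (p := 1 / lam) (Or.inr (by positivity))).const_mul (4 / lam)
    rwa [zero_rpow (by positivity), mul_zero] at this
  have h1 := hη.eventually (gt_mem_nhds (show 0 < lam / 2 by positivity))
  have h2 := hVd.eventually (gt_mem_nhds hθ.1)
  have key : ∀ᶠ i in l, 0 ≤ log (x i * W i (x i)) - log (2 * lam * U i (d i)) ∧
      log (x i * W i (x i)) - log (2 * lam * U i (d i)) ≤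
        4 / lam * fV lam (η i) (U i) (d i) ^ (1 / lam) := by
    filter_upwards [hA, hUx, hVx, hd, h1, h2] with i hA hUx hVx hd h1 h2
    have hP := hA.P_nonneg_crit hVx hd.1 hd.2.1 hd.2.2
    have hN : fN lam (U i) (W i) (d i) = 2 * lam * U i (d i) := by
      unfold fN; rw [hd.2.1]; ring
    have hNx : fN lam (U i) (W i) (x i) = x i * W i (x i) := by
      unfold fN; rw [hUx]; ring
    have hN0 : 0 < 2 * lam * U i (d i) := mul_pos (by positivity) hd.2.2
    have hsub : ∀ r ∈ Ioo (x i) (d i), r ∈ Icc (x i) (y i) := fun r hr => ⟨hr.1.le, hr.2.le.trans hd.1.2⟩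
    have := hA.N_lemma (Arc.E_nonneg_left hVx hA) h1.le hθ (left_mem_Icc.2 hA.hxy.le) hd.1 hd.1.1
      (fun r hr => hP r (Ioo_subset_Icc_self hr))
      (fun r hr => (hA.V_mono_of (hsub r hr) hd.1 hr.2.le
        (fun s hs => hP s ⟨hr.1.le.trans hs.1.le, hs.2.le⟩)).trans h2.le) h2.le (by rw [hN]; exact hN0)
    rw [hN, hNx] at this
    obtain ⟨a, b⟩ := this
    constructor
    · linarith [log_le_log hN0 a]
    · have c := pow_small hlam hA.hη h1.le (hA.V_nonneg hd.1) le_rfl (h2.le.trans hθ.2.1)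
      have : 4 / lam * fV lam (η i) (U i) (d i) ^ (2 / (lam + η i)) ≤
        4 / lam * fV lam (η i) (U i) (d i) ^ (1 / lam) := by gcongr
      linarith
  exact tendsto_of_tendsto_of_tendsto_of_le_of_le' tendsto_const_nhds hup
    (key.mono fun _ h => h.1) (key.mono fun _ h => h.2)

/-! ### Part F: crossing a bump -/

set_option maxHeartbeats 1000000 in
theorem mid_est {lam θ : ℝ} (hlam : 0 < lam) (hθ0 : 0 < θ) (hθ1 : θ ≤ 1) :
    ∃ C, 0 < C ∧ ∃ c0, 0 < c0 ∧ ∀ η P V, 0 < η → η < lam → 0 ≤ en lam η P V →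
      en lam η P V ≤ c0 → θ ≤ V → 0 < (lam + η) * V - P ∧
      |(η - lam) + V ^ (1 + 2 / (lam + η)) / ((lam + η) * V - P) - (lam + 1) / lam * (P / V) - 1| ≤
        C * (η + en lam η P V) := by
  set B := Kc lam + 1 with hB
  have hK := Kc_ge_one hlam
  have hB1 : 1 ≤ B := by linarith
  have hB0 : 0 < B := by linarith
  set β := θ ^ (2 + 2 / lam) / (2 + 2 / lam) with hβ
  have hβ0 : 0 < β := by positivity
  set K := 2 * (lam + 1) / lam + (2 * B ^ 2 + (2 * lam + 1) / lam * (2 * lam * B * B) +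
    B ^ (2 + 2 / lam) / lam) with hKd
  have hK0 : 0 < K := by positivity
  refine ⟨K * (4 * lam * B) / (θ * β), by positivity, min (β / 2) 1,
    lt_min (by positivity) one_pos, ?_⟩
  intro η P V hη hηl hE0 hEc hV
  have ha : 0 < lam + η := by linarith
  have hV0 : 0 < V := by linarith
  have hVK := peak_bound hlam hη hηl hE0 hV0.le le_rfl
  have hE1 : en lam η P V ≤ 1 := hEc.trans (min_le_right _ _)
  have hE2 : en lam η P V ≤ β / 2 := hEc.trans (min_le_left _ _)
  have hVB : V ≤ B := by rw [hB]; nlinarith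
  have hPe := en_P lam η P V
  set e := en lam η P V with he
  have hq : 2 + 2 / (lam + η) ≤ 2 + 2 / lam := by
    have : 2 / (lam + η) ≤ 2 / lam := div_le_div_of_nonneg_left (by norm_num) hlam (by linarith)
    linarith
  have hq0 : 0 < 2 + 2 / (lam + η) := by positivity
  have hXlo : θ ^ (2 + 2 / lam) ≤ V ^ (2 + 2 / (lam + η)) :=
    (rpow_le_rpow_of_exponent_ge hθ0 hθ1 hq).trans (rpow_le_rpow hθ0.le hV hq0.le)
  have hXhi : V ^ (2 + 2 / (lam + η)) ≤ B ^ (2 + 2 / lam) :=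
    (rpow_le_rpow hV0.le hVB hq0.le).trans (rpow_le_rpow_of_exponent_le hB1 hq)
  have hXβ : β ≤ V ^ (2 + 2 / (lam + η)) / (2 + 2 / (lam + η)) := by
    rw [hβ]; gcongr
  have hpX : V ^ (1 + 2 / (lam + η)) = V ^ (2 + 2 / (lam + η)) / V := by
    rw [← rpow_sub_one hV0.ne']; congr 1; ring
  have hqe : 2 + 2 / (lam + η) = 2 * (lam + η + 1) / (lam + η) := by field_simp
  set X := V ^ (2 + 2 / (lam + η)) with hX
  have hX0 : 0 < X := rpow_pos_of_pos hV0 _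
  have hdiff : ((lam + η) * V) ^ 2 - P ^ 2 = 2 * η * (lam + η) * V ^ 2 - 2 * e +
      2 * (X / (2 + 2 / (lam + η))) := by
    rw [hPe]; ring
  have hlow : β ≤ ((lam + η) * V) ^ 2 - P ^ 2 := by
    rw [hdiff]
    have : 0 ≤ 2 * η * (lam + η) * V ^ 2 := by positivity
    linarith
  have haV : 0 < (lam + η) * V := by positivity
  have hPabs : |P| < (lam + η) * V := abs_lt_of_sq_lt_sq (by linarith) haV.le
  obtain ⟨hP1, hP2⟩ := abs_lt.1 hPabs
  have hY0 : 0 < (lam + η) * V - P := by linarith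
  have haVB : (lam + η) * V ≤ 2 * lam * B := by
    have : lam + η ≤ 2 * lam := by linarith
    gcongr
  have hYlo : β / (4 * lam * B) ≤ (lam + η) * V - P := by
    rw [div_le_iff₀ (by positivity)]
    have : ((lam + η) * V) ^ 2 - P ^ 2 = ((lam + η) * V - P) * ((lam + η) * V + P) := by ring
    rw [this] at hlow
    refine hlow.trans (mul_le_mul_of_nonneg_left ?_ hY0.le)
    linarith
  refine ⟨hY0, ?_⟩
  set S := (lam + η) / lam * V ^ 2 + (2 * lam + 1) / lam * (P * V) + X / (lam * (lam + η + 1)) with hS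
  have hSb : |S| ≤ 2 * B ^ 2 + (2 * lam + 1) / lam * (2 * lam * B * B) + B ^ (2 + 2 / lam) / lam := by
    rw [hS]
    refine (abs_add_le _ _).trans (add_le_add ((abs_add_le _ _).trans (add_le_add ?_ ?_)) ?_)
    · rw [abs_of_nonneg (by positivity)]
      have : (lam + η) / lam ≤ 2 := by rw [div_le_iff₀ hlam]; linarith
      gcongr
    · rw [abs_mul, abs_of_nonneg (show 0 ≤ (2 * lam + 1) / lam by positivity), abs_mul,
        abs_of_pos hV0]
      have : |P| ≤ 2 * lam * B := by linarith
      gcongr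
    · rw [abs_of_nonneg (by positivity)]
      apply div_le_div₀ (by positivity) hXhi hlam
      nlinarith
  have hD : (η - lam) + V ^ (1 + 2 / (lam + η)) / ((lam + η) * V - P) - (lam + 1) / lam * (P / V) - 1
      = (2 * (lam + 1) / lam * e - η * S) / (V * ((lam + η) * V - P)) := by
    have hP2' : P ^ 2 = 2 * e + (lam ^ 2 - η ^ 2) * V ^ 2 - X * ((lam + η) / (lam + η + 1)) := by
      rw [hPe, hqe]; field_simp
    have h1 : 0 < lam + η + 1 := by linarith
    rw [hpX, eq_div_iff (by positivity), hS]
    have e1 : ∀ Y, Y ≠ 0 → ((η - lam) + X / V / Y - (lam + 1) / lam * (P / V) - 1) *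
        (V * Y) = (η - lam - 1) * (V * Y) + X - (lam + 1) / lam * (P * Y) := by
      intro Y hY
      field_simp
      ring
    have e2 : P * ((lam + η) * V - P) = P * (lam + η) * V - P ^ 2 := by ring
    rw [e1 _ hY0.ne', e2, hP2']
    field_simp
    ring
  rw [hD, abs_div, abs_of_pos (show 0 < V * ((lam + η) * V - P) by positivity)]
  have hnum : |2 * (lam + 1) / lam * e - η * S| ≤ K * (η + e) := by
    refine (abs_sub _ _).trans ?_
    rw [abs_mul η S, abs_of_pos hη, abs_of_nonneg (show 0 ≤ 2 * (lam + 1) / lam * e by positivity)]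
    have h2 : 0 ≤ 2 * B ^ 2 + (2 * lam + 1) / lam * (2 * lam * B * B) + B ^ (2 + 2 / lam) / lam := by positivity
    have h3 : 0 ≤ 2 * (lam + 1) / lam := by positivity
    rw [hKd]
    generalize 2 * B ^ 2 + (2 * lam + 1) / lam * (2 * lam * B * B) + B ^ (2 + 2 / lam) / lam = T at hSb h2
    generalize 2 * (lam + 1) / lam = T' at h3
    have h1 : η * |S| ≤ η * T := mul_le_mul_of_nonneg_left hSb hη.le
    have h4 := mul_nonneg h2 hE0
    have h5 := mul_nonneg h3 hη.le
    linarith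
  have hden : θ * (β / (4 * lam * B)) ≤ V * ((lam + η) * V - P) := by gcongr
  calc |2 * (lam + 1) / lam * e - η * S| / (V * ((lam + η) * V - P))
      ≤ K * (η + e) / (θ * (β / (4 * lam * B))) := by
        apply div_le_div₀ (by positivity) hnum (by positivity) hden
    _ = _ := by field_simp

namespace Arc
variable {lam η x y d : ℝ} {U W : ℝ → ℝ}

/-- time spent in the nonlinear regime -/
theorem mid_time (h : Arc lam η x y U W) {s t K : ℝ} (hs : s ∈ Ioo x y) (ht : t ∈ Ioo x y)
    (hst : s ≤ t)
    (hY : ∀ r ∈ Icc s t, 0 < (lam + η) * fV lam η U r - fP lam η U W r)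
    (hD : ∀ r ∈ Icc s t, |(η - lam) + fV lam η U r ^ (1 + 2 / (lam + η)) /
      ((lam + η) * fV lam η U r - fP lam η U W r) -
      (lam + 1) / lam * (fP lam η U W r / fV lam η U r) - 1| ≤ K) :
    |(log ((lam + η) * fV lam η U t - fP lam η U W t) - (lam + 1) / lam * log (fV lam η U t)) -
     (log ((lam + η) * fV lam η U s - fP lam η U W s) - (lam + 1) / lam * log (fV lam η U s)) -
     (log t - log s)| ≤ K * (log t - log s) := by
  have hsub : ∀ r ∈ Icc s t, r ∈ Ioo x y := fun r hr =>
    ⟨hs.1.trans_le hr.1, hr.2.trans_lt ht.2⟩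
  have hI : Icc s t ⊆ Icc x y := fun r hr => Ioo_subset_Icc_self (hsub r hr)
  have ha := h.ha
  have s0 := h.rpos hs
  set Q : ℝ → ℝ := fun r => log ((lam + η) * fV lam η U r - fP lam η U W r) -
    (lam + 1) / lam * log (fV lam η U r) with hQ
  have hcQ : ContinuousOn Q (Icc s t) := by
    apply ContinuousOn.sub
    · exact ((continuousOn_const.mul (h.cV.mono hI)).sub (h.cP.mono hI)).log (fun r hr => (hY r hr).ne')
    · exact continuousOn_const.mul ((h.cV.mono hI).log (fun r hr => (h.V_pos (hsub r hr)).ne'))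
  have hcl : ContinuousOn log (Icc s t) :=
    continuousOn_id.log (fun r hr => (s0.trans_le hr.1).ne')
  have hdQ : ∀ r ∈ Icc s t, HasDerivAt Q (((η - lam) + fV lam η U r ^ (1 + 2 / (lam + η)) /
      ((lam + η) * fV lam η U r - fP lam η U W r) -
      (lam + 1) / lam * (fP lam η U W r / fV lam η U r)) / r) r := by
    intro r hr
    have hrI := hsub r hr
    have r0 := h.rpos hrI
    have hV0 := h.V_pos hrI
    have hY0 := hY r hr
    have h1 := ((((h.dV hrI).const_mul (lam + η)).sub (h.dP hrI)).log hY0.ne').sub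
      (((h.dV hrI).log hV0.ne').const_mul ((lam + 1) / lam))
    refine h1.congr_deriv ?_
    simp only [Pi.sub_apply]
    generalize fV lam η U r ^ (1 + 2 / (lam + η)) = X
    have := h.hlam.ne'
    have := hY0.ne'
    field_simp
    ring
  rw [abs_le]
  have r0 : ∀ r ∈ Ioo s t, 0 < r := fun r hr => s0.trans hr.1
  constructor
  · have := mono_of_hd (f := fun r => Q r - (1 - K) * log r)
      (f' := fun r => ((η - lam) + fV lam η U r ^ (1 + 2 / (lam + η)) /
      ((lam + η) * fV lam η U r - fP lam η U W r) -
      (lam + 1) / lam * (fP lam η U W r / fV lam η U r)) / r - (1 - K) * r⁻¹) hst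
      (hcQ.sub (continuousOn_const.mul hcl))
      (fun r hr => (hdQ r (Ioo_subset_Icc_self hr)).sub ((hasDerivAt_log (r0 r hr).ne').const_mul _)) ?_
    · linarith
    · intro r hr
      have h1 := (abs_le.1 (hD r (Ioo_subset_Icc_self hr))).1
      rw [← div_eq_mul_inv, ← sub_div]
      exact div_nonneg (by linarith) (r0 r hr).le
  · have := anti_of_hd (f := fun r => Q r - (1 + K) * log r)
      (f' := fun r => ((η - lam) + fV lam η U r ^ (1 + 2 / (lam + η)) /
      ((lam + η) * fV lam η U r - fP lam η U W r) -
      (lam + 1) / lam * (fP lam η U W r / fV lam η U r)) / r - (1 + K) * r⁻¹) hst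
      (hcQ.sub (continuousOn_const.mul hcl))
      (fun r hr => (hdQ r (Ioo_subset_Icc_self hr)).sub ((hasDerivAt_log (r0 r hr).ne').const_mul _)) ?_
    · linarith
    · intro r hr
      have h1 := (abs_le.1 (hD r (Ioo_subset_Icc_self hr))).2
      rw [← div_eq_mul_inv, ← sub_div]
      exact div_nonpos_of_nonpos_of_nonneg (by linarith) (r0 r hr).le

end Arc

namespace Arc
variable {lam η x y d : ℝ} {U W : ℝ → ℝ}

theorem gq_of_nonneg (lam η : ℝ) {P V : ℝ} (hP : 0 ≤ P) : gq lam η (en lam η P V) V = P := by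
  unfold gq
  rw [← en_P, sqrt_sq hP]

theorem gq_of_nonpos (lam η : ℝ) {P V : ℝ} (hP : P ≤ 0) : gq lam η (en lam η P V) V = -P := by
  unfold gq
  rw [← en_P, sqrt_sq_eq_abs, abs_of_nonpos hP]

/-- connection through a bump -/
theorem bump_conn (h : Arc lam η x y U W) (hVx : fV lam η U x = 0) (hVy : fV lam η U y = 0)
    (hηl : η ≤ lam / 2) {θ C c0 : ℝ} (hθ : ThSmall lam θ) (hC : 0 < C)
    (hmid : ∀ η P V, 0 < η → η < lam → 0 ≤ en lam η P V →
      en lam η P V ≤ c0 → θ ≤ V → 0 < (lam + η) * V - P ∧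
      |(η - lam) + V ^ (1 + 2 / (lam + η)) / ((lam + η) * V - P) - (lam + 1) / lam * (P / V) - 1| ≤
        C * (η + en lam η P V))
    (hEy : fE lam η U W y ≤ c0) (hd : d ∈ Icc x y) (hW : W d = 0) (hU : 0 < U d)
    (hVd : fV lam η U d < θ) :
    ∃ E1 E2 τ e : ℝ, (0 ≤ E1 ∧ E1 ≤ fE lam η U W y) ∧ (0 ≤ E2 ∧ E2 ≤ fE lam η U W y) ∧
      0 ≤ τ ∧ (0 ≤ e ∧ e ≤ 6 / lam * θ ^ (1 / lam)) ∧
      |log ((lam + η) * θ + gq lam η E2 θ) - log ((lam + η) * θ - gq lam η E1 θ) - τ| ≤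
        C * (η + fE lam η U W y) * τ ∧
      fG lam W y + (lam - η) / (lam + η) * log (U d) =
        log ((lam + η) * θ + gq lam η E2 θ) + (lam - η) * τ +
        (lam - η) / (lam + η) * (log (gq lam η E1 θ + (lam - η) * θ) - log (2 * lam)) + e := by
  obtain ⟨hθ0, hθ1, hθ2⟩ := hθ
  have hlam := h.hlam
  have hη := h.hη
  have hηlt := h.hηl
  have ha := h.ha
  have hE0 : ∀ r ∈ Icc x y, 0 ≤ fE lam η U W r := fun r hr =>
    (E_nonneg_left hVx h).trans (h.E_mono (left_mem_Icc.2 h.hxy.le) hr hr.1)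
  have hE1 : ∀ r ∈ Icc x y, fE lam η U W r ≤ fE lam η U W y := fun r hr =>
    h.E_mono hr (right_mem_Icc.2 h.hxy.le) hr.2
  obtain ⟨b, hb, hPb, hPl, hPr, hmax⟩ := h.exists_peak hVx hVy
  have hbI := Ioo_subset_Icc_self hb
  have hVb : θ < fV lam η U b := by
    by_contra hcon
    have := small_P hlam hη hηl ⟨hθ0, hθ1, hθ2⟩ (h.V_nonneg hbI) (not_lt.1 hcon) (hE0 b hbI)
    rw [hPb, abs_zero] at this
    have h2 := mul_pos (half_pos hlam) (h.V_pos hb)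
    linarith
  have hdb : d ≤ b := by
    by_contra hcon
    push Not at hcon
    have h1 := hPr d ⟨hcon.le, hd.2⟩
    rw [P_crit hW] at h1
    have h2 : 0 < fV lam η U d := mul_pos (rpow_pos_of_pos ((h.rpos hb).trans hcon) _) hU
    have := mul_pos ha h2
    linarith
  obtain ⟨r1, hr1, hV1⟩ := intermediate_value_Icc hdb
    (h.cV.mono (Icc_subset_Icc hd.1 hbI.2)) ⟨hVd.le, hVb.le⟩
  obtain ⟨r2, hr2, hV2⟩ := intermediate_value_Icc' hbI.2
    (h.cV.mono (Icc_subset_Icc hbI.1 le_rfl)) ⟨by rw [hVy]; exact hθ0.le, hVb.le⟩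
  have hr1d : d < r1 := lt_of_le_of_ne hr1.1 (by rintro rfl; linarith)
  have hr2y : r2 < y := lt_of_le_of_ne hr2.2 (by rintro rfl; linarith)
  have h1I : r1 ∈ Ioo x y := ⟨hd.1.trans_lt hr1d, hr1.2.trans_lt hb.2⟩
  have h2I : r2 ∈ Ioo x y := ⟨hb.1.trans_le hr2.1, hr2y⟩
  have h1J := Ioo_subset_Icc_self h1I
  have h2J := Ioo_subset_Icc_self h2I
  have hr12 : r1 ≤ r2 := hr1.2.trans hr2.1
  have r1p := h.rpos h1I
  have r2p := h.rpos h2I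
  have hP1 := hPl r1 ⟨h1J.1, hr1.2⟩
  have hP2 := hPr r2 ⟨hr2.1, hr2.2⟩
  have hg1 : gq lam η (fE lam η U W r1) θ = fP lam η U W r1 := by
    unfold fE; rw [hV1]; exact gq_of_nonneg lam η hP1
  have hg2 : gq lam η (fE lam η U W r2) θ = -fP lam η U W r2 := by
    unfold fE; rw [hV2]; exact gq_of_nonpos lam η hP2
  -- V on the three pieces
  have hVleft : ∀ r ∈ Icc d r1, fV lam η U r ≤ θ := by
    intro r hr
    rw [← hV1]
    exact h.V_mono_of ⟨hd.1.trans hr.1, hr.2.trans h1J.2⟩ h1J hr.2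
      (fun s hs => hPl s ⟨(hd.1.trans hr.1).trans hs.1.le, hs.2.le.trans hr1.2⟩)
  have hVright : ∀ r ∈ Icc r2 y, fV lam η U r ≤ θ := by
    intro r hr
    rw [← hV2]
    exact h.V_anti_of h2J ⟨h2J.1.trans hr.1, hr.2⟩ hr.1
      (fun s hs => hPr s ⟨hr2.1.trans hs.1.le, hs.2.le.trans hr.2⟩)
  have hVmid : ∀ r ∈ Icc r1 r2, θ ≤ fV lam η U r := by
    intro r hr
    have hrI : r ∈ Icc x y := ⟨h1J.1.trans hr.1, hr.2.trans h2J.2⟩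
    rcases le_total r b with hrb | hrb
    · rw [← hV1]
      exact h.V_mono_of h1J hrI hr.1 (fun s hs => hPl s ⟨h1J.1.trans hs.1.le, hs.2.le.trans hrb⟩)
    · rw [← hV2]
      exact h.V_anti_of hrI h2J hr.2 (fun s hs => hPr s ⟨hrb.trans hs.1.le, hs.2.le.trans h2J.2⟩)
  -- left piece
  have hZ1 := h.N_eq (r := r1)
  rw [hV1] at hZ1
  have hZpos : 0 < fP lam η U W r1 + (lam - η) * θ := by
    have := mul_pos (sub_pos.2 hηlt) hθ0
    linarith
  have hNpos : 0 < fN lam U W r1 := by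
    rw [← hZ1] at hZpos
    exact (pos_iff_pos_of_mul_pos hZpos).1 (rpow_pos_of_pos r1p _)
  have hN := h.N_lemma (E_nonneg_left hVx h) hηl ⟨hθ0, hθ1, hθ2⟩ hd h1J hr1.1
    (fun r hr => hPl r ⟨hd.1.trans hr.1.le, hr.2.le.trans hr1.2⟩)
    (fun r hr => hVleft r (Ioo_subset_Icc_self hr)) hV1.le hNpos
  have hNd : fN lam U W d = 2 * lam * U d := by unfold fN; rw [hW]; ring
  have hlogN : log (fN lam U W r1) = log (fP lam η U W r1 + (lam - η) * θ) - (lam + η) * log r1 := by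
    rw [← hZ1, log_mul (rpow_pos_of_pos r1p _).ne' hNpos.ne', log_rpow r1p]; ring
  have hlogd : log (fN lam U W d) = log (2 * lam) + log (U d) := by
    rw [hNd, log_mul (by positivity) hU.ne']
  have hpw1 := pow_small hlam hη hηl hθ0.le le_rfl hθ1
  rw [hV1] at hN
  have hN1 := log_le_log hNpos hN.1
  have hN2 := hN.2
  -- right piece
  obtain ⟨-, hJ1, hJ2⟩ := h.J_lemma (E_nonneg_left hVx h) hηl ⟨hθ0, hθ1, hθ2⟩ h2I
    (fun r hr => hPr r ⟨hr2.1.trans hr.1, hr.2.le⟩)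
    (fun r hr => hVright r (Ico_subset_Icc_self hr))
  rw [hV2] at hJ2
  have hY := h.Y_eq r2p
  rw [hV2] at hY
  have hWpos : 0 < -W r2 := by
    have h3 : 0 < r2 ^ (lam + η + 1) * (-W r2) := by
      have := mul_pos ha hθ0
      nlinarith
    exact (pos_iff_pos_of_mul_pos h3).1 (rpow_pos_of_pos r2p _)
  have hlogY : fG lam W r2 = log ((lam + η) * θ - fP lam η U W r2) + (lam - η) * log r2 := by
    have : (lam + η) * θ - fP lam η U W r2 = r2 ^ (lam + η + 1) * (-W r2) := by linarith
    rw [this, log_mul (rpow_pos_of_pos r2p _).ne' hWpos.ne', log_rpow r2p]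
    unfold fG; ring
  -- middle piece
  have hτ : 0 ≤ log r2 - log r1 := sub_nonneg.2 (log_le_log r1p hr12)
  have hmid' : ∀ r ∈ Icc r1 r2, _ := fun r hr =>
    hmid η (fP lam η U W r) (fV lam η U r) hη hηlt
      (hE0 r ⟨h1J.1.trans hr.1, hr.2.trans h2J.2⟩)
      ((hE1 r ⟨h1J.1.trans hr.1, hr.2.trans h2J.2⟩).trans hEy) (hVmid r hr)
  have hM := h.mid_time (K := C * (η + fE lam η U W y)) h1I h2I hr12 (fun r hr => (hmid' r hr).1)
    (fun r hr => (hmid' r hr).2.trans (by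
      have := hE1 r ⟨h1J.1.trans hr.1, hr.2.trans h2J.2⟩
      unfold fE at this ⊢
      gcongr))
  rw [hV1, hV2] at hM
  have hμ0 : 0 ≤ (lam - η) / (lam + η) := div_nonneg (sub_pos.2 hηlt).le ha.le
  have hμ1 : (lam - η) / (lam + η) ≤ 1 := by rw [div_le_one ha]; linarith
  set e1 := log (fN lam U W d) - log (fN lam U W r1) with he1
  set e2 := fG lam W y - fG lam W r2 with he2
  have he10 : 0 ≤ e1 := by linarith
  have he11 : e1 ≤ 4 / lam * θ ^ (1 / lam) := by
    have : 4 / lam * θ ^ (2 / (lam + η)) ≤ 4 / lam * θ ^ (1 / lam) := by gcongr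
    linarith
  have he20 : 0 ≤ e2 := by linarith
  have he21 : e2 ≤ 2 / lam * θ ^ (1 / lam) := by
    have : 2 / lam * θ ^ (2 / (lam + η)) ≤ 2 / lam * θ ^ (1 / lam) := by gcongr
    linarith
  refine ⟨fE lam η U W r1, fE lam η U W r2, log r2 - log r1, e2 + (lam - η) / (lam + η) * e1,
    ⟨hE0 _ h1J, hE1 _ h1J⟩, ⟨hE0 _ h2J, hE1 _ h2J⟩, hτ, ⟨by positivity, ?_⟩, ?_, ?_⟩
  · have h3 : (lam - η) / (lam + η) * e1 ≤ 1 * e1 := by gcongr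
    have h4 : 6 / lam * θ ^ (1 / lam) = 2 / lam * θ ^ (1 / lam) + 4 / lam * θ ^ (1 / lam) := by ring
    linarith
  · rw [hg1, hg2, ← sub_eq_add_neg]
    convert hM using 2
    ring
  · rw [hg1, hg2, ← sub_eq_add_neg]
    have h5 : log (U d) = log (fP lam η U W r1 + (lam - η) * θ) - (lam + η) * log r1 + e1
        - log (2 * lam) := by
      rw [he1, hlogd, hlogN]; ring
    have h6 : fG lam W y = log ((lam + η) * θ - fP lam η U W r2) + (lam - η) * log r2 + e2 := by
      rw [← hlogY, he2]; ring
    rw [h5, h6]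
    field_simp
    ring

end Arc

theorem tendsto_of_approx {ι : Type*} {l : Filter ι} {X : ι → ℝ} {Ψ B : ℝ → ℝ} {L : ℝ}
    (hΨ : Tendsto Ψ (𝓝[>] 0) (𝓝 L)) (hB : Tendsto B (𝓝[>] 0) (𝓝 0))
    (H : ∀ᶠ θ in 𝓝[>] (0 : ℝ), ∃ M : ι → ℝ, Tendsto M l (𝓝 (Ψ θ)) ∧ ∀ᶠ i in l, |X i - M i| ≤ B θ) :
    Tendsto X l (𝓝 L) := by
  rw [Metric.tendsto_nhds]
  intro e he
  have h1 := (Metric.tendsto_nhds.1 hΨ) (e / 3) (by positivity)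
  have h2 := hB.eventually (gt_mem_nhds (show 0 < e / 3 by positivity))
  obtain ⟨θ, h1, h2, M, hM, h3⟩ := (h1.and (h2.and H)).exists
  filter_upwards [h3, (Metric.tendsto_nhds.1 hM) (e / 3) (by positivity)] with i a b
  rw [Real.dist_eq] at *
  have : X i - L = (X i - M i) + (M i - Ψ θ) + (Ψ θ - L) := by ring
  rw [this]
  have := abs_add_three (X i - M i) (M i - Ψ θ) (Ψ θ - L)
  linarith

theorem tau_tendsto {ι : Type*} {l : Filter ι} {A τ κ : ι → ℝ} {a : ℝ} (hA : Tendsto A l (𝓝 a))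
    (hκ : Tendsto κ l (𝓝 0)) (hτ : ∀ᶠ i in l, 0 ≤ τ i) (h : ∀ᶠ i in l, |A i - τ i| ≤ κ i * τ i) :
    Tendsto τ l (𝓝 a) := by
  have h1 : Tendsto (fun i => A i - τ i) l (𝓝 0) := by
    refine squeeze_zero_norm' (a := fun i => |κ i| * (2 * |A i|)) ?_ ?_
    · filter_upwards [hτ, h, hκ.eventually (gt_mem_nhds (show (0 : ℝ) < 1 / 2 by norm_num))]
        with i h1 h2 h3
      rw [norm_eq_abs]
      have h4 : κ i * τ i ≤ 1 / 2 * τ i := by gcongr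
      have h5 : τ i ≤ 2 * |A i| := by
        have := (abs_le.1 h2).1
        have := le_abs_self (A i)
        linarith
      calc |A i - τ i| ≤ κ i * τ i := h2
        _ ≤ |κ i| * τ i := by gcongr; exact le_abs_self _
        _ ≤ _ := by gcongr
    · have := hκ.abs.mul (hA.abs.const_mul 2)
      simpa using this
  have := hA.sub h1
  simpa using this

/-- the limiting profile value -/
def Psi (lam θ : ℝ) : ℝ := log (lam * θ + gq lam 0 0 θ) +
  lam * (log (lam * θ + gq lam 0 0 θ) - log (lam * θ - gq lam 0 0 θ)) +
  (log (gq lam 0 0 θ + lam * θ) - log (2 * lam))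

theorem gq_lt {lam θ : ℝ} (hlam : 0 < lam) (hθ : 0 < θ) : gq lam 0 0 θ < lam * θ := by
  unfold gq
  rw [sqrt_lt' (by positivity)]
  have : 0 < 2 * θ ^ (2 + 2 / (lam + 0)) / (2 + 2 / (lam + 0)) := by
    rw [add_zero]; positivity
  nlinarith

theorem Psi_tendsto {lam : ℝ} (hlam : 0 < lam) :
    Tendsto (Psi lam) (𝓝[>] 0) (𝓝 (log (2 * lam) + lam * log (4 * lam * (lam + 1)))) := by
  have hpw : Tendsto (fun θ : ℝ => θ ^ (2 / lam)) (𝓝[>] 0) (𝓝 0) := by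
    have := (continuous_id.rpow_const (p := 2 / lam) (fun _ => Or.inr (by positivity))).tendsto (0 : ℝ)
    simp only [id] at this
    rw [zero_rpow (by positivity)] at this
    exact this.mono_left nhdsWithin_le_nhds
  have hs : Tendsto (fun θ : ℝ => √(1 - θ ^ (2 / lam) / (lam * (lam + 1)))) (𝓝[>] 0) (𝓝 1) := by
    have := (tendsto_const_nhds.sub (hpw.div_const (lam * (lam + 1))) :
      Tendsto (fun θ : ℝ => (1 : ℝ) - θ ^ (2 / lam) / (lam * (lam + 1))) _ _).sqrt
    simpa using this
  have hlim : Tendsto (fun θ : ℝ => 2 * log lam - log (2 * lam) +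
      (2 + 2 * lam) * log (1 + √(1 - θ ^ (2 / lam) / (lam * (lam + 1)))) +
      lam * log (lam * (lam + 1))) (𝓝[>] 0)
      (𝓝 (2 * log lam - log (2 * lam) + (2 + 2 * lam) * log (1 + 1) + lam * log (lam * (lam + 1)))) := by
    refine (tendsto_const_nhds.add ?_).add tendsto_const_nhds
    exact ((tendsto_const_nhds.add hs).log (by norm_num)).const_mul _
  have hval : 2 * log lam - log (2 * lam) + (2 + 2 * lam) * log (1 + 1) + lam * log (lam * (lam + 1))
      = log (2 * lam) + lam * log (4 * lam * (lam + 1)) := by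
    have h4 : log 4 = 2 * log 2 := by
      rw [show (4 : ℝ) = 2 ^ 2 by norm_num, log_pow]; norm_num
    rw [mul_assoc 4, log_mul (by norm_num : (4 : ℝ) ≠ 0) (by positivity),
      log_mul (by norm_num : (2 : ℝ) ≠ 0) hlam.ne', h4]
    norm_num
    ring
  rw [← hval]
  refine hlim.congr' ?_
  filter_upwards [self_mem_nhdsWithin, hpw.eventually (gt_mem_nhds (show 0 < lam * (lam + 1) by positivity))]
    with θ (hθ : 0 < θ) hsm
  set X := θ ^ (2 / lam) with hX
  have hXp : 0 < X := rpow_pos_of_pos hθ _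
  have h0 : 0 < 1 - X / (lam * (lam + 1)) := by
    rw [sub_pos, div_lt_one (by positivity)]; exact hsm
  have hg : gq lam 0 0 θ = lam * θ * √(1 - X / (lam * (lam + 1))) := by
    rw [gq_zero_eq hlam hθ, ← mul_pow, sqrt_mul (by positivity), sqrt_sq (by positivity)]
  have hlt := gq_lt hlam hθ
  set s := √(1 - X / (lam * (lam + 1))) with hsdef
  have hs0 : 0 ≤ s := sqrt_nonneg _
  have hsq : s ^ 2 = 1 - X / (lam * (lam + 1)) := sq_sqrt h0.le
  have hs1 : s < 1 := by
    rw [hg] at hlt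
    have : 0 < lam * θ := by positivity
    nlinarith
  have h1 : 1 - s = X / (lam * (lam + 1)) / (1 + s) := by
    rw [eq_div_iff (by positivity)]; linarith
  have h2 : log (1 - s) = 2 / lam * log θ - log (lam * (lam + 1)) - log (1 + s) := by
    rw [h1, log_div (by positivity) (by positivity), log_div (by positivity) (by positivity), hX,
      log_rpow hθ]
  unfold Psi
  rw [hg, show lam * θ + lam * θ * s = lam * θ * (1 + s) by ring,
    show lam * θ - lam * θ * s = lam * θ * (1 - s) by ring,
    show lam * θ * s + lam * θ = lam * θ * (1 + s) by ring,
    log_mul (x := lam * θ) (y := 1 + s) (by positivity) (by positivity),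
    log_mul (x := lam * θ) (y := 1 - s) (by positivity) (by linarith), h2, log_mul hlam.ne' hθ.ne']
  field_simp
  ring

/-- connection across a bump, in the limit -/
theorem bump_conn_tendsto {ι : Type*} {l : Filter ι} [l.NeBot] {lam : ℝ} (hlam : 0 < lam)
    {η x y d : ι → ℝ} {U W : ι → ℝ → ℝ} (hη : Tendsto η l (𝓝 0))
    (hA : ∀ᶠ i in l, Arc lam (η i) (x i) (y i) (U i) (W i))
    (hVx : ∀ᶠ i in l, fV lam (η i) (U i) (x i) = 0)
    (hVy : ∀ᶠ i in l, fV lam (η i) (U i) (y i) = 0)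
    (hd : ∀ᶠ i in l, d i ∈ Icc (x i) (y i) ∧ W i (d i) = 0 ∧ 0 < U i (d i))
    (hE : Tendsto (fun i => fE lam (η i) (U i) (W i) (x i)) l (𝓝 0)) :
    Tendsto (fun i => Arc.fG lam (W i) (y i) + (lam - η i) / (lam + η i) * log (U i (d i))) l
      (𝓝 (log (2 * lam) + lam * log (4 * lam * (lam + 1)))) := by
  have hEy := bump_E_tendsto_zero hη hA hVx hVy hE
  obtain ⟨-, hVd⟩ := crit_tendsto hlam hη hA hVx hd hE
  have hB : Tendsto (fun θ : ℝ => 6 / lam * θ ^ (1 / lam)) (𝓝[>] 0) (𝓝 0) := by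
    have := ((continuous_id.rpow_const (p := 1 / lam)
      (fun _ => Or.inr (by positivity))).const_mul (6 / lam)).tendsto (0 : ℝ)
    simp only [id] at this
    rw [zero_rpow (by positivity), mul_zero] at this
    exact this.mono_left nhdsWithin_le_nhds
  refine tendsto_of_approx (Psi_tendsto hlam) hB ?_
  filter_upwards [exists_small hlam] with θ hθ
  have hθ0 := hθ.1
  obtain ⟨C, hC, c0, hc0, hmid⟩ := mid_est hlam hθ.1 hθ.2.1
  have hex : ∀ᶠ i in l, ∃ q : ℝ × ℝ × ℝ × ℝ,
      (0 ≤ q.1 ∧ q.1 ≤ fE lam (η i) (U i) (W i) (y i)) ∧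
      (0 ≤ q.2.1 ∧ q.2.1 ≤ fE lam (η i) (U i) (W i) (y i)) ∧
      0 ≤ q.2.2.1 ∧ (0 ≤ q.2.2.2 ∧ q.2.2.2 ≤ 6 / lam * θ ^ (1 / lam)) ∧
      |log ((lam + η i) * θ + gq lam (η i) q.2.1 θ) - log ((lam + η i) * θ - gq lam (η i) q.1 θ)
        - q.2.2.1| ≤ C * (η i + fE lam (η i) (U i) (W i) (y i)) * q.2.2.1 ∧
      Arc.fG lam (W i) (y i) + (lam - η i) / (lam + η i) * log (U i (d i)) =
        log ((lam + η i) * θ + gq lam (η i) q.2.1 θ) + (lam - η i) * q.2.2.1 +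
        (lam - η i) / (lam + η i) * (log (gq lam (η i) q.1 θ + (lam - η i) * θ) - log (2 * lam))
        + q.2.2.2 := by
    filter_upwards [hA, hVx, hVy, hd, hη.eventually (gt_mem_nhds (half_pos hlam)),
      hEy.eventually (gt_mem_nhds hc0), hVd.eventually (gt_mem_nhds hθ.1)] with i hA hVx hVy hd h1 h2 h3
    obtain ⟨E1, E2, τ, e, h⟩ := hA.bump_conn hVx hVy h1.le hθ hC hmid h2.le hd.1 hd.2.1 hd.2.2 h3
    exact ⟨(E1, E2, τ, e), h⟩
  obtain ⟨f, hf⟩ := hex.choice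
  have hE1 : Tendsto (fun i => (f i).1) l (𝓝 0) :=
    tendsto_of_tendsto_of_tendsto_of_le_of_le' tendsto_const_nhds hEy
      (hf.mono fun i h => h.1.1) (hf.mono fun i h => h.1.2)
  have hE2 : Tendsto (fun i => (f i).2.1) l (𝓝 0) :=
    tendsto_of_tendsto_of_tendsto_of_le_of_le' tendsto_const_nhds hEy
      (hf.mono fun i h => h.2.1.1) (hf.mono fun i h => h.2.1.2)
  have hg1 := gq_tendsto hlam hη hE1 hθ.1
  have hg2 := gq_tendsto hlam hη hE2 hθ.1
  have hap : Tendsto (fun i => lam + η i) l (𝓝 lam) := by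
    simpa using tendsto_const_nhds.add hη
  have ham : Tendsto (fun i => lam - η i) l (𝓝 lam) := by
    simpa using tendsto_const_nhds.sub hη
  have hμ : Tendsto (fun i => (lam - η i) / (lam + η i)) l (𝓝 1) := by
    have := ham.div hap hlam.ne'
    rw [div_self hlam.ne'] at this
    exact this
  have hπ := gq_nonneg lam 0 0 θ
  have hlt := gq_lt hlam hθ.1
  have hl2 := ((hap.mul_const θ).add hg2).log (by positivity)
  have hl1 := ((hap.mul_const θ).sub hg1).log (by linarith)
  have hl3 := (hg1.add (ham.mul_const θ)).log (by positivity)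
  have hκ : Tendsto (fun i => C * (η i + fE lam (η i) (U i) (W i) (y i))) l (𝓝 0) := by
    simpa using (hη.add hEy).const_mul C
  have hτ := tau_tendsto (hl2.sub hl1) hκ (hf.mono fun i h => h.2.2.1) (hf.mono fun i h => h.2.2.2.2.1)
  refine ⟨fun i => log ((lam + η i) * θ + gq lam (η i) (f i).2.1 θ) + (lam - η i) * (f i).2.2.1 +
        (lam - η i) / (lam + η i) * (log (gq lam (η i) (f i).1 θ + (lam - η i) * θ) - log (2 * lam)),
    ?_, ?_⟩
  · have := (hl2.add (ham.mul hτ)).add (hμ.mul (hl3.sub_const (log (2 * lam))))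
    rw [one_mul] at this
    exact this
  · filter_upwards [hf] with i h
    rw [h.2.2.2.2.2, add_sub_cancel_left, abs_of_nonneg h.2.2.2.1.1]
    exact h.2.2.2.1.2

/-- the exponent perturbation -/
def etaf (lam ε : ℝ) : ℝ := lam / (1 - lam * ε / 2) - lam

/-- zeros, completed by the end points -/
def rr (m : ℕ) (ρ : ℕ → ℝ) (k : ℕ) : ℝ := if k = 0 then 1 else if k = m then 0 else ρ k

theorem radial_w {n : ℕ} (hn : 3 ≤ n) {p : ℝ} (hp : 1 ≤ p) {u : ℝ → ℝ} (h : IsRadialSolution n p u)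
    (hd1 : deriv u 1 = 0) (hu1 : u 1 ≠ 0) :
    ∃ w : ℝ → ℝ, ContinuousOn w (Icc 0 1) ∧ w 0 = 0 ∧ w 1 = 0 ∧
      (∀ r ∈ Ioo (0 : ℝ) 1, HasDerivAt u (w r) r) ∧
      (∀ r ∈ Ioo (0 : ℝ) 1, HasDerivAt w (-(((n : ℝ) - 1) / r * w r) - |u r| ^ (p - 1) * u r) r) := by
  obtain ⟨hC, -, hode⟩ := h
  have hC' : ContDiffOn ℝ (1 + 1) u (Icc 0 1) := by
    rw [one_add_one_eq_two]; exact hC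
  have hw1 : ContDiffOn ℝ 1 (derivWithin u (Icc 0 1)) (Icc 0 1) :=
    ((contDiffOn_succ_iff_derivWithin (uniqueDiffOn_Icc one_pos)).1 hC').2.2
  set w := derivWithin u (Icc 0 1) with hw
  have hcw : ContinuousOn w (Icc 0 1) := hw1.continuousOn
  have hcu : ContinuousOn u (Icc 0 1) := hC.continuousOn
  have hnb : ∀ r ∈ Ioo (0 : ℝ) 1, Icc (0 : ℝ) 1 ∈ 𝓝 r := fun r hr => Icc_mem_nhds hr.1 hr.2
  have hwd : ∀ r ∈ Ioo (0 : ℝ) 1, deriv u r = w r := fun r hr =>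
    (derivWithin_of_mem_nhds (hnb r hr)).symm
  have hdu : ∀ r ∈ Ioo (0 : ℝ) 1, HasDerivAt u (w r) r := by
    intro r hr
    rw [← hwd r hr]
    exact (((hC.differentiableOn (by norm_num)) r (Ioo_subset_Icc_self hr)).differentiableAt
      (hnb r hr)).hasDerivAt
  have hdw0 : ∀ r ∈ Ioo (0 : ℝ) 1, HasDerivAt w (derivWithin w (Icc 0 1) r) r := by
    intro r hr
    exact ((hw1.differentiableOn one_ne_zero r (Ioo_subset_Icc_self hr)).hasDerivWithinAt).hasDerivAt
      (hnb r hr)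
  have hdw' : ∀ r ∈ Ioo (0 : ℝ) 1, derivWithin w (Icc 0 1) r =
      -(((n : ℝ) - 1) / r * w r) - |u r| ^ (p - 1) * u r := by
    intro r hr
    have h1 := hode r ⟨hr.1, hr.2.le⟩
    have h2 : (fun s => s ^ (n - 1) * deriv u s) =ᶠ[𝓝 r] fun s => s ^ (n - 1) * w s := by
      filter_upwards [Ioo_mem_nhds hr.1 hr.2] with s hs
      rw [hwd s hs]
    rw [h2.deriv_eq] at h1
    have h3 := ((hasDerivAt_pow (n - 1) r).mul (hdw0 r hr)).deriv
    have h4 : (fun s => s ^ (n - 1) * w s) = (fun s => s ^ (n - 1)) * w := rfl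
    rw [h4, h3] at h1
    obtain ⟨N, rfl⟩ : ∃ N, n = N + 2 := ⟨n - 2, by omega⟩
    have e1 : N + 2 - 1 = N + 1 := rfl
    have e2 : N + 1 - 1 = N := rfl
    rw [e1, e2, pow_succ] at h1
    have hr0 := hr.1
    have hpow : (0 : ℝ) < r ^ N := pow_pos hr0 N
    push_cast at h1 ⊢
    have h5 : r ^ N * (((N : ℝ) + 1) * w r + r * derivWithin w (Icc 0 1) r
        + r * (|u r| ^ (p - 1) * u r)) = 0 := by linarith
    have h6 := (mul_eq_zero.1 h5).resolve_left hpow.ne'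
    field_simp
    linarith
  have hdw : ∀ r ∈ Ioo (0 : ℝ) 1, HasDerivAt w
      (-(((n : ℝ) - 1) / r * w r) - |u r| ^ (p - 1) * u r) r := fun r hr => hdw' r hr ▸ hdw0 r hr
  refine ⟨w, hcw, ?_, ?_, hdu, hdw⟩
  · -- at the origin
    have hsub : Ioo (0 : ℝ) 1 ⊆ Icc 0 1 := Ioo_subset_Icc_self
    have hne : (𝓝[Ioo (0 : ℝ) 1] 0).NeBot := by
      rw [nhdsWithin_Ioo_eq_nhdsGT one_pos]; infer_instance
    have t0 : (0 : ℝ) ∈ Icc (0 : ℝ) 1 := ⟨le_rfl, zero_le_one⟩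
    have t1 : Tendsto w (𝓝[Ioo (0 : ℝ) 1] 0) (𝓝 (w 0)) := (hcw 0 t0).mono hsub
    have t2 : Tendsto u (𝓝[Ioo (0 : ℝ) 1] 0) (𝓝 (u 0)) := (hcu 0 t0).mono hsub
    have t3 : Tendsto (derivWithin w (Icc 0 1)) (𝓝[Ioo (0 : ℝ) 1] 0) (𝓝 (derivWithin w (Icc 0 1) 0)) :=
      ((hw1.continuousOn_derivWithin (uniqueDiffOn_Icc one_pos) le_rfl) 0 t0).mono hsub
    have t4 : Tendsto (fun r : ℝ => r) (𝓝[Ioo (0 : ℝ) 1] 0) (𝓝 0) :=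
      (continuous_id.tendsto 0).mono_left nhdsWithin_le_nhds
    have t5 := t4.mul (t3.add ((t2.abs.rpow_const (p := p - 1) (Or.inr (by linarith))).mul t2))
    have t6 : Tendsto (fun r => -(((n : ℝ) - 1) * w r)) (𝓝[Ioo (0 : ℝ) 1] 0) (𝓝 _) :=
      (t1.const_mul ((n : ℝ) - 1)).neg
    have t7 : (fun r => r * (derivWithin w (Icc 0 1) r + |u r| ^ (p - 1) * u r))
        =ᶠ[𝓝[Ioo (0 : ℝ) 1] 0] (fun r => -(((n : ℝ) - 1) * w r)) := by
      filter_upwards [self_mem_nhdsWithin] with r hr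
      rw [hdw' r hr]
      have := hr.1.ne'
      field_simp
      ring
    have t8 := tendsto_nhds_unique (t5.congr' t7) t6
    have h3 : (3 : ℝ) ≤ n := by exact_mod_cast hn
    have h4 : ((n : ℝ) - 1) * w 0 = 0 := by linarith
    exact (mul_eq_zero.1 h4).resolve_left (by linarith)
  · -- at the boundary
    have h1 := hode 1 ⟨one_pos, le_rfl⟩
    have h2 : DifferentiableAt ℝ (fun s => s ^ (n - 1) * deriv u s) 1 := by
      apply differentiableAt_of_deriv_ne_zero
      rw [h1]
      have := rpow_pos_of_pos (abs_pos.2 hu1) (p - 1)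
      simp [this.ne', hu1]
    have hsub : Ioo (0 : ℝ) 1 ⊆ Icc 0 1 := Ioo_subset_Icc_self
    have hne : (𝓝[Ioo (0 : ℝ) 1] 1).NeBot := by
      rw [nhdsWithin_Ioo_eq_nhdsLT one_pos]; infer_instance
    have t1 : Tendsto w (𝓝[Ioo (0 : ℝ) 1] 1) (𝓝 (w 1)) :=
      (hcw 1 ⟨zero_le_one, le_rfl⟩).mono hsub
    have t2 : Tendsto (fun s => s ^ (n - 1) * deriv u s) (𝓝[Ioo (0 : ℝ) 1] 1) (𝓝 (1 ^ (n - 1) * deriv u 1)) :=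
      h2.continuousAt.tendsto.mono_left nhdsWithin_le_nhds
    have t3 : Tendsto (fun s : ℝ => s ^ (n - 1) * w s) (𝓝[Ioo (0 : ℝ) 1] 1) (𝓝 (1 ^ (n - 1) * w 1)) :=
      (((continuous_pow (n - 1)).tendsto 1).mono_left nhdsWithin_le_nhds).mul t1
    have t4 : (fun s => s ^ (n - 1) * deriv u s) =ᶠ[𝓝[Ioo (0 : ℝ) 1] 1] (fun s => s ^ (n - 1) * w s) := by
      filter_upwards [self_mem_nhdsWithin] with r hr
      rw [hwd r hr]
    have := tendsto_nhds_unique (t2.congr' t4) t3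
    rw [hd1] at this
    simpa using this.symm

theorem sign_of_ne {u : ℝ → ℝ} {x y : ℝ} (hxy : x < y) (hc : ContinuousOn u (Icc x y))
    (h0 : ∀ r ∈ Ioo x y, u r ≠ 0) : ∃ s : ℝ, (s = 1 ∨ s = -1) ∧ ∀ r ∈ Ioo x y, 0 < s * u r := by
  have hc' := hc.mono Ioo_subset_Icc_self
  have hmid : (x + y) / 2 ∈ Ioo x y := by constructor <;> linarith
  have key : ∀ r ∈ Ioo x y, ∀ t ∈ Ioo x y, u r < 0 → 0 < u t → False := by
    intro r hr t ht h1 h2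
    obtain ⟨z, hz, hz0⟩ := isPreconnected_Ioo.intermediate_value hr ht hc' ⟨h1.le, h2.le⟩
    exact h0 z hz hz0
  rcases lt_or_gt_of_ne (h0 _ hmid) with h | h
  · refine ⟨-1, Or.inr rfl, fun r hr => ?_⟩
    rcases lt_or_gt_of_ne (h0 r hr) with h1 | h1
    · linarith
    · exact (key _ hmid r hr h h1).elim
  · refine ⟨1, Or.inl rfl, fun r hr => ?_⟩
    rcases lt_or_gt_of_ne (h0 r hr) with h1 | h1
    · exact (key r hr _ hmid h1 h).elim
    · linarith

/-- on an arc starting at the origin the function is decreasing -/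
theorem Arc.pos_zero {lam η y : ℝ} {U W : ℝ → ℝ} (h : Arc lam η 0 y U W) : 0 < U 0 := by
  have hlam := h.hlam
  have hI : ∀ t ∈ Ioo 0 y, ∀ r ∈ Ioo 0 t, r ∈ Ioo 0 y := fun t ht r hr => ⟨hr.1, hr.2.trans ht.2⟩
  have hWn : ∀ t ∈ Ioo 0 y, W t ≤ 0 := by
    intro t ht
    have := anti_of_hd (f := fun r => r ^ (2 * lam + 1) * W r)
      (f' := fun r => -(r ^ (2 * lam + 1) * U r ^ (1 + 2 / (lam + η)))) ht.1.le
      (((continuous_id.rpow_const (fun _ => Or.inr (by positivity))).continuousOn).mul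
        (h.cW.mono (Icc_subset_Icc le_rfl ht.2.le))) ?_ ?_
    · rw [zero_rpow (by positivity), zero_mul] at this
      have h1 : 0 < t ^ (2 * lam + 1) := rpow_pos_of_pos ht.1 _
      by_contra hcon
      push Not at hcon
      have := mul_pos h1 hcon
      linarith
    · intro r hr
      have h1 := (hasDerivAt_rpow_const (p := 2 * lam + 1) (Or.inl hr.1.ne')).mul
        (h.dW r (hI t ht r hr))
      refine h1.congr_deriv ?_
      rw [show 2 * lam + 1 - 1 = 2 * lam by ring, rpow_add_one hr.1.ne']
      have := hr.1.ne'
      field_simp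
      ring
    · intro r hr
      have := h.pos r (hI t ht r hr)
      have := hr.1
      rw [neg_nonpos]
      positivity
  have hmid : y / 2 ∈ Ioo 0 y := by constructor <;> linarith [h.hxy]
  have h2 := anti_of_hd (f := U) (f' := W) hmid.1.le (h.cU.mono (Icc_subset_Icc le_rfl hmid.2.le))
    (fun r hr => h.dU r (hI _ hmid r hr)) (fun r hr => hWn r (hI _ hmid r hr))
  exact (h.pos _ hmid).trans_le h2

theorem etaf_facts {lam ε : ℝ} (hlam : 0 < lam) (hε : 0 < ε) (hε2 : lam * ε < 1) :
    0 < etaf lam ε ∧ etaf lam ε < lam ∧ 2 / (lam + etaf lam ε) = 2 / lam - ε := by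
  have h1 : 0 < 1 - lam * ε / 2 := by linarith
  have h2 := mul_pos hlam hε
  unfold etaf
  refine ⟨?_, ?_, ?_⟩
  · rw [sub_pos, lt_div_iff₀ h1]; nlinarith
  · rw [sub_lt_iff_lt_add, div_lt_iff₀ h1]; nlinarith
  · rw [add_sub_cancel]
    field_simp

theorem rr_lt {n m : ℕ} (hm : 2 ≤ m) {p : ℝ} {u : ℝ → ℝ} {ρ δ : ℕ → ℝ}
    (h : NeumannData n p m u ρ δ) {k : ℕ} (hk : k < m) : rr m ρ (k + 1) < rr m ρ k := by
  obtain ⟨-, -, h1, h2, h3, h4, -, -⟩ := h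
  unfold rr
  rcases Nat.eq_zero_or_pos k with rfl | hk0
  · have := h3 1 le_rfl (by omega)
    simp only [zero_add, one_ne_zero, if_false, if_true]
    rw [if_neg (by omega)]
    linarith
  · rw [if_neg (show ¬ (k + 1 = 0) by omega), if_neg (show ¬ (k = 0) by omega), if_neg hk.ne]
    have h5 := h4 k hk0 (by omega)
    split_ifs with h6
    · rw [h6, h2] at h5; exact h5
    · have := h3 (k + 1) (by omega) (by omega)
      linarith

theorem rr_anti {n m : ℕ} (hm : 2 ≤ m) {p : ℝ} {u : ℝ → ℝ} {ρ δ : ℕ → ℝ}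
    (h : NeumannData n p m u ρ δ) {j k : ℕ} (hjk : j ≤ k) (hk : k ≤ m) : rr m ρ k ≤ rr m ρ j := by
  induction k, hjk using Nat.le_induction with
  | base => exact le_rfl
  | succ k hjk ih => exact (rr_lt hm h (by omega)).le.trans (ih (by omega))

theorem rr_eq {m k : ℕ} {ρ : ℕ → ℝ} (h1 : 1 ≤ k) (h2 : k ≤ m - 1) : rr m ρ k = ρ k := by
  unfold rr
  rw [if_neg (by omega), if_neg (by omega)]

theorem del_mem {n m : ℕ} {p : ℝ} {u : ℝ → ℝ} {ρ δ : ℕ → ℝ}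
    (h : NeumannData n p m u ρ δ) {k : ℕ} (hk1 : 1 ≤ k) (hk : k ≤ m) :
    (k = m ∧ δ k = 0 ∧ rr m ρ k = 0 ∨ rr m ρ k < δ k) ∧
    (k = 1 ∧ δ k = 1 ∧ rr m ρ (k - 1) = 1 ∨ δ k < rr m ρ (k - 1)) := by
  obtain ⟨-, -, h1, h2, h3, h4, -, -⟩ := h
  constructor
  · rcases hk.eq_or_lt with rfl | hk'
    · left; refine ⟨rfl, h2, ?_⟩
      unfold rr; rw [if_neg (by omega), if_pos rfl]
    · right; rw [rr_eq hk1 (by omega)]; exact h3 k hk1 (by omega)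
  · rcases hk1.eq_or_lt with rfl | hk'
    · left; refine ⟨rfl, h1, ?_⟩
      unfold rr; simp
    · right; rw [rr_eq (by omega) (by omega)]
      have := h4 (k - 1) (by omega) (by omega)
      rwa [Nat.sub_add_cancel hk1] at this

theorem neumann_extract {n m : ℕ} (hn : 3 ≤ n) (hm : 2 ≤ m) {lam ε : ℝ} (hlam : lam = ((n : ℝ) - 2) / 2)
    (hε : 0 < ε) (hε2 : lam * ε < 1) {u : ℝ → ℝ} {ρ δ : ℕ → ℝ}
    (h : NeumannData n (pEps n ε) m u ρ δ) :
    ∃ (w : ℝ → ℝ) (s : ℕ → ℝ),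
      (∀ k, 1 ≤ k → k ≤ m - 1 → deriv u (ρ k) = w (ρ k) ∧ u (ρ k) = 0 ∧ 0 < ρ k) ∧
      (∀ k, 1 ≤ k → k ≤ m → (s k = 1 ∨ s k = -1) ∧
        Arc lam (etaf lam ε) (rr m ρ k) (rr m ρ (k - 1)) (fun r => s k * u r) (fun r => s k * w r) ∧
        δ k ∈ Icc (rr m ρ k) (rr m ρ (k - 1)) ∧ w (δ k) = 0 ∧ 0 < s k * u (δ k)) := by
  have hn3 : (3 : ℝ) ≤ n := by exact_mod_cast hn
  have hlam0 : 0 < lam := by rw [hlam]; linarith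
  obtain ⟨hη0, hηl, hηe⟩ := etaf_facts hlam0 hε hε2
  have hpe : pEps n ε - 1 = 2 / (lam + etaf lam ε) := by
    rw [hηe, hlam]; unfold pEps
    have : (n : ℝ) - 2 ≠ 0 := by linarith
    field_simp
    ring
  have hpp : 0 < pEps n ε - 1 := by rw [hpe]; positivity
  have hD := h
  obtain ⟨hR, hd1, hδ1, hδm, hρδ, hδρ, hZ, hCr⟩ := h
  have hcu : ContinuousOn u (Icc 0 1) := hR.1.continuousOn
  have hz : ∀ k, 1 ≤ k → k ≤ m - 1 → ρ k ∈ Ioo (0 : ℝ) 1 ∧ u (ρ k) = 0 := by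
    intro k h1 h2
    have : ρ k ∈ ρ '' Icc 1 (m - 1) := ⟨k, ⟨h1, h2⟩, rfl⟩
    rw [← hZ] at this
    exact this
  -- nonvanishing at the boundary
  have hu1 : u 1 ≠ 0 := by
    intro hu1
    obtain ⟨hρ1, hu0⟩ := hz 1 le_rfl (by omega)
    obtain ⟨c, hc, hc0⟩ := exists_deriv_eq_zero hρ1.2
      (hcu.mono (Icc_subset_Icc hρ1.1.le le_rfl)) (hu0.trans hu1.symm)
    have : c ∈ {r : ℝ | r ∈ Set.Icc (0 : ℝ) 1 ∧ deriv u r = 0} :=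
      ⟨⟨(hρ1.1.trans hc.1).le, hc.2.le⟩, hc0⟩
    rw [hCr] at this
    obtain ⟨j, ⟨hj1, hj2⟩, rfl⟩ := this
    rcases hj1.eq_or_lt with rfl | hj
    · rw [hδ1] at hc; exact lt_irrefl _ hc.2
    · have h2 : 2 ≤ j := hj
      have e1 : rr m ρ (j - 1) ≤ rr m ρ 1 := rr_anti hm hD (by omega) (by omega)
      rw [rr_eq le_rfl (by omega)] at e1
      rcases (del_mem hD hj1 hj2).2 with h3 | h3
      · omega
      · linarith [hc.1]
  obtain ⟨w, hcw, hw0, hw1, hdu, hdw⟩ := radial_w hn (by linarith) hR hd1 hu1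
  have hrr0 : ∀ k ≤ m, 0 ≤ rr m ρ k := by
    intro k hk
    have := rr_anti hm hD hk le_rfl
    have e : rr m ρ m = 0 := by unfold rr; rw [if_neg (by omega), if_pos rfl]
    linarith
  have hrr1 : ∀ k ≤ m, rr m ρ k ≤ 1 := by
    intro k hk
    have := rr_anti hm hD (Nat.zero_le k) hk
    have e : rr m ρ 0 = 1 := by unfold rr; rw [if_pos rfl]
    linarith
  have hlt : ∀ k, 1 ≤ k → k ≤ m → rr m ρ k < rr m ρ (k - 1) := by
    intro k h1 h2
    have := rr_lt hm hD (k := k - 1) (by omega)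
    rwa [Nat.sub_add_cancel h1] at this
  have hsgn : ∀ k, ∃ s : ℝ, 1 ≤ k → k ≤ m → (s = 1 ∨ s = -1) ∧
      ∀ r ∈ Ioo (rr m ρ k) (rr m ρ (k - 1)), 0 < s * u r := by
    intro k
    by_cases hk : 1 ≤ k ∧ k ≤ m
    · obtain ⟨h1, h2⟩ := hk
      obtain ⟨s, hs⟩ := sign_of_ne (hlt k h1 h2)
        (hcu.mono (Icc_subset_Icc (hrr0 k h2) (hrr1 _ (by omega)))) (by
          intro r hr h0
          have : r ∈ {r : ℝ | r ∈ Set.Ioo (0 : ℝ) 1 ∧ u r = 0} :=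
            ⟨⟨(hrr0 k h2).trans_lt hr.1, hr.2.trans_le (hrr1 _ (by omega))⟩, h0⟩
          rw [hZ] at this
          obtain ⟨j, ⟨hj1, hj2⟩, rfl⟩ := this
          rw [← rr_eq (ρ := ρ) hj1 hj2] at hr
          rcases le_or_gt k j with hkj | hkj
          · have := rr_anti hm hD hkj (by omega)
            linarith [hr.1]
          · have := rr_anti hm hD (j := j) (k := k - 1) (by omega) (by omega)
            linarith [hr.2])
      exact ⟨s, fun _ _ => hs⟩
    · exact ⟨0, fun h1 h2 => (hk ⟨h1, h2⟩).elim⟩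
  choose s hs using hsgn
  refine ⟨w, s, ?_, ?_⟩
  · intro k h1 h2
    exact ⟨(hdu _ (hz k h1 h2).1).deriv, (hz k h1 h2).2, (hz k h1 h2).1.1⟩
  · intro k h1 h2
    obtain ⟨hs1, hs2⟩ := hs k h1 h2
    have hsub : Icc (rr m ρ k) (rr m ρ (k - 1)) ⊆ Icc 0 1 :=
      Icc_subset_Icc (hrr0 k h2) (hrr1 _ (by omega))
    have hsub' : ∀ r ∈ Ioo (rr m ρ k) (rr m ρ (k - 1)), r ∈ Ioo (0 : ℝ) 1 := fun r hr =>
      ⟨(hrr0 k h2).trans_lt hr.1, hr.2.trans_le (hrr1 _ (by omega))⟩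
    have hArc : Arc lam (etaf lam ε) (rr m ρ k) (rr m ρ (k - 1)) (fun r => s k * u r)
        (fun r => s k * w r) := by
      refine ⟨hlam0, hη0, hηl, hrr0 k h2, hlt k h1 h2, continuousOn_const.mul (hcu.mono hsub),
        continuousOn_const.mul (hcw.mono hsub), fun r hr => (hdu r (hsub' r hr)).const_mul _,
        fun r hr => ?_, hs2⟩
      refine ((hdw r (hsub' r hr)).const_mul (s k)).congr_deriv ?_
      have hp0 := hs2 r hr
      have habs : |u r| = s k * u r := by
        rw [← abs_of_pos hp0, abs_mul]
        rcases hs1 with h | h <;> simp [h]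
      rw [habs, hpe, rpow_add hp0, rpow_one, show (n : ℝ) - 1 = 2 * lam + 1 by rw [hlam]; ring]
      ring
    obtain ⟨hdl, hdr⟩ := del_mem hD h1 h2
    have hdI : δ k ∈ Icc (rr m ρ k) (rr m ρ (k - 1)) := by
      constructor
      · rcases hdl with h | h
        · rw [h.2.1, h.2.2]
        · exact h.le
      · rcases hdr with h | h
        · rw [h.2.1, h.2.2]
        · exact h.le
    refine ⟨hs1, hArc, hdI, ?_, ?_⟩
    · have hmem : δ k ∈ δ '' Icc 1 m := ⟨k, ⟨h1, h2⟩, rfl⟩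
      rw [← hCr] at hmem
      rcases hdl with h | h
      · rw [h.2.1, hw0]
      rcases hdr with h' | h'
      · rw [h'.2.1, hw1]
      rw [← (hdu _ (hsub' _ ⟨h, h'⟩)).deriv]
      exact hmem.2
    · rcases hdl with h | h
      · rw [h.2.2] at hArc
        rw [h.2.1]
        exact hArc.pos_zero
      rcases hdr with h' | h'
      · have e := hArc.U_nonneg hdI
        rw [h'.2.1] at e ⊢
        refine lt_of_le_of_ne e (Ne.symm (mul_ne_zero ?_ hu1))
        rcases hs1 with h | h <;> simp [h]
      · exact hs2 _ ⟨h, h'⟩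

theorem etaf_tendsto {lam : ℝ} : Tendsto (etaf lam) (𝓝[>] 0) (𝓝 0) := by
  have h : ContinuousAt (etaf lam) 0 := by
    unfold etaf
    apply ContinuousAt.sub _ continuousAt_const
    apply ContinuousAt.div continuousAt_const (by fun_prop)
    norm_num
  have h0 : etaf lam 0 = 0 := by unfold etaf; norm_num
  have := h.tendsto
  rw [h0] at this
  exact this.mono_left nhdsWithin_le_nhds

theorem fE_zero {lam η x s : ℝ} {u w : ℝ → ℝ} (ha : 0 < lam + η) (hs : s = 1 ∨ s = -1)
    (hV : fV lam η (fun r => s * u r) x = 0) :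
    fE lam η (fun r => s * u r) (fun r => s * w r) x = (x ^ (lam + η) * (x * w x)) ^ 2 / 2 := by
  have hs2 : s ^ 2 = 1 := by rcases hs with h | h <;> simp [h]
  unfold fE en fP
  rw [hV, zero_rpow (by positivity)]
  have : (x ^ (lam + η) * (x * (s * w x))) ^ 2 = s ^ 2 * (x ^ (lam + η) * (x * w x)) ^ 2 := by ring
  rw [mul_zero, zero_add, this, hs2]
  ring

theorem abs_sgn {s a : ℝ} (hs : s = 1 ∨ s = -1) : |s * a| = |a| := by
  rw [abs_mul]; rcases hs with h | h <;> simp [h]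

theorem neumann_limits {n m : ℕ} (hn : 3 ≤ n) (hm : 2 ≤ m) {lam : ℝ} (hlam : lam = ((n : ℝ) - 2) / 2)
    {u : ℝ → ℝ → ℝ} {ρ δ : ℝ → ℕ → ℝ}
    (hu : ∀ ε ∈ Set.Ioo (0 : ℝ) (4 / ((n : ℝ) - 2)),
      NeumannData n (pEps n ε) m (u ε) (ρ ε) (δ ε)) :
    (∀ k, 1 ≤ k → k ≤ m → ∀ᶠ ε in 𝓝[>] (0 : ℝ), 0 < |u ε (δ ε k)|) ∧
    (∀ k, 1 ≤ k → k ≤ m - 1 → ∀ᶠ ε in 𝓝[>] (0 : ℝ), 0 < ρ ε k ∧ 0 < δ ε k) ∧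
    (∀ k, 1 ≤ k → k ≤ m - 1 → Tendsto (fun ε => (ρ ε k ^ (lam + etaf lam ε) *
      (ρ ε k * |deriv (u ε) (ρ ε k)|)) ^ 2 / 2 / etaf lam ε) (𝓝[>] 0)
        (𝓝 (4 * Ibub lam * ((m : ℝ) - k)))) ∧
    (∀ k, 1 ≤ k → k ≤ m - 1 → Tendsto (fun ε => (δ ε k ^ (lam + etaf lam ε) *
      |u ε (δ ε k)|) ^ (2 + 2 / (lam + etaf lam ε)) / (2 + 2 / (lam + etaf lam ε)) / etaf lam ε) (𝓝[>] 0)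
        (𝓝 (4 * Ibub lam * ((m : ℝ) - k)))) ∧
    (∀ k, 1 ≤ k → k ≤ m - 1 → Tendsto (fun ε => log (ρ ε k * |deriv (u ε) (ρ ε k)|) -
      log (2 * lam * |u ε (δ ε k)|)) (𝓝[>] 0) (𝓝 0)) ∧
    (∀ k, 1 ≤ k → k ≤ m - 1 → Tendsto (fun ε => log |deriv (u ε) (ρ ε k)| +
      (2 * lam + 1) * log (ρ ε k) + (lam - etaf lam ε) / (lam + etaf lam ε) *
        log |u ε (δ ε (k + 1))|) (𝓝[>] 0)
        (𝓝 (log (2 * lam) + lam * log (4 * lam * (lam + 1))))) := by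
  have hn3 : (3 : ℝ) ≤ n := by exact_mod_cast hn
  have hlam0 : 0 < lam := by rw [hlam]; linarith
  have hη := etaf_tendsto (lam := lam)
  have hex : ∀ᶠ ε in 𝓝[>] (0 : ℝ), ∃ ws : (ℝ → ℝ) × (ℕ → ℝ),
      (0 < etaf lam ε ∧
      ∀ k, 1 ≤ k → k ≤ m - 1 → deriv (u ε) (ρ ε k) = ws.1 (ρ ε k) ∧ u ε (ρ ε k) = 0 ∧ 0 < ρ ε k) ∧
      (∀ k, 1 ≤ k → k ≤ m → (ws.2 k = 1 ∨ ws.2 k = -1) ∧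
        Arc lam (etaf lam ε) (rr m (ρ ε) k) (rr m (ρ ε) (k - 1)) (fun r => ws.2 k * u ε r)
          (fun r => ws.2 k * ws.1 r) ∧
        δ ε k ∈ Icc (rr m (ρ ε) k) (rr m (ρ ε) (k - 1)) ∧ ws.1 (δ ε k) = 0 ∧
          0 < ws.2 k * u ε (δ ε k)) := by
    have hp : 0 < 4 / ((n : ℝ) - 2) := div_pos (by norm_num) (by linarith)
    filter_upwards [Ioo_mem_nhdsGT hp, Ioo_mem_nhdsGT (show 0 < 1 / lam by positivity)] with ε h1 h2
    have h3 : lam * ε < 1 := by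
      have := h2.2; rw [lt_div_iff₀ hlam0] at this; linarith
    obtain ⟨w, s, ha, hb⟩ := neumann_extract hn hm hlam h1.1 h3 (hu ε h1)
    exact ⟨(w, s), ⟨(etaf_facts hlam0 h1.1 h3).1, ha⟩, hb⟩
  obtain ⟨f, hf⟩ := hex.choice
  set w := fun ε => (f ε).1 with hwdef
  set s := fun ε => (f ε).2 with hsdef
  have hηpos : ∀ᶠ ε in 𝓝[>] (0 : ℝ), 0 < etaf lam ε := hf.mono fun ε h => h.1.1
  have hz : ∀ k, 1 ≤ k → k ≤ m - 1 → ∀ᶠ ε in 𝓝[>] (0 : ℝ),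
      deriv (u ε) (ρ ε k) = w ε (ρ ε k) ∧ u ε (ρ ε k) = 0 ∧ 0 < ρ ε k :=
    fun k h1 h2 => hf.mono fun ε h => h.1.2 k h1 h2
  have hs : ∀ k, 1 ≤ k → k ≤ m → ∀ᶠ ε in 𝓝[>] (0 : ℝ), s ε k = 1 ∨ s ε k = -1 :=
    fun k h1 h2 => hf.mono fun ε h => (h.2 k h1 h2).1
  have hA : ∀ k, 1 ≤ k → k ≤ m → ∀ᶠ ε in 𝓝[>] (0 : ℝ),
      Arc lam (etaf lam ε) (rr m (ρ ε) k) (rr m (ρ ε) (k - 1)) (fun r => s ε k * u ε r)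
          (fun r => s ε k * w ε r) :=
    fun k h1 h2 => hf.mono fun ε h => (h.2 k h1 h2).2.1
  have hd : ∀ k, 1 ≤ k → k ≤ m → ∀ᶠ ε in 𝓝[>] (0 : ℝ),
      δ ε k ∈ Icc (rr m (ρ ε) k) (rr m (ρ ε) (k - 1)) ∧ s ε k * w ε (δ ε k) = 0 ∧
          0 < s ε k * u ε (δ ε k) :=
    fun k h1 h2 => hf.mono fun ε h => ⟨(h.2 k h1 h2).2.2.1,
      by rw [hwdef]; simp only; rw [(h.2 k h1 h2).2.2.2.1, mul_zero], (h.2 k h1 h2).2.2.2.2⟩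
  have hV0 : ∀ (j k : ℕ), 1 ≤ k → k ≤ m → ∀ᶠ ε in 𝓝[>] (0 : ℝ),
      fV lam (etaf lam ε) (fun r => s ε j * u ε r) (rr m (ρ ε) k) = 0 := by
    intro j k h1 h2
    rcases h2.eq_or_lt with h3 | h3
    · filter_upwards [hηpos] with ε h4
      have : rr m (ρ ε) k = 0 := by unfold rr; rw [if_neg (by omega), if_pos h3]
      unfold fV
      rw [this, zero_rpow (by positivity), zero_mul]
    · filter_upwards [hz k h1 (by omega)] with ε h4
      unfold fV
      rw [rr_eq h1 (by omega)]
      simp only [h4.2.1, mul_zero]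
  have hEe : ∀ (j k : ℕ), 1 ≤ j → j ≤ m → 1 ≤ k → k ≤ m → ∀ᶠ ε in 𝓝[>] (0 : ℝ),
      fE lam (etaf lam ε) (fun r => s ε j * u ε r) (fun r => s ε j * w ε r) (rr m (ρ ε) k) =
      (rr m (ρ ε) k ^ (lam + etaf lam ε) * (rr m (ρ ε) k * w ε (rr m (ρ ε) k))) ^ 2 / 2 := by
    intro j k h1 h2 h3 h4
    filter_upwards [hs j h1 h2, hηpos, hV0 j k h3 h4] with ε h5 h6 h7
    exact fE_zero (by positivity) h5 h7
  have hEmain : ∀ j, ∀ k, 1 ≤ k → k + j = m →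
      Tendsto (fun ε => (rr m (ρ ε) k ^ (lam + etaf lam ε) * (rr m (ρ ε) k * w ε (rr m (ρ ε) k))) ^ 2 / 2)
        (𝓝[>] (0 : ℝ)) (𝓝 0) ∧
      Tendsto (fun ε => (rr m (ρ ε) k ^ (lam + etaf lam ε) * (rr m (ρ ε) k * w ε (rr m (ρ ε) k))) ^ 2 / 2 /
        etaf lam ε) (𝓝[>] (0 : ℝ)) (𝓝 (4 * Ibub lam * j)) := by
    intro j
    induction j with
    | zero =>
      intro k hk1 hk
      have : ∀ ε, rr m (ρ ε) k = 0 := by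
        intro ε; unfold rr; rw [if_neg (by omega), if_pos (by omega)]
      simp [this]
    | succ j ih =>
      intro k hk1 hk
      obtain ⟨i1, i2⟩ := ih (k + 1) (by omega) (by omega)
      have a1 := hA (k + 1) (by omega) (by omega)
      rw [Nat.add_sub_cancel] at a1
      have a2 := hV0 (k + 1) (k + 1) (by omega) (by omega)
      have a3 := hV0 (k + 1) k (by omega) (by omega)
      have a4 := hEe (k + 1) (k + 1) (by omega) (by omega) (by omega) (by omega)
      have a5 := hEe (k + 1) k (by omega) (by omega) (by omega) (by omega)
      have i1' := i1.congr' (a4.mono fun ε h => h.symm)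
      have b1 := bump_E_tendsto_zero hη a1 a2 a3 i1'
      have b2 := bump_tendsto hlam0 hη a1 a2 a3 i1'
      refine ⟨b1.congr' a5, ?_⟩
      have b3 := b2.add i2
      have e : 4 * Ibub lam * ((j + 1 : ℕ) : ℝ) = 4 * Ibub lam + 4 * Ibub lam * (j : ℝ) := by
        push_cast; ring
      rw [e]
      refine b3.congr' ?_
      filter_upwards [a4, a5] with ε h4 h5
      rw [h4, h5]; ring
  have hE0 : ∀ k, 1 ≤ k → k ≤ m → Tendsto (fun ε => fE lam (etaf lam ε) (fun r => s ε k * u ε r)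
      (fun r => s ε k * w ε r) (rr m (ρ ε) k)) (𝓝[>] (0 : ℝ)) (𝓝 0) := by
    intro k h1 h2
    exact (hEmain (m - k) k h1 (by omega)).1.congr' ((hEe k k h1 h2 h1 h2).mono fun ε h => h.symm)
  have hEd : ∀ k, 1 ≤ k → k ≤ m → Tendsto (fun ε => fE lam (etaf lam ε) (fun r => s ε k * u ε r)
      (fun r => s ε k * w ε r) (rr m (ρ ε) k) / etaf lam ε) (𝓝[>] (0 : ℝ))
      (𝓝 (4 * Ibub lam * ((m : ℝ) - k))) := by
    intro k h1 h2
    have := (hEmain (m - k) k h1 (by omega)).2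
    rw [Nat.cast_sub h2] at this
    exact this.congr' ((hEe k k h1 h2 h1 h2).mono fun ε h => by simp only [h])
  refine ⟨?_, ?_, ?_, ?_, ?_, ?_⟩
  · intro k h1 h2
    filter_upwards [hd k h1 h2] with ε h
    rw [abs_pos]
    intro h0; rw [h0, mul_zero] at h; exact lt_irrefl _ h.2.2
  · intro k h1 h2
    filter_upwards [hz k h1 h2, hd k h1 (by omega)] with ε h h'
    have := h'.1.1
    rw [rr_eq h1 h2] at this
    exact ⟨h.2.2, h.2.2.trans_le this⟩
  · intro k h1 h2
    have := (hEmain (m - k) k h1 (by omega)).2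
    rw [Nat.cast_sub (by omega)] at this
    refine this.congr' ?_
    filter_upwards [hz k h1 h2] with ε h
    rw [rr_eq h1 h2, h.1, mul_pow, mul_pow, mul_pow, mul_pow, sq_abs]
  · intro k h1 h2
    have := crit_tendsto_div hlam0 hη (hA k h1 (by omega)) (hV0 k k h1 (by omega))
      (hd k h1 (by omega)) (hE0 k h1 (by omega)) (hEd k h1 (by omega))
    refine this.congr' ?_
    filter_upwards [hs k h1 (by omega), hd k h1 (by omega)] with ε h3 h4
    unfold fV
    simp only
    rw [← abs_of_pos h4.2.2, abs_sgn h3]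
  · intro k h1 h2
    have := slope_tendsto hlam0 hη (hA k h1 (by omega)) (by
      filter_upwards [hz k h1 h2] with ε h
      rw [rr_eq h1 h2, h.2.1, mul_zero]) (hd k h1 (by omega)) (hE0 k h1 (by omega))
    refine this.congr' ?_
    filter_upwards [hs k h1 (by omega), hd k h1 (by omega), hz k h1 h2] with ε h3 h4 h5
    rw [rr_eq h1 h2, ← abs_of_pos h4.2.2, abs_sgn h3, ← log_abs (ρ ε k * (s ε k * w ε (ρ ε k))),
      abs_mul, abs_sgn h3, abs_of_pos h5.2.2, h5.1]
  · intro k h1 h2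
    have a1 := hA (k + 1) (by omega) (by omega)
    have a6 := hd (k + 1) (by omega) (by omega)
    rw [Nat.add_sub_cancel] at a1
    simp only [Nat.add_sub_cancel] at a6
    have a2 := hV0 (k + 1) (k + 1) (by omega) (by omega)
    have a3 := hV0 (k + 1) k (by omega) (by omega)
    have := bump_conn_tendsto hlam0 hη a1 a2 a3 a6 (hE0 (k + 1) (by omega) (by omega))
    refine this.congr' ?_
    filter_upwards [hs (k + 1) (by omega) (by omega), a6, hz k h1 h2] with ε h3 h4 h5
    unfold Arc.fG
    rw [rr_eq h1 h2, ← abs_of_pos h4.2.2, abs_sgn h3, ← log_abs (-(s ε (k + 1) * w ε (ρ ε k))),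
      abs_neg, abs_sgn h3, h5.1]

/-- `f = α log (κ ε) + β + o(1)` -/
def Asy (κ : ℝ) (f : ℝ → ℝ) (α β : ℝ) : Prop :=
  Tendsto (fun ε => f ε - α * log (κ * ε)) (𝓝[>] 0) (𝓝 β)

namespace Asy
variable {κ : ℝ} {f g : ℝ → ℝ} {α β α' β' : ℝ}

theorem add (hf : Asy κ f α β) (hg : Asy κ g α' β') :
    Asy κ (fun ε => f ε + g ε) (α + α') (β + β') := by
  refine (Tendsto.add hf hg).congr fun ε => ?_
  ring

theorem sub (hf : Asy κ f α β) (hg : Asy κ g α' β') :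
    Asy κ (fun ε => f ε - g ε) (α - α') (β - β') := by
  refine (Tendsto.sub hf hg).congr fun ε => ?_
  ring

theorem cmul (hf : Asy κ f α β) (c : ℝ) : Asy κ (fun ε => c * f ε) (c * α) (c * β) := by
  refine (Tendsto.const_mul c hf).congr fun ε => ?_
  ring

theorem of_tendsto (hf : Tendsto f (𝓝[>] 0) (𝓝 β)) : Asy κ f 0 β := by
  unfold Asy
  simpa using hf

theorem conv (hf : Asy κ f α β) (h : f =ᶠ[𝓝[>] 0] g) (h1 : α = α') (h2 : β = β') : Asy κ g α' β' := by
  subst h1 h2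
  refine Tendsto.congr' ?_ hf
  filter_upwards [h] with ε he
  rw [he]

theorem eps_log (hκ : 0 < κ) : Tendsto (fun ε => ε * log (κ * ε)) (𝓝[>] 0) (𝓝 0) := by
  have h1 : Tendsto (fun ε : ℝ => log ε * ε) (𝓝[>] 0) (𝓝 0) := by
    simpa using tendsto_log_mul_rpow_nhdsGT_zero one_pos
  have h2 : Tendsto (fun ε : ℝ => ε * log κ) (𝓝[>] 0) (𝓝 0) := by
    have := (continuous_id.mul (continuous_const (y := log κ))).tendsto (0 : ℝ)
    simp only [id, Pi.mul_apply, zero_mul] at this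
    exact this.mono_left nhdsWithin_le_nhds
  have := h2.add h1
  rw [add_zero] at this
  refine this.congr' ?_
  filter_upwards [self_mem_nhdsWithin] with ε (he : 0 < ε)
  rw [log_mul hκ.ne' he.ne']; ring

theorem pert (hκ : 0 < κ) (hf : Asy κ f α β) {c r : ℝ → ℝ} {c0 r0 : ℝ}
    (hc : ∀ᶠ ε in 𝓝[>] (0 : ℝ), c ε = c0 + ε * r ε) (hr : Tendsto r (𝓝[>] 0) (𝓝 r0)) :
    Asy κ (fun ε => c ε * f ε) (c0 * α) (c0 * β) := by
  have he : Tendsto (fun ε : ℝ => ε) (𝓝[>] 0) (𝓝 0) :=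
    (continuous_id.tendsto 0).mono_left nhdsWithin_le_nhds
  have h1 : Tendsto (fun ε => c0 + ε * r ε) (𝓝[>] 0) (𝓝 (c0 + 0 * r0)) :=
    tendsto_const_nhds.add (he.mul hr)
  have h2 := (h1.mul hf).add (((eps_log hκ).mul hr).const_mul α)
  simp only [zero_mul, add_zero, mul_zero] at h2
  refine h2.congr' ?_
  filter_upwards [hc] with ε h
  rw [h]; ring

theorem concl (hκ : 0 < κ) {F : ℝ → ℝ} (hF : ∀ᶠ ε in 𝓝[>] (0 : ℝ), 0 < F ε)
    (h : Asy κ (fun ε => log (F ε)) α β) {e K : ℝ} (he : e = -α) (hK : 0 < K) (hβ : log K = β) :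
    Tendsto (fun ε => F ε * (κ * ε) ^ e) (𝓝[>] 0) (𝓝 K) := by
  have h1 := (continuous_exp.tendsto β).comp h
  rw [← hβ, exp_log hK] at h1
  refine h1.congr' ?_
  filter_upwards [hF, self_mem_nhdsWithin] with ε h2 (h3 : 0 < ε)
  simp only [Function.comp]
  rw [rpow_def_of_pos (by positivity), he, sub_eq_add_neg, exp_add, exp_log h2]
  congr 2
  ring

end Asy

theorem etaf_div {lam : ℝ} : Tendsto (fun ε => etaf lam ε / ε) (𝓝[>] 0) (𝓝 (lam ^ 2 / 2)) := by
  have h : ContinuousAt (fun ε : ℝ => lam ^ 2 / 2 / (1 - lam * ε / 2)) 0 := by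
    apply ContinuousAt.div continuousAt_const (by fun_prop)
    norm_num
  have h1 := h.tendsto
  simp only [mul_zero, zero_div, sub_zero, div_one] at h1
  have h2 : ∀ᶠ ε in 𝓝 (0 : ℝ), 0 < 1 - lam * ε / 2 := by
    have : ContinuousAt (fun ε : ℝ => 1 - lam * ε / 2) 0 := by fun_prop
    exact this.eventually (lt_mem_nhds (by norm_num))
  refine (h1.mono_left nhdsWithin_le_nhds).congr' ?_
  filter_upwards [self_mem_nhdsWithin, h2.filter_mono nhdsWithin_le_nhds] with ε (h3 : 0 < ε) h4
  unfold etaf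
  have := h3.ne'
  have := h4.ne'
  have h5 : 2 - lam * ε ≠ 0 := by intro h; apply h4.ne'; linarith
  field_simp
  ring

theorem log_etaf {lam κ : ℝ} (hlam : 0 < lam) (hκ : 0 < κ) :
    Asy κ (fun ε => log (etaf lam ε)) 1 (log (lam ^ 2 / 2) - log κ) := by
  have h1 := (etaf_div (lam := lam)).log (by positivity)
  have h2 := h1.sub_const (log κ)
  refine h2.congr' ?_
  have h3 : ∀ᶠ ε in 𝓝[>] (0 : ℝ), lam * ε < 1 := by
    filter_upwards [Ioo_mem_nhdsGT (show 0 < 1 / lam by positivity)] with ε h2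
    have := h2.2; rw [lt_div_iff₀ hlam] at this; linarith
  filter_upwards [self_mem_nhdsWithin, h3] with ε (h4 : 0 < ε) h5
  have := (etaf_facts hlam h4 h5).1
  rw [log_div this.ne' h4.ne', log_mul hκ.ne' h4.ne']
  ring

/-- solving the logarithmic relations for the energy-like quantities -/
theorem log_energy {lam κ J : ℝ} (hlam : 0 < lam) (hκ : 0 < κ) (hJ : 0 < J) {X : ℝ → ℝ}
    (h : Tendsto (fun ε => X ε / etaf lam ε) (𝓝[>] 0) (𝓝 J)) :
    (∀ᶠ ε in 𝓝[>] (0 : ℝ), X ε ≠ 0) ∧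
    Asy κ (fun ε => log (X ε)) 1 (log J + log (lam ^ 2 / 2) - log κ) := by
  have hpos := h.eventually (lt_mem_nhds hJ)
  have hX : ∀ᶠ ε in 𝓝[>] (0 : ℝ), X ε ≠ 0 ∧ etaf lam ε ≠ 0 := by
    filter_upwards [hpos] with ε h1
    constructor
    · intro h0; rw [h0, zero_div] at h1; exact lt_irrefl _ h1
    · intro h0; rw [h0, div_zero] at h1; exact lt_irrefl _ h1
  refine ⟨hX.mono fun ε h => h.1, ?_⟩
  refine ((Asy.of_tendsto (κ := κ) (h.log hJ.ne')).add (log_etaf hlam hκ)).conv ?_ (by ring) (by ring)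
  filter_upwards [hX] with ε h1
  rw [log_div h1.1 h1.2]; ring

theorem ev_small {lam : ℝ} (hlam : 0 < lam) : ∀ᶠ ε in 𝓝[>] (0 : ℝ), 0 < ε ∧ lam * ε < 1 := by
  filter_upwards [self_mem_nhdsWithin, Ioo_mem_nhdsGT (show 0 < 1 / lam by positivity)] with ε h1 h2
  have := h2.2; rw [lt_div_iff₀ hlam] at this
  exact ⟨h1, by linarith⟩

theorem log_J {lam κ M : ℝ} (hlam : 0 < lam) (hκ : 0 < κ) (hM : 0 < M)
    (hI : Ibub lam = κ * (4 * lam * (lam + 1)) ^ lam) :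
    0 < 4 * Ibub lam * M ∧ log (4 * Ibub lam * M) + log (lam ^ 2 / 2) - log κ =
      log 2 + 2 * log lam + lam * log (4 * lam * (lam + 1)) + log M := by
  have hA : 0 < 4 * lam * (lam + 1) := by positivity
  have hp : 0 < (4 * lam * (lam + 1)) ^ lam := rpow_pos_of_pos hA _
  rw [hI]
  refine ⟨by positivity, ?_⟩
  rw [log_mul (by positivity) hM.ne', log_mul (by norm_num) (by positivity),
    log_mul hκ.ne' hp.ne', log_rpow hA, log_div (by positivity) (by norm_num), log_pow,
    show (4 : ℝ) = 2 ^ 2 by norm_num, log_pow]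
  push_cast
  ring

theorem asy_rho {lam κ M : ℝ} (hlam : 0 < lam) (hκ : 0 < κ) (hM : 0 < M)
    (hI : Ibub lam = κ * (4 * lam * (lam + 1)) ^ lam) {r d : ℝ → ℝ}
    (hr : ∀ᶠ ε in 𝓝[>] (0 : ℝ), 0 < r ε)
    (h : Tendsto (fun ε => (r ε ^ (lam + etaf lam ε) * (r ε * |d ε|)) ^ 2 / 2 / etaf lam ε) (𝓝[>] 0)
        (𝓝 (4 * Ibub lam * M))) :
    (∀ᶠ ε in 𝓝[>] (0 : ℝ), 0 < |d ε|) ∧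
    Asy κ (fun ε => (lam + etaf lam ε) * log (r ε) + log (r ε) + log |d ε|) (1 / 2)
      (log (2 * lam) + lam / 2 * log (4 * lam * (lam + 1)) + 1 / 2 * log M) := by
  obtain ⟨hJ, hJe⟩ := log_J hlam hκ hM hI
  obtain ⟨h1, h2⟩ := log_energy hlam hκ hJ h
  rw [hJe] at h2
  have hd : ∀ᶠ ε in 𝓝[>] (0 : ℝ), 0 < |d ε| := by
    filter_upwards [h1] with ε h
    rw [abs_pos]
    rintro h0
    apply h
    rw [h0]; simp
  refine ⟨hd, ?_⟩
  have h3 := (h2.add (Asy.of_tendsto (κ := κ) (f := fun _ => log 2) tendsto_const_nhds)).cmul (1 / 2)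
  refine h3.conv ?_ (by ring) (by rw [log_mul (by norm_num) hlam.ne']; ring)
  filter_upwards [hr, hd] with ε h4 h5
  have h6 : 0 < r ε ^ (lam + etaf lam ε) := rpow_pos_of_pos h4 _
  rw [log_div (by positivity) (by norm_num), log_pow, log_mul h6.ne' (by positivity),
    log_mul h4.ne' h5.ne', log_rpow h4]
  push_cast
  ring

theorem asy_delta {lam κ M : ℝ} (hlam : 0 < lam) (hκ : 0 < κ) (hM : 0 < M)
    (hI : Ibub lam = κ * (4 * lam * (lam + 1)) ^ lam) {r d : ℝ → ℝ}
    (hr : ∀ᶠ ε in 𝓝[>] (0 : ℝ), 0 < r ε) (hd : ∀ᶠ ε in 𝓝[>] (0 : ℝ), 0 < |d ε|)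
    (h : Tendsto (fun ε => (r ε ^ (lam + etaf lam ε) * |d ε|) ^ (2 + 2 / (lam + etaf lam ε)) /
      (2 + 2 / (lam + etaf lam ε)) / etaf lam ε) (𝓝[>] 0) (𝓝 (4 * Ibub lam * M))) :
    Asy κ (fun ε => (lam + etaf lam ε) * log (r ε) + log |d ε|) (lam / (2 * (lam + 1)))
      (lam / 2 * log (4 * lam * (lam + 1)) + lam / (2 * (lam + 1)) * log M) := by
  obtain ⟨hJ, hJe⟩ := log_J hlam hκ hM hI
  obtain ⟨h1, h2⟩ := log_energy hlam hκ hJ h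
  rw [hJe] at h2
  have hq0 : 0 < 2 + 2 / lam := by positivity
  have hq : ContinuousAt (fun ε : ℝ => 2 + 2 / lam - ε) 0 := by fun_prop
  have hq1 : Tendsto (fun ε : ℝ => 2 + 2 / lam - ε) (𝓝[>] 0) (𝓝 (2 + 2 / lam)) := by
    have := hq.tendsto
    simp only [sub_zero] at this
    exact this.mono_left nhdsWithin_le_nhds
  have hlq := hq1.log hq0.ne'
  have hqpos := hq1.eventually (lt_mem_nhds hq0)
  have h3 := h2.add (Asy.of_tendsto (κ := κ) hlq)
  have hr0 : Tendsto (fun ε : ℝ => (2 + 2 / lam)⁻¹ * (2 + 2 / lam - ε)⁻¹) (𝓝[>] 0)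
      (𝓝 ((2 + 2 / lam)⁻¹ * (2 + 2 / lam)⁻¹)) := (hq1.inv₀ hq0.ne').const_mul _
  have h4 := h3.pert hκ (c := fun ε => (2 + 2 / lam - ε)⁻¹) (c0 := (2 + 2 / lam)⁻¹) (by
    filter_upwards [hqpos] with ε h5
    generalize 2 + 2 / lam = q at *
    have := h5.ne'
    have := hq0.ne'
    field_simp
    ring) hr0
  have e0 : (2 + 2 / lam)⁻¹ = lam / (2 * (lam + 1)) := by field_simp
  have e1 : log (2 + 2 / lam) = log 2 + log (lam + 1) - log lam := by
    rw [show 2 + 2 / lam = 2 * (lam + 1) / lam by field_simp, log_div (by positivity) hlam.ne',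
      log_mul (by norm_num) (by positivity)]
  have e2 : log (4 * lam * (lam + 1)) = 2 * log 2 + log lam + log (lam + 1) := by
    rw [log_mul (by positivity) (by positivity), log_mul (by norm_num) hlam.ne',
      show (4 : ℝ) = 2 ^ 2 by norm_num, log_pow]
    push_cast; ring
  refine h4.conv ?_ (by rw [e0]; ring) (by rw [e0, e1, e2]; field_simp; ring)
  filter_upwards [hr, hd, hqpos, ev_small hlam] with ε h5 h6 h7 h8
  have h9 : 0 < r ε ^ (lam + etaf lam ε) := rpow_pos_of_pos h5 _
  have h10 := (etaf_facts hlam h8.1 h8.2).2.2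
  have h11 : 2 + 2 / (lam + etaf lam ε) = 2 + 2 / lam - ε := by rw [h10]; ring
  rw [h11]
  have h12 : 0 < r ε ^ (lam + etaf lam ε) * |d ε| := by positivity
  rw [log_div (rpow_pos_of_pos h12 _).ne' h7.ne', log_rpow h12, log_mul h9.ne' h6.ne', log_rpow h5,
    sub_add_cancel, inv_mul_cancel_left₀ h7.ne']

theorem inv_a_pert {lam κ α β : ℝ} (hlam : 0 < lam) (hκ : 0 < κ) {f : ℝ → ℝ}
    (h : Asy κ (fun ε => (lam + etaf lam ε) * f ε) α β) : Asy κ f (α / lam) (β / lam) := by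
  have h1 := h.pert hκ (c := fun ε => 1 / lam - ε / 2) (c0 := 1 / lam) (r := fun _ => -(1 / 2))
    (by filter_upwards with ε; ring) tendsto_const_nhds
  refine h1.conv ?_ (by ring) (by ring)
  filter_upwards [ev_small hlam] with ε h2
  obtain ⟨h3, -, h4⟩ := etaf_facts hlam h2.1 h2.2
  have h5 : 1 / lam - ε / 2 = 1 / (lam + etaf lam ε) := by
    have : 1 / (lam + etaf lam ε) = (2 / (lam + etaf lam ε)) / 2 := by ring
    rw [this, h4]; ring
  have : 0 < lam + etaf lam ε := by linarith
  rw [h5]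
  field_simp

theorem inv_mu_pert {lam κ α β : ℝ} (hlam : 0 < lam) (hκ : 0 < κ) {f : ℝ → ℝ}
    (h : Asy κ (fun ε => (lam - etaf lam ε) / (lam + etaf lam ε) * f ε) α β) : Asy κ f α β := by
  have hc : ContinuousAt (fun ε : ℝ => lam / (1 - lam * ε)) 0 := by
    apply ContinuousAt.div continuousAt_const (by fun_prop); norm_num
  have h1 := h.pert hκ (c := fun ε => 1 / (1 - lam * ε)) (c0 := 1) (r := fun ε => lam / (1 - lam * ε))
    (by
      filter_upwards [ev_small hlam] with ε h2
      have : 1 - lam * ε ≠ 0 := by linarith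
      field_simp; ring) (hc.tendsto.mono_left nhdsWithin_le_nhds)
  refine h1.conv ?_ (by ring) (by ring)
  filter_upwards [ev_small hlam] with ε h2
  obtain ⟨h3, -, h4⟩ := etaf_facts hlam h2.1 h2.2
  have h0 : 0 < lam + etaf lam ε := by linarith
  have h5 : (lam - etaf lam ε) / (lam + etaf lam ε) = 1 - lam * ε := by
    have : (lam - etaf lam ε) / (lam + etaf lam ε) = lam * (2 / (lam + etaf lam ε)) - 1 := by
      field_simp; ring
    rw [this, h4]; field_simp; ring
  rw [h5]
  have : 1 - lam * ε ≠ 0 := by linarith [h2.2]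
  field_simp

/-- The constants in logarithmic form. -/
theorem neumann_logs {n m : ℕ} (hn : 3 ≤ n) (hm : 2 ≤ m) {lam κ : ℝ} (hlam : lam = ((n : ℝ) - 2) / 2)
    (hκ : 0 < κ) (hI : Ibub lam = κ * (4 * lam * (lam + 1)) ^ lam)
    {u : ℝ → ℝ → ℝ} {ρ δ : ℝ → ℕ → ℝ}
    (hu : ∀ ε ∈ Set.Ioo (0 : ℝ) (4 / ((n : ℝ) - 2)),
      NeumannData n (pEps n ε) m (u ε) (ρ ε) (δ ε))
    {C a1 M1 : ℝ} {c : ℕ → ℝ} (hC : C = log (4 * lam * (lam + 1))) (ha1 : a1 = lam / (2 * (lam + 1)))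
    (hM1 : M1 = log ((m : ℝ) - 1))
    (hc : ∀ k, c k = log (Real.Gamma ((m : ℝ) - k + 1)) - log (Real.Gamma m)) :
    (∀ k, 1 ≤ k → k ≤ m → (∀ᶠ ε in 𝓝[>] (0 : ℝ), 0 < |u ε (δ ε k)|) ∧
      Asy κ (fun ε => log |u ε (δ ε k)|) (a1 - (k - 1)) (lam / 2 * C + a1 * M1 + c k)) ∧
    (∀ k, 1 ≤ k → k ≤ m - 1 →
      ((∀ᶠ ε in 𝓝[>] (0 : ℝ), 0 < δ ε k) ∧ Asy κ (fun ε => log (δ ε k)) ((k - 1) / lam)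
        ((a1 * (log ((m : ℝ) - k) - M1) - c k) / lam)) ∧
      ((∀ᶠ ε in 𝓝[>] (0 : ℝ), 0 < ρ ε k) ∧ Asy κ (fun ε => log (ρ ε k)) ((1 / 2 - (a1 - (k - 1))) / lam)
        ((1 / 2 * log ((m : ℝ) - k) - a1 * M1 - c k) / lam)) ∧
      ((∀ᶠ ε in 𝓝[>] (0 : ℝ), 0 < |deriv (u ε) (ρ ε k)|) ∧ Asy κ (fun ε => log |deriv (u ε) (ρ ε k)|)
        ((a1 - (k - 1)) - (1 / 2 - (a1 - (k - 1))) / lam)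
        (lam / 2 * C + a1 * M1 + c k + log (2 * lam) -
          (1 / 2 * log ((m : ℝ) - k) - a1 * M1 - c k) / lam))) := by
  have hn3 : (3 : ℝ) ≤ n := by exact_mod_cast hn
  have hlam0 : 0 < lam := by rw [hlam]; linarith
  obtain ⟨L1, L2, L3, L4, L5, L6⟩ := neumann_limits hn hm hlam hu
  have hMpos : ∀ k : ℕ, k ≤ m - 1 → 0 < (m : ℝ) - k := by
    intro k hk
    have : k + 1 ≤ m := by omega
    have : ((k + 1 : ℕ) : ℝ) ≤ m := by exact_mod_cast this
    push_cast at this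
    linarith
  have hR : ∀ k, 1 ≤ k → k ≤ m - 1 → _ := fun k h1 h2 => asy_rho hlam0 hκ (hMpos k h2) hI
    ((L2 k h1 h2).mono fun ε h => h.1) (L3 k h1 h2)
  have hD : ∀ k, 1 ≤ k → k ≤ m - 1 → _ := fun k h1 h2 => asy_delta hlam0 hκ (hMpos k h2) hI
    ((L2 k h1 h2).mono fun ε h => h.2) (L1 k h1 (by omega)) (L4 k h1 h2)
  rw [← hC, ← ha1] at hD
  rw [← hC] at hR L6
  have hS : ∀ k, 1 ≤ k → k ≤ m - 1 → Asy κ (fun ε => log (ρ ε k) + log |deriv (u ε) (ρ ε k)| -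
      log |u ε (δ ε k)|) 0 (log (2 * lam)) := by
    intro k h1 h2
    refine (Asy.of_tendsto (κ := κ) ((L5 k h1 h2).add_const (log (2 * lam)))).conv ?_ rfl (by ring)
    filter_upwards [L2 k h1 h2, L1 k h1 (by omega), (hR k h1 h2).1] with ε h3 h4 h5
    rw [log_mul h3.1.ne' h5.ne', log_mul (by positivity) h4.ne']
    ring
  have hRk : ∀ (k : ℕ) (α β : ℝ), 1 ≤ k → k ≤ m - 1 → Asy κ (fun ε => log |u ε (δ ε k)|) α β →
      Asy κ (fun ε => log (ρ ε k)) ((1 / 2 - α) / lam)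
        ((lam / 2 * C + 1 / 2 * log ((m : ℝ) - k) - β) / lam) := by
    intro k α β h1 h2 h3
    apply inv_a_pert hlam0 hκ
    refine (((hR k h1 h2).2.sub (hS k h1 h2)).sub h3).conv ?_ (by ring) (by ring)
    filter_upwards with ε
    ring
  have hH : ∀ k, 1 ≤ k → k ≤ m →
      Asy κ (fun ε => log |u ε (δ ε k)|) (a1 - (k - 1)) (lam / 2 * C + a1 * M1 + c k) := by
    intro k h1
    induction k, h1 using Nat.le_induction with
    | base =>
      intro _
      refine (hD 1 le_rfl (by omega)).conv ?_ (by push_cast; ring) ?_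
      · have hp : 0 < 4 / ((n : ℝ) - 2) := div_pos (by norm_num) (by linarith)
        filter_upwards [Ioo_mem_nhdsGT hp] with ε h1
        rw [(hu ε h1).2.2.1]
        simp
      · rw [hc, hM1]
        push_cast
        rw [sub_add_cancel]; ring
    | succ k h1 ih =>
      intro h2
      have h3 := ih (by omega)
      have h4 := hRk k _ _ h1 (by omega) h3
      apply inv_mu_pert hlam0 hκ
      refine ((((Asy.of_tendsto (κ := κ) (L6 k h1 (by omega))).sub (hS k h1 (by omega))).sub
        h3).sub (h4.cmul (2 * lam))).conv ?_ ?_ ?_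
      · filter_upwards with ε
        ring
      · push_cast; field_simp; ring
      · rw [hc, hc]
        have h5 := hMpos k (by omega)
        have e : (m : ℝ) - ((k + 1 : ℕ) : ℝ) + 1 = m - k := by push_cast; ring
        rw [e, Real.Gamma_add_one h5.ne', log_mul h5.ne' (Real.Gamma_pos_of_pos h5).ne']
        field_simp
        ring
  refine ⟨fun k h1 h2 => ⟨L1 k h1 h2, hH k h1 h2⟩, fun k h1 h2 => ?_⟩
  have hHk := hH k h1 (by omega)
  have hRR := hRk k _ _ h1 h2 hHk
  refine ⟨⟨(L2 k h1 h2).mono fun ε h => h.2, ?_⟩, ⟨(L2 k h1 h2).mono fun ε h => h.1, ?_⟩,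
    ⟨(hR k h1 h2).1, ?_⟩⟩
  · apply inv_a_pert hlam0 hκ
    · refine ((hD k h1 h2).sub hHk).conv ?_ (by ring) (by ring)
      filter_upwards with ε
      ring
  · refine hRR.conv (by rfl) rfl (by ring)
  · refine (((hS k h1 h2).add hHk).sub hRR).conv ?_ (by ring) (by ring)
    filter_upwards with ε
    ring

/-- **Theorem 1.2 (Neumann case).** Sharp asymptotic rates and constants for the values
of a radial Neumann solution with `m-1` interior zeros at its critical points, the
positions of the critical points, the values of the derivative at the zeros, and the
positions of the zeros, as `ε → 0⁺`. -/
theorem neumann_asymptotics (n m : ℕ) (hn : 3 ≤ n) (hm : 2 ≤ m)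
    (u : ℝ → ℝ → ℝ) (ρ δ : ℝ → ℕ → ℝ)
    (hu : ∀ ε ∈ Set.Ioo (0 : ℝ) (4 / ((n : ℝ) - 2)),
      NeumannData n (pEps n ε) m (u ε) (ρ ε) (δ ε)) :
    (∀ k : ℕ, 1 ≤ k → k ≤ m →
      Tendsto (fun ε : ℝ => |u ε (δ ε k)| *
          (kappa n * ε) ^ ((2 * (k : ℝ) * (n : ℝ) - 3 * (n : ℝ) + 2) / (2 * (n : ℝ))))
        (𝓝[>] (0 : ℝ))
        (𝓝 (((n : ℝ) * ((n : ℝ) - 2)) ^ (((n : ℝ) - 2) / 4) *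
          ((m : ℝ) - 1) ^ ((1 : ℝ) / 2 - 1 / (n : ℝ)) *
          Real.Gamma ((m : ℝ) - (k : ℝ) + 1) / Real.Gamma (m : ℝ)))) ∧
    (∀ k : ℕ, 2 ≤ k → k ≤ m - 1 →
      Tendsto (fun ε : ℝ => δ ε k *
          (kappa n * ε) ^ (-(2 * ((k : ℝ) - 1)) / ((n : ℝ) - 2)))
        (𝓝[>] (0 : ℝ))
        (𝓝 (((m : ℝ) - 1) ^ (-(1 : ℝ) / (n : ℝ)) * ((m : ℝ) - (k : ℝ)) ^ ((1 : ℝ) / (n : ℝ)) *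
          (Real.Gamma (m : ℝ) / Real.Gamma ((m : ℝ) - (k : ℝ) + 1)) ^ ((2 : ℝ) / ((n : ℝ) - 2))))) ∧
    (∀ k : ℕ, 1 ≤ k → k ≤ m - 1 →
      Tendsto (fun ε : ℝ => |deriv (u ε) (ρ ε k)| *
          (kappa n * ε) ^ ((2 * (k : ℝ) * (n : ℝ) - 3 * (n : ℝ) + 4) / (2 * ((n : ℝ) - 2))))
        (𝓝[>] (0 : ℝ))
        (𝓝 ((n : ℝ) ^ (((n : ℝ) - 2) / 4) * ((n : ℝ) - 2) ^ (((n : ℝ) + 2) / 4) *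
          ((m : ℝ) - 1) ^ ((1 : ℝ) / 2) * ((m : ℝ) - (k : ℝ)) ^ (-(1 : ℝ) / ((n : ℝ) - 2)) *
          (Real.Gamma ((m : ℝ) - (k : ℝ) + 1) / Real.Gamma (m : ℝ)) ^ ((n : ℝ) / ((n : ℝ) - 2))))) ∧
    (∀ k : ℕ, 1 ≤ k → k ≤ m - 1 →
      Tendsto (fun ε : ℝ => ρ ε k *
          (kappa n * ε) ^ (-(2 * (k : ℝ) * (n : ℝ) - 2 * (n : ℝ) + 2) / ((n : ℝ) * ((n : ℝ) - 2))))
        (𝓝[>] (0 : ℝ))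
        (𝓝 (((m : ℝ) - 1) ^ (-(1 : ℝ) / (n : ℝ)) *
          ((m : ℝ) - (k : ℝ)) ^ ((1 : ℝ) / ((n : ℝ) - 2)) *
          (Real.Gamma (m : ℝ) / Real.Gamma ((m : ℝ) - (k : ℝ) + 1)) ^ ((2 : ℝ) / ((n : ℝ) - 2))))) := by
  have hn3 : (3 : ℝ) ≤ n := by exact_mod_cast hn
  have hn2 : 0 < (n : ℝ) - 2 := by linarith
  have hn0 : 0 < (n : ℝ) := by linarith
  have hm2 : (2 : ℝ) ≤ m := by exact_mod_cast hm
  have hm1 : 0 < (m : ℝ) - 1 := by linarith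
  have hGm : 0 < Real.Gamma (m : ℝ) := Real.Gamma_pos_of_pos (by linarith)
  have hGk : ∀ k : ℕ, k ≤ m → 0 < Real.Gamma ((m : ℝ) - k + 1) := by
    intro k hk
    have : (k : ℝ) ≤ m := by exact_mod_cast hk
    exact Real.Gamma_pos_of_pos (by linarith)
  have hMk : ∀ k : ℕ, 1 ≤ k → k ≤ m - 1 → 0 < (m : ℝ) - k := by
    intro k h1 hk
    have : (k : ℝ) < m := by exact_mod_cast (show k < m by omega)
    linarith
  have hκ : 0 < kappa n := by
    unfold kappa
    have h1 : 0 < Real.Gamma ((n : ℝ) / 2) := Real.Gamma_pos_of_pos (by positivity)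
    have h2 : 0 < Real.Gamma (n : ℝ) := Real.Gamma_pos_of_pos hn0
    positivity
  obtain ⟨lam, hlam⟩ : ∃ lam : ℝ, lam = ((n : ℝ) - 2) / 2 := ⟨_, rfl⟩
  have hlam0 : 0 < lam := by rw [hlam]; positivity
  have hA : 4 * lam * (lam + 1) = (n : ℝ) * ((n : ℝ) - 2) := by rw [hlam]; ring
  have hI : Ibub lam = kappa n * (4 * lam * (lam + 1)) ^ lam := by
    rw [Ibub_eq hlam0]
    unfold kappa
    rw [show lam + 1 = (n : ℝ) / 2 by rw [hlam]; ring, show 2 * lam + 2 = (n : ℝ) by rw [hlam]; ring,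
      show lam / 2 = ((n : ℝ) - 2) / 4 by rw [hlam]; ring,
      show 4 * (lam * ((n : ℝ) / 2)) = 4 * lam * ((n : ℝ) / 2) by ring]
  obtain ⟨K1, K2⟩ := neumann_logs hn hm hlam hκ hI hu rfl rfl rfl (fun _ => rfl)
  have hC : log (4 * lam * (lam + 1)) = log (n : ℝ) + log ((n : ℝ) - 2) := by
    rw [hA, log_mul hn0.ne' hn2.ne']
  have ha1 : lam / (2 * (lam + 1)) = 1 / 2 - 1 / (n : ℝ) := by
    rw [show 2 * (lam + 1) = (n : ℝ) by rw [hlam]; ring, hlam]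
    field_simp
  have h2lam : log (2 * lam) = log ((n : ℝ) - 2) := by rw [hlam]; congr 1; ring
  rw [hC, ha1, h2lam] at K2
  rw [hC, ha1] at K1
  refine ⟨fun k h1 h2 => ?_, fun k h1 h2 => ?_, fun k h1 h2 => ?_, fun k h1 h2 => ?_⟩
  · have g := hGk k h2
    obtain ⟨p1, p2⟩ := K1 k h1 h2
    have q1 : 0 < ((n : ℝ) * ((n : ℝ) - 2)) ^ (((n : ℝ) - 2) / 4) := rpow_pos_of_pos (by positivity) _
    have q2 : 0 < ((m : ℝ) - 1) ^ ((1 : ℝ) / 2 - 1 / (n : ℝ)) := rpow_pos_of_pos hm1 _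
    refine Asy.concl hκ p1 p2 ?_ (by positivity) ?_
    · field_simp; ring
    · rw [log_div (by positivity) hGm.ne', log_mul (by positivity) g.ne', log_mul q1.ne' q2.ne',
        log_rpow (by positivity), log_rpow hm1, log_mul hn0.ne' hn2.ne', hlam]
      ring
  · have g := hGk k (by omega)
    have hk := hMk k (by omega) h2
    obtain ⟨⟨p1, p2⟩, -⟩ := K2 k (by omega) h2
    have q1 : 0 < ((m : ℝ) - 1) ^ (-(1 : ℝ) / (n : ℝ)) := rpow_pos_of_pos hm1 _
    have q2 : 0 < ((m : ℝ) - (k : ℝ)) ^ ((1 : ℝ) / (n : ℝ)) := rpow_pos_of_pos hk _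
    have q3 : 0 < (Real.Gamma (m : ℝ) / Real.Gamma ((m : ℝ) - (k : ℝ) + 1)) ^ ((2 : ℝ) / ((n : ℝ) - 2)) :=
      rpow_pos_of_pos (by positivity) _
    refine Asy.concl hκ p1 p2 ?_ (by positivity) ?_
    · rw [hlam]; field_simp
    · rw [log_mul (by positivity) q3.ne', log_mul q1.ne' q2.ne', log_rpow hm1, log_rpow hk,
        log_rpow (by positivity), log_div hGm.ne' g.ne', hlam]
      field_simp
      ring
  · have g := hGk k (by omega)
    have hk := hMk k (by omega) h2
    obtain ⟨-, -, ⟨p1, p2⟩⟩ := K2 k (by omega) h2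
    have q1 : 0 < (n : ℝ) ^ (((n : ℝ) - 2) / 4) := rpow_pos_of_pos hn0 _
    have q2 : 0 < ((n : ℝ) - 2) ^ (((n : ℝ) + 2) / 4) := rpow_pos_of_pos hn2 _
    have q3 : 0 < ((m : ℝ) - 1) ^ ((1 : ℝ) / 2) := rpow_pos_of_pos hm1 _
    have q4 : 0 < ((m : ℝ) - (k : ℝ)) ^ (-(1 : ℝ) / ((n : ℝ) - 2)) := rpow_pos_of_pos hk _
    have q5 : 0 < (Real.Gamma ((m : ℝ) - (k : ℝ) + 1) / Real.Gamma (m : ℝ)) ^ ((n : ℝ) / ((n : ℝ) - 2)) :=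
      rpow_pos_of_pos (by positivity) _
    refine Asy.concl hκ p1 p2 ?_ (by positivity) ?_
    · rw [hlam]; field_simp; ring
    · rw [log_mul (by positivity) q5.ne', log_mul (by positivity) q4.ne', log_mul (by positivity) q3.ne',
        log_mul q1.ne' q2.ne', log_rpow hn0, log_rpow hn2, log_rpow hm1, log_rpow hk,
        log_rpow (by positivity), log_div g.ne' hGm.ne', hlam]
      field_simp
      ring
  · have g := hGk k (by omega)
    have hk := hMk k (by omega) h2
    obtain ⟨-, ⟨p1, p2⟩, -⟩ := K2 k (by omega) h2
    have q1 : 0 < ((m : ℝ) - 1) ^ (-(1 : ℝ) / (n : ℝ)) := rpow_pos_of_pos hm1 _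
    have q2 : 0 < ((m : ℝ) - (k : ℝ)) ^ ((1 : ℝ) / ((n : ℝ) - 2)) := rpow_pos_of_pos hk _
    have q3 : 0 < (Real.Gamma (m : ℝ) / Real.Gamma ((m : ℝ) - (k : ℝ) + 1)) ^ ((2 : ℝ) / ((n : ℝ) - 2)) :=
      rpow_pos_of_pos (by positivity) _
    refine Asy.concl hκ p1 p2 ?_ (by positivity) ?_
    · rw [hlam]; field_simp; ring
    · rw [log_mul (by positivity) q3.ne', log_mul q1.ne' q2.ne', log_rpow hm1, log_rpow hk,
        log_rpow (by positivity), log_div hGm.ne' g.ne', hlam]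
      field_simp
      ring
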